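/- arXiv:math/9905020 — 4 statements merged into one kernel-verified Lean document; each statement's English description precedes it below -/
import Mathlib

section
/- Any two smooth immersions of the unit 2-sphere into Euclidean 3-space are regularly homotopic. That is, if f, g : S² → ℝ³ are smooth maps whose differential at every point of S² is injective, then there exists a smooth map H : [0,1] × S² → ℝ³ such that H(0,·) = f, H(1,·) = g, and for every t ∈ [0,1] the map H(t,·) : S² → ℝ³ has injective differential at every point. -/
open Metric Manifold

noncomputable section

/-- Euclidean 3-space. -/
abbrev E3 : Type := EuclideanSpace ℝ (Fin 3)

/-- The unit 2-sphere in Euclidean 3-space, with its standard smooth structure. -/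
abbrev S2 : Type := Metric.sphere (0 : E3) 1

/-- A smooth immersion of the sphere into 3-space: a smooth map whose manifold
differential is injective at every point. -/
def IsImmersion (f : S2 → E3) : Prop :=
  ContMDiff (𝓡 2) 𝓘(ℝ, E3) (⊤ : ℕ∞) f ∧
    ∀ x : S2, Function.Injective (mfderiv (𝓡 2) 𝓘(ℝ, E3) f x)

/-- A regular homotopy between `f` and `g`: a smooth map `H : [0,1] × S² → ℝ³`
with `H(0,·) = f`, `H(1,·) = g`, such that each `H(t,·)` is an immersion. -/
def RegularHomotopic (f g : S2 → E3) : Prop :=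
  ∃ H : Set.Icc (0 : ℝ) 1 × S2 → E3,
    ContMDiff ((𝓡∂ 1).prod (𝓡 2)) 𝓘(ℝ, E3) (⊤ : ℕ∞) H ∧
    (∀ x : S2, H (⟨0, by norm_num⟩, x) = f x) ∧
    (∀ x : S2, H (⟨1, by norm_num⟩, x) = g x) ∧
    (∀ t : Set.Icc (0 : ℝ) 1, IsImmersion (fun x : S2 => H (t, x)))

section Aux
open scoped ContDiff
open Set Filter Topology

abbrev P2 : Type := EuclideanSpace ℝ (Fin 2)

lemma isOpen_inj : IsOpen {L : P2 →L[ℝ] E3 | Function.Injective L} := by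
  rw [Metric.isOpen_iff]
  intro L hL
  obtain ⟨K, hK, hA⟩ := (L : P2 →ₗ[ℝ] E3).exists_antilipschitzWith (LinearMap.ker_eq_bot.mpr hL)
  refine ⟨(K : ℝ)⁻¹, by positivity, ?_⟩
  intro M hM
  rw [mem_ball, dist_eq_norm] at hM
  refine (injective_iff_map_eq_zero M).mpr fun v hv => ?_
  by_contra hne
  have hv0 : 0 < ‖v‖ := norm_pos_iff.mpr hne
  have h1 : ‖v‖ ≤ K * ‖L v‖ := by
    have := hA.le_mul_dist v 0
    simpa [dist_eq_norm] using this
  have h2 : ‖L v‖ ≤ ‖M - L‖ * ‖v‖ := by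
    have := (M - L).le_opNorm v
    simpa [hv, norm_neg] using this
  have hKp : (0 : ℝ) < K := by exact_mod_cast hK
  have : ‖M - L‖ * ‖v‖ < (K : ℝ)⁻¹ * ‖v‖ := by gcongr
  have h3 : K * ‖L v‖ < K * ((K : ℝ)⁻¹ * ‖v‖) := by
    apply mul_lt_mul_of_pos_left _ hKp; linarith
  rw [← mul_assoc, mul_inv_cancel₀ hKp.ne', one_mul] at h3
  linarith

/-- partial derivative structure of the corrugated map -/
lemma corr_fderiv (b : ℝ × P2 → E3) (G : ℝ × P2 × P2 → E3) (hb : ContDiff ℝ ∞ b)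
    (hG : ContDiff ℝ ∞ G) (t ε : ℝ) (hε : ε ≠ 0) (x v : P2) :
    fderiv ℝ (fun y => b (t, y) + ε • G (t, y, ε⁻¹ • y)) x v =
      fderiv ℝ b (t, x) (0, v) + fderiv ℝ G (t, x, ε⁻¹ • x) (0, ε • v, v) := by
  have hb' := (hb.differentiable (by simp)).differentiableAt (x := (t, x)) |>.hasFDerivAt
  have hG' := (hG.differentiable (by simp)).differentiableAt (x := (t, x, ε⁻¹ • x)) |>.hasFDerivAt
  have h1 : HasFDerivAt (fun y : P2 => (t, y)) ((0 : P2 →L[ℝ] ℝ).prod (.id ℝ P2)) x :=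
    (hasFDerivAt_const t x).prodMk (hasFDerivAt_id x)
  have h2 : HasFDerivAt (fun y : P2 => (t, y, ε⁻¹ • y))
      ((0 : P2 →L[ℝ] ℝ).prod ((ContinuousLinearMap.id ℝ P2).prod (ε⁻¹ • .id ℝ P2))) x :=
    (hasFDerivAt_const t x).prodMk ((hasFDerivAt_id x).prodMk ((hasFDerivAt_id x).const_smul ε⁻¹))
  have h3 := (HasFDerivAt.comp x hb' h1).add ((HasFDerivAt.comp x hG' h2).const_smul ε)
  have h4 := h3.fderiv
  have h5 : fderiv ℝ (fun y => b (t, y) + ε • G (t, y, ε⁻¹ • y)) x = _ := h4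
  rw [h5]
  simp only [ContinuousLinearMap.add_apply, ContinuousLinearMap.smul_apply,
    ContinuousLinearMap.comp_apply, ContinuousLinearMap.prod_apply, ContinuousLinearMap.zero_apply,
    ContinuousLinearMap.id_apply]
  rw [← map_smul]
  simp [smul_smul, hε]

lemma corr_main (b : ℝ × P2 → E3) (G : ℝ × P2 × P2 → E3) (hb : ContDiff ℝ ∞ b)
    (hG : ContDiff ℝ ∞ G) (C ρ : ℝ)
    (hper : ∀ θ : P2, ∃ τ : P2, ‖θ + τ‖ ≤ C ∧ ∀ t x θ', G (t, x, θ' + τ) = G (t, x, θ'))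
    (hinj : ∀ t ∈ Icc (0 : ℝ) 1, ∀ x : P2, ‖x‖ ≤ ρ → ∀ θ : P2, ∀ v : P2,
      fderiv ℝ b (t, x) (0, v) + fderiv ℝ G (t, x, θ) (0, 0, v) = 0 → v = 0) :
    ∀ᶠ ε in 𝓝[>] (0 : ℝ), ∀ t ∈ Icc (0 : ℝ) 1, ∀ x : P2, ‖x‖ ≤ ρ →
      Function.Injective (fderiv ℝ (fun y => b (t, y) + ε • G (t, y, ε⁻¹ • y)) x) := by
  let P : ℝ × (ℝ × P2 × P2) → (P2 →L[ℝ] E3) := fun z =>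
    (fderiv ℝ b (z.2.1, z.2.2.1)).comp ((0 : P2 →L[ℝ] ℝ).prod (.id ℝ P2)) +
    (fderiv ℝ G z.2).comp
      ((0 : P2 →L[ℝ] ℝ).prod ((z.1 • ContinuousLinearMap.id ℝ P2).prod (.id ℝ P2)))
  have hPc : Continuous P := by
    have e1 : Continuous (fderiv ℝ b) := hb.continuous_fderiv (by simp)
    have e2 : Continuous (fderiv ℝ G) := hG.continuous_fderiv (by simp)
    refine Continuous.add ?_ ?_
    · exact (e1.comp (by fun_prop)).clm_comp continuous_const
    · refine (e2.comp continuous_snd).clm_comp ?_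
      have : Continuous fun z : ℝ × (ℝ × P2 × P2) => 
          ContinuousLinearMap.prodₗᵢ ℝ ((0 : P2 →L[ℝ] ℝ), 
            ContinuousLinearMap.prodₗᵢ ℝ ((z.1 • ContinuousLinearMap.id ℝ P2), 
              (ContinuousLinearMap.id ℝ P2))) := by
        fun_prop
      exact this
  let K : Set (ℝ × P2 × P2) := Icc (0 : ℝ) 1 ×ˢ (closedBall (0 : P2) ρ ×ˢ closedBall (0 : P2) C)
  have hK : IsCompact K := isCompact_Icc.prod ((isCompact_closedBall _ _).prod (isCompact_closedBall _ _))
  have key : ∀ᶠ ε in 𝓝 (0 : ℝ), ∀ z ∈ K, Function.Injective (P (ε, z)) := by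
    apply hK.eventually_forall_of_forall_eventually
    rintro ⟨t, x, θ⟩ ⟨ht, hx, hθ⟩
    have : IsOpen (P ⁻¹' {L : P2 →L[ℝ] E3 | Function.Injective L}) := isOpen_inj.preimage hPc
    refine this.mem_nhds ?_
    refine (injective_iff_map_eq_zero _).mpr fun v hv => ?_
    refine hinj t ht x (by simpa using hx) θ v ?_
    simpa [P] using hv
  filter_upwards [nhdsWithin_le_nhds key, self_mem_nhdsWithin] with ε hε hpos t ht x hx
  have hpos : (0 : ℝ) < ε := hpos
  obtain ⟨τ, hτ, hGτ⟩ := hper (ε⁻¹ • x)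
  have h1 := hε (t, x, ε⁻¹ • x + τ) ⟨ht, by simpa using hx, by simpa using hτ⟩
  have hfd : fderiv ℝ G (t, x, ε⁻¹ • x + τ) = fderiv ℝ G (t, x, ε⁻¹ • x) := by
    have : (fun z => G (z + ((0 : ℝ), (0 : P2), τ))) = G := by
      funext ⟨a, c, d⟩
      simpa using hGτ a c d
    conv_rhs => rw [← this, fderiv_comp_add_right]
    simp
  refine (injective_iff_map_eq_zero _).mpr fun v hv => ?_
  rw [corr_fderiv b G hb hG t ε hpos.ne' x v] at hv
  apply (injective_iff_map_eq_zero _).mp h1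
  simpa [P, hfd] using hv

/-- The periodic corrugation map. -/
def psi (z : ℝ × ℝ × P2) : E3 :=
  !₂[-z.2.1 * Real.sin (2 * z.2.2 0) - z.2.1 / 8 * Real.sin (8 * z.2.2 1) * (z.2.1 * Real.cos (z.2.2 0)),
     -(z.2.1 / 8) * Real.sin (16 * z.2.2 1),
     z.2.1 * Real.sin (z.2.2 0) + z.2.1 / 8 * Real.sin (8 * z.2.2 1) *
       (z.1 - 2 * z.2.1 * Real.cos (2 * z.2.2 0))]

lemma psi_contDiff : ContDiff ℝ ∞ psi := by
  rw [contDiff_euclidean]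
  have h0 : ContDiff ℝ ∞ (fun z : ℝ × ℝ × P2 => z.2.2 0) :=
    (contDiff_euclidean.mp (contDiff_snd.comp contDiff_snd)) 0
  have h1 : ContDiff ℝ ∞ (fun z : ℝ × ℝ × P2 => z.2.2 1) :=
    (contDiff_euclidean.mp (contDiff_snd.comp contDiff_snd)) 1
  intro i
  fin_cases i <;> simp [psi] <;> fun_prop

lemma psi_zero (l : ℝ) (θ : P2) : psi (l, 0, θ) = 0 := by
  ext i; fin_cases i <;> simp [psi]

lemma psi_periodic (θ : P2) : ∃ τ : P2, ‖θ + τ‖ ≤ 20 ∧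
    ∀ l s θ', psi (l, s, θ' + τ) = psi (l, s, θ') := by
  let m : ℤ := -⌊θ 0 / (2 * Real.pi)⌋
  let n : ℤ := -⌊θ 1 / (2 * Real.pi)⌋
  have hb : ∀ a : ℝ, |a + (-⌊a / (2 * Real.pi)⌋ : ℤ) * (2 * Real.pi)| ≤ 8 := by
    intro a
    have hpi := Real.pi_pos
    have hpi4 := Real.pi_lt_d2
    have h1 := Int.floor_le (a / (2 * Real.pi))
    have h2 := Int.lt_floor_add_one (a / (2 * Real.pi))
    rw [le_div_iff₀ (by positivity)] at h1
    rw [div_lt_iff₀ (by positivity)] at h2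
    push_cast
    rw [abs_le]; constructor <;> nlinarith
  refine ⟨!₂[m * (2 * Real.pi), n * (2 * Real.pi)], ?_, ?_⟩
  · rw [EuclideanSpace.norm_eq, Real.sqrt_le_left (by norm_num)]
    simp only [Fin.sum_univ_two, Real.norm_eq_abs, sq_abs]
    have e0 := sq_le_sq' (abs_le.mp (hb (θ 0))).1 (abs_le.mp (hb (θ 0))).2
    have e1 := sq_le_sq' (abs_le.mp (hb (θ 1))).1 (abs_le.mp (hb (θ 1))).2
    simp [m, n] at e0 e1 ⊢
    nlinarith
  · intro l s θ'
    have a1 : Real.sin (2 * (θ' 0 + m * (2 * Real.pi))) = Real.sin (2 * θ' 0) := by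
      rw [← Real.sin_add_int_mul_two_pi (2 * θ' 0) (2 * m)]; congr 1; push_cast; ring
    have a2 : Real.cos (2 * (θ' 0 + m * (2 * Real.pi))) = Real.cos (2 * θ' 0) := by
      rw [← Real.cos_add_int_mul_two_pi (2 * θ' 0) (2 * m)]; congr 1; push_cast; ring
    have a3 : Real.sin (8 * (θ' 1 + n * (2 * Real.pi))) = Real.sin (8 * θ' 1) := by
      rw [← Real.sin_add_int_mul_two_pi (8 * θ' 1) (8 * n)]; congr 1; push_cast; ring
    have a4 : Real.sin (16 * (θ' 1 + n * (2 * Real.pi))) = Real.sin (16 * θ' 1) := by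
      rw [← Real.sin_add_int_mul_two_pi (16 * θ' 1) (16 * n)]; congr 1; push_cast; ring
    simp [psi, a1, a2, a3, a4]

/-- derivative of psi in the angle variable -/
def dpsi (l s : ℝ) (θ v : P2) : E3 :=
  !₂[(-2 * s * Real.cos (2 * θ 0) + s ^ 2 / 8 * Real.sin (8 * θ 1) * Real.sin (θ 0)) * v 0
        - s ^ 2 * Real.cos (8 * θ 1) * Real.cos (θ 0) * v 1,
     -2 * s * Real.cos (16 * θ 1) * v 1,
     (s * Real.cos (θ 0) + s ^ 2 / 2 * Real.sin (8 * θ 1) * Real.sin (2 * θ 0)) * v 0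
        + s * Real.cos (8 * θ 1) * (l - 2 * s * Real.cos (2 * θ 0)) * v 1]

lemma fderiv_psi (l s : ℝ) (θ v : P2) : fderiv ℝ psi (l, s, θ) (0, 0, v) = dpsi l s θ v := by
  have hd := (psi_contDiff.differentiable (by simp)).differentiableAt (x := (l, s, θ)) |>.hasFDerivAt
  have hline : HasDerivAt (fun r : ℝ => ((l, s, θ + r • v) : ℝ × ℝ × P2)) (0, 0, v) 0 := by
    have h1 : HasDerivAt (fun r : ℝ => θ + r • v) v 0 := by
      simpa using ((hasDerivAt_id (0 : ℝ)).smul_const v).const_add θ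
    exact (hasDerivAt_const _ _).prodMk ((hasDerivAt_const _ _).prodMk h1)
  have hd' : HasFDerivAt psi (fderiv ℝ psi (l, s, θ)) ((fun r : ℝ => ((l, s, θ + r • v) : ℝ × ℝ × P2)) 0) := by
    simpa using hd
  have h := hd'.comp_hasDerivAt (0 : ℝ) hline
  have hu : ∀ i : Fin 2, HasDerivAt (fun r : ℝ => (θ + r • v) i) (v i) 0 := by
    intro i
    simpa using ((hasDerivAt_id (0 : ℝ)).mul_const (v i)).const_add (θ i)
  have hi : ∀ i : Fin 3, HasDerivAt (fun r : ℝ => psi (l, s, θ + r • v) i)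
      (fderiv ℝ psi (l, s, θ) (0, 0, v) i) 0 := by
    intro i
    exact (EuclideanSpace.proj i : E3 →L[ℝ] ℝ).hasFDerivAt.comp_hasDerivAt (0 : ℝ) h
  have s2 := ((hu 0).const_mul 2).sin
  have c2 := ((hu 0).const_mul 2).cos
  have s1 := (hu 0).sin
  have c1 := (hu 0).cos
  have s8 := ((hu 1).const_mul 8).sin
  have s16 := ((hu 1).const_mul 16).sin
  ext i
  refine (hi i).unique ?_
  fin_cases i
  · simp only [psi, dpsi]
    have := (s2.const_mul (-s)).sub ((s8.const_mul (s / 8)).mul (c1.const_mul s))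
    refine HasDerivAt.congr_deriv (f := fun r : ℝ => _) this ?_
    simp
    ring
  · simp only [psi, dpsi]
    have := (s16.const_mul (-(s/8)))
    refine HasDerivAt.congr_deriv (f := fun r : ℝ => _) this ?_
    simp
    ring
  · simp only [psi, dpsi]
    have := (s1.const_mul s).add ((s8.const_mul (s / 8)).mul ((c2.const_mul (2 * s)).const_sub l))
    refine HasDerivAt.congr_deriv (f := fun r : ℝ => _) this ?_
    simp
    ring

def iota (v : P2) : E3 := !₂[v 0, v 1, 0]

lemma key_pos (s S X n : ℝ) (hs : 0 ≤ s) (hs1 : s ≤ 1) (hS : S ^ 2 ≤ 1) (hnp : 0 < n)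
    (hn : 48 / 100 * s ^ 2 ≤ n) (hX : X ^ 2 ≤ 17 * n) : 0 < n + s ^ 2 / 8 * S * X := by
  have e1 : (s ^ 2 / 8 * S * X) ^ 2 < n ^ 2 := by
    have hs2 : s ^ 2 ≤ 1 := pow_le_one₀ hs hs1
    have b1 : (s ^ 2) ^ 2 ≤ s ^ 2 := by
      rw [sq (s ^ 2)]; exact mul_le_of_le_one_left (sq_nonneg s) hs2
    have b2 : (s ^ 2) ^ 2 * S ^ 2 ≤ s ^ 2 := 
      (mul_le_of_le_one_right (sq_nonneg _) hS).trans b1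
    have b3 : (s ^ 2) ^ 2 * S ^ 2 * X ^ 2 ≤ s ^ 2 * (17 * n) :=
      mul_le_mul b2 hX (sq_nonneg _) (sq_nonneg _)
    have b4 : s ^ 2 * (17 * n) ≤ (100 / 48 * n) * (17 * n) := by
      apply mul_le_mul_of_nonneg_right _ (by linarith); linarith
    have : (s ^ 2 / 8 * S * X) ^ 2 = (s ^ 2) ^ 2 * S ^ 2 * X ^ 2 / 64 := by ring
    rw [this]
    have := mul_pos hnp hnp
    linarith
  have := abs_lt_of_sq_lt_sq e1 hnp.le
  linarith [(abs_lt.mp this).1]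

lemma key_alg (l s c1 c3 S w su s2u p q cu v0 v1 : ℝ) (hl : 0 ≤ l) (hs : 0 ≤ s) (hs1 : s ≤ 1)
    (hne : 0 < l + s) (hc1 : c1 = l - 2 * s * (2 * cu ^ 2 - 1)) (hc3 : c3 = s * cu)
    (hp : p = l - 2 * s * (2 * w ^ 2 - 1)) (hq : q = s * w) (hS : S ^ 2 ≤ 1) (hsu : su ^ 2 ≤ 1)
    (hs2u : s2u ^ 2 ≤ 1)
    (h1 : v0 * (c1 + s ^ 2 / 8 * S * su) - q * c3 * v1 = 0) (h2 : p * v1 = 0)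
    (h3 : v0 * (c3 + s ^ 2 / 2 * S * s2u) + q * c1 * v1 = 0) : v0 = 0 ∧ v1 = 0 := by
  have gen : ∀ w : ℝ, 48 / 100 * s ^ 2 ≤ (l - 2 * s * (2 * w ^ 2 - 1)) ^ 2 + (s * w) ^ 2 := by
    intro w
    rcases le_total (w ^ 2) (1 / 2) with h | h
    · have : 0 ≤ s * (1 - 2 * w ^ 2) := mul_nonneg hs (by linarith)
      have e1 : (2 * (s * (1 - 2 * w ^ 2))) ^ 2 ≤ (l - 2 * s * (2 * w ^ 2 - 1)) ^ 2 := by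
        apply pow_le_pow_left₀ (by linarith); nlinarith
      have e2 : 48 / 100 * s ^ 2 ≤ (2 * (s * (1 - 2 * w ^ 2))) ^ 2 + (s * w) ^ 2 := by
        have : 48 / 100 ≤ (2 * (1 - 2 * w ^ 2)) ^ 2 + w ^ 2 := by
          nlinarith [sq_nonneg (w ^ 2 - 15 / 32)]
        nlinarith [sq_nonneg s]
      linarith
    · nlinarith [sq_nonneg (l - 2 * s * (2 * w ^ 2 - 1)), sq_nonneg s]
  have pos : ∀ w : ℝ, 0 < (l - 2 * s * (2 * w ^ 2 - 1)) ^ 2 + (s * w) ^ 2 := by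
    intro w
    rcases hs.eq_or_lt with h | h
    · subst h; have : 0 < l := by linarith
      simp; positivity
    · have := gen w; have : 0 < s ^ 2 := by positivity
      linarith
  have hn := gen cu
  have hnp := pos cu
  rw [← hc1, ← hc3] at hn hnp
  have hpq := pos w
  rw [← hp, ← hq] at hpq
  have hX : (c1 * su + 4 * (c3 * s2u)) ^ 2 ≤ 17 * (c1 ^ 2 + c3 ^ 2) := by
    have a1 : (c1 * su) ^ 2 ≤ c1 ^ 2 := by rw [mul_pow]; nlinarith [sq_nonneg c1]
    have a2 : (c3 * s2u) ^ 2 ≤ c3 ^ 2 := by rw [mul_pow]; nlinarith [sq_nonneg c3]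
    nlinarith [sq_nonneg (4 * (c1 * su) - c3 * s2u)]
  have hbr : 0 < c1 ^ 2 + c3 ^ 2 + s ^ 2 / 8 * S * (c1 * su + 4 * (c3 * s2u)) := by
    exact key_pos _ _ _ _ hs hs1 hS hnp hn hX
  have hv0 : v0 = 0 := by
    have : v0 * (c1 ^ 2 + c3 ^ 2 + s ^ 2 / 8 * S * (c1 * su + 4 * (c3 * s2u))) = 0 := by
      linear_combination c1 * h1 + c3 * h3
    exact (mul_eq_zero.mp this).resolve_right hbr.ne'
  refine ⟨hv0, ?_⟩
  subst hv0
  have : v1 ^ 2 * ((p ^ 2 + q ^ 2) * (c1 ^ 2 + c3 ^ 2)) = 0 := by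
    have f1 : q * c3 * v1 = 0 := by linarith
    have f3 : q * c1 * v1 = 0 := by linarith
    linear_combination (p * v1 * (c1 ^ 2 + c3 ^ 2)) * h2 + q * c3 * v1 * f1 + q * c1 * v1 * f3
  have h5 := (mul_eq_zero.mp this).resolve_right (mul_pos hpq hnp).ne'
  exact pow_eq_zero_iff (two_ne_zero) |>.mp h5

lemma psi_key (l s : ℝ) (hl : 0 ≤ l) (hs : 0 ≤ s) (hs1 : s ≤ 1) (hne : 0 < l + s) (θ v : P2)
    (h : l • iota v + dpsi l s θ v = 0) : v = 0 := by
  have h0 := congrArg (fun w : E3 => w 0) h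
  have h1 := congrArg (fun w : E3 => w 1) h
  have h2 := congrArg (fun w : E3 => w 2) h
  simp [iota, dpsi] at h0 h1 h2
  have := key_alg l s (l - 2 * s * Real.cos (2 * θ 0)) (s * Real.cos (θ 0)) (Real.sin (8 * θ 1))
    (Real.cos (8 * θ 1)) (Real.sin (θ 0)) (Real.sin (2 * θ 0)) (l - 2 * s * Real.cos (16 * θ 1))
    (s * Real.cos (8 * θ 1)) (Real.cos (θ 0)) (v 0) (v 1) hl hs hs1 hne
    (by rw [Real.cos_two_mul]) rfl
    (by rw [show 16 * θ 1 = 2 * (8 * θ 1) by ring, Real.cos_two_mul]) rfl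
    (Real.sin_sq_le_one _) (Real.sin_sq_le_one _) (Real.sin_sq_le_one _)
    (by linear_combination h0) (by linear_combination h1) (by linear_combination h2)
  ext i
  fin_cases i
  · exact this.1
  · exact this.2

structure IsCut (R : ℝ) (χ : P2 → ℝ) : Prop where
  smooth : ContDiff ℝ ∞ χ
  nonneg : ∀ x, 0 ≤ χ x
  le_one : ∀ x, χ x ≤ 1
  inner : ∀ x, ‖x‖ ≤ R → χ x = 1
  outer : ∀ x, R + 1 ≤ ‖x‖ → χ x = 0

lemma exists_cut (R : ℝ) (hR : 0 < R) : ∃ χ, IsCut R χ := by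
  let f : ContDiffBump (0 : P2) := ⟨R, R + 1, hR, by linarith⟩
  refine ⟨f, f.contDiff, fun x => f.nonneg, fun x => f.le_one, fun x hx => ?_, fun x hx => ?_⟩
  · exact f.one_of_mem_closedBall (by simpa [f] using hx)
  · exact f.zero_of_le_dist (by simpa [f] using hx)

def hcor (ε : ℝ) (b : P2 → E3) (Φ : P2 → E3 →L[ℝ] E3) (l s : P2 → ℝ) : P2 → E3 :=
  fun y => b y + ε • ((l y)⁻¹ • Φ y (psi (l y, s y, ε⁻¹ • y)))

lemma hcor_of_zero (ε : ℝ) (b : P2 → E3) (Φ : P2 → E3 →L[ℝ] E3) (l s : P2 → ℝ) (x : P2)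
    (h : s x = 0) : hcor ε b Φ l s x = b x := by
  simp [hcor, h, psi_zero]

def FSeg (f g : P2 → E3) : Prop :=
  ∃ K : ℝ × P2 → E3, ContDiff ℝ ∞ K ∧
    (∀ t ∈ Icc (0 : ℝ) 1, ∀ x, Function.Injective (fderiv ℝ (fun y => K (t, y)) x)) ∧
    (∃ ρ, ∀ t x, ρ ≤ ‖x‖ → K (t, x) = f x) ∧ (∀ x, K (0, x) = f x) ∧ (∀ x, K (1, x) = g x)

lemma fderiv_sliceR (b : ℝ × P2 → E3) (hb : ContDiff ℝ ∞ b) (t : ℝ) (x v : P2) :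
    fderiv ℝ (fun y => b (t, y)) x v = fderiv ℝ b (t, x) (0, v) := by
  have hb' := (hb.differentiable (by simp)).differentiableAt (x := (t, x)) |>.hasFDerivAt
  have h1 : HasFDerivAt (fun y : P2 => (t, y)) ((0 : P2 →L[ℝ] ℝ).prod (.id ℝ P2)) x :=
    (hasFDerivAt_const t x).prodMk (hasFDerivAt_id x)
  have h3 : HasFDerivAt (fun y => b (t, y)) _ x := HasFDerivAt.comp x hb' h1
  rw [h3.fderiv]
  simp

lemma leg (b : ℝ × P2 → E3) (Φ : ℝ × P2 → E3 →L[ℝ] E3) (l s : ℝ × P2 → ℝ)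
    (hb : ContDiff ℝ ∞ b) (hΦ : ContDiff ℝ ∞ Φ) (hl : ContDiff ℝ ∞ l) (hs : ContDiff ℝ ∞ s)
    (hlpos : ∀ z, 0 < l z) (ρ : ℝ)
    (hinj : ∀ t ∈ Icc (0 : ℝ) 1, ∀ x : P2, ‖x‖ ≤ ρ → ∀ θ v : P2,
      l (t, x) • fderiv ℝ b (t, x) (0, v) + Φ (t, x) (dpsi (l (t, x)) (s (t, x)) θ v) = 0 → v = 0) :
    ∀ᶠ ε in 𝓝[>] (0 : ℝ), ∀ t ∈ Icc (0 : ℝ) 1, ∀ x : P2, ‖x‖ ≤ ρ → Function.Injective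
      (fderiv ℝ (hcor ε (fun y => b (t, y)) (fun y => Φ (t, y)) (fun y => l (t, y))
        (fun y => s (t, y))) x) := by
  let G : ℝ × P2 × P2 → E3 := fun z =>
    (l (z.1, z.2.1))⁻¹ • Φ (z.1, z.2.1) (psi (l (z.1, z.2.1), s (z.1, z.2.1), z.2.2))
  have hp : ContDiff ℝ ∞ (fun z : ℝ × P2 × P2 => (z.1, z.2.1)) := by fun_prop
  have hG : ContDiff ℝ ∞ G := by
    refine ((hl.comp hp).inv fun z => (hlpos _).ne').smul ((hΦ.comp hp).clm_apply ?_)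
    exact psi_contDiff.comp ((hl.comp hp).prodMk ((hs.comp hp).prodMk (by fun_prop)))
  refine corr_main b G hb hG 20 ρ ?_ ?_
  · intro θ
    obtain ⟨τ, h1, h2⟩ := psi_periodic θ
    exact ⟨τ, h1, fun t x θ' => by simp only [G, h2]⟩
  · intro t ht x hx θ v hv
    refine hinj t ht x hx θ v ?_
    have hGd : fderiv ℝ G (t, x, θ) (0, 0, v) = (l (t, x))⁻¹ • Φ (t, x) (dpsi (l (t, x)) (s (t, x)) θ v) := by
      rw [← fderiv_psi]
      have d1 := (hG.differentiable (by simp)).differentiableAt (x := (t, x, θ)) |>.hasFDerivAt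
      have e1 : HasFDerivAt (fun y : P2 => (t, x, y))
          ((0 : P2 →L[ℝ] ℝ).prod ((0 : P2 →L[ℝ] P2).prod (.id ℝ P2))) θ :=
        (hasFDerivAt_const t θ).prodMk ((hasFDerivAt_const x θ).prodMk (hasFDerivAt_id θ))
      have d2 := (psi_contDiff.differentiable (by simp)).differentiableAt
        (x := (l (t, x), s (t, x), θ)) |>.hasFDerivAt
      have e2 : HasFDerivAt (fun y : P2 => (l (t, x), s (t, x), y))
          ((0 : P2 →L[ℝ] ℝ).prod ((0 : P2 →L[ℝ] ℝ).prod (.id ℝ P2))) θ :=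
        (hasFDerivAt_const _ θ).prodMk ((hasFDerivAt_const _ θ).prodMk (hasFDerivAt_id θ))
      have f1 : HasFDerivAt (G ∘ fun y => (t, x, y)) _ θ := HasFDerivAt.comp θ d1 e1
      have e3 := HasFDerivAt.comp θ d2 e2
      have e4 := ((Φ (t, x)).hasFDerivAt.comp θ e3).const_smul (l (t, x))⁻¹
      have f2 : HasFDerivAt (G ∘ fun y => (t, x, y)) _ θ := e4
      have := congrArg (fun L : P2 →L[ℝ] E3 => L v) (f1.unique f2)
      simpa using this
    rw [hGd] at hv
    have := congrArg (fun w => l (t, x) • w) hv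
    simpa [smul_smul, (hlpos (t, x)).ne'] using this

lemma hcor_contDiff (ε : ℝ) (b : ℝ × P2 → E3) (Φ : ℝ × P2 → E3 →L[ℝ] E3) (l s : ℝ × P2 → ℝ)
    (hb : ContDiff ℝ ∞ b) (hΦ : ContDiff ℝ ∞ Φ) (hl : ContDiff ℝ ∞ l) (hs : ContDiff ℝ ∞ s)
    (hlpos : ∀ z, 0 < l z) :
    ContDiff ℝ ∞ (fun z : ℝ × P2 => hcor ε (fun y => b (z.1, y)) (fun y => Φ (z.1, y))
      (fun y => l (z.1, y)) (fun y => s (z.1, y)) z.2) := by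
  unfold hcor
  have h1 : ContDiff ℝ ∞ (fun z : ℝ × P2 => psi (l z, s z, ε⁻¹ • z.2)) :=
    psi_contDiff.comp (hl.prodMk (hs.prodMk (by fun_prop)))
  have h2 : ContDiff ℝ ∞ (fun z : ℝ × P2 => (l z)⁻¹) := hl.inv fun z => (hlpos _).ne'
  have h3 := h2.smul (hΦ.clm_apply h1)
  have h4 : ContDiff ℝ ∞ (fun z : ℝ × P2 => ε • ((l z)⁻¹ • Φ z (psi (l z, s z, ε⁻¹ • z.2)))) :=
    h3.const_smul ε
  exact hb.add h4

/-- general segment -/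
lemma seg (b : ℝ × P2 → E3) (Φ : ℝ × P2 → E3 →L[ℝ] E3) (l s : ℝ × P2 → ℝ)
    (hb : ContDiff ℝ ∞ b) (hΦ : ContDiff ℝ ∞ Φ) (hl : ContDiff ℝ ∞ l) (hs : ContDiff ℝ ∞ s)
    (hlpos : ∀ z, 0 < l z) (ρ : ℝ) (f : P2 → E3)
    (hout : ∀ t x, ρ ≤ ‖x‖ → b (t, x) = f x ∧ s (t, x) = 0)
    (hf : ∀ x, ρ ≤ ‖x‖ → Function.Injective (fderiv ℝ f x))
    (hinj : ∀ t ∈ Icc (0 : ℝ) 1, ∀ x : P2, ‖x‖ ≤ ρ → ∀ θ v : P2,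
      l (t, x) • fderiv ℝ b (t, x) (0, v) + Φ (t, x) (dpsi (l (t, x)) (s (t, x)) θ v) = 0 → v = 0) :
    ∀ᶠ ε in 𝓝[>] (0 : ℝ), FSeg
      (hcor ε (fun y => b (0, y)) (fun y => Φ (0, y)) (fun y => l (0, y)) (fun y => s (0, y)))
      (hcor ε (fun y => b (1, y)) (fun y => Φ (1, y)) (fun y => l (1, y)) (fun y => s (1, y))) := by
  filter_upwards [leg b Φ l s hb hΦ hl hs hlpos ρ hinj] with ε hε
  refine ⟨_, hcor_contDiff ε b Φ l s hb hΦ hl hs hlpos, ?_, ⟨ρ, ?_⟩, fun x => rfl, fun x => rfl⟩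
  · intro t ht x
    rcases le_or_gt ‖x‖ ρ with hx | hx
    · exact hε t ht x hx
    · have : (fun y => hcor ε (fun y => b (t, y)) (fun y => Φ (t, y)) (fun y => l (t, y))
          (fun y => s (t, y)) y) =ᶠ[𝓝 x] f := by
        filter_upwards [(isOpen_lt continuous_const continuous_norm).mem_nhds hx] with y hy
        rw [hcor_of_zero _ _ _ _ _ _ (hout t y (le_of_lt hy)).2]
        exact (hout t y (le_of_lt hy)).1
      rw [this.fderiv_eq]
      exact hf x hx.le
  · intro t x hx
    rw [hcor_of_zero _ _ _ _ _ _ (hout t x hx).2, hcor_of_zero _ _ _ _ _ _ (hout 0 x hx).2]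
    exact (hout t x hx).1.trans (hout 0 x hx).1.symm

lemma legA (f : P2 → E3) (hf : ContDiff ℝ ∞ f) (Φ : P2 → E3 →L[ℝ] E3) (hΦ : ContDiff ℝ ∞ Φ)
    (hΦi : ∀ x, Function.Injective (Φ x)) (hΦf : ∀ x v, Φ x (iota v) = fderiv ℝ f x v)
    (hfi : ∀ x, Function.Injective (fderiv ℝ f x))
    (R : ℝ) (χ : P2 → ℝ) (hχ : IsCut R χ) (l0 : ℝ) (h0 : 0 < l0) (h1 : l0 < 1) :
    ∀ᶠ ε in 𝓝[>] (0 : ℝ), FSeg f (hcor ε f Φ (fun x => 1 - (1 - l0) * χ x) χ) := by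
  let σ := Real.smoothTransition
  have hσ : ContDiff ℝ ∞ σ := Real.smoothTransition.contDiff
  have hσ0 : ∀ t, 0 ≤ σ t := Real.smoothTransition.nonneg
  have hσ1 : ∀ t, σ t ≤ 1 := Real.smoothTransition.le_one
  have hs : ContDiff ℝ ∞ (fun z : ℝ × P2 => σ z.1 * χ z.2) :=
    (hσ.comp contDiff_fst).mul (hχ.smooth.comp contDiff_snd)
  have hpr : ∀ z : ℝ × P2, 0 ≤ σ z.1 * χ z.2 ∧ σ z.1 * χ z.2 ≤ 1 := fun z =>
    ⟨mul_nonneg (hσ0 _) (hχ.nonneg _), mul_le_one₀ (hσ1 _) (hχ.nonneg _) (hχ.le_one _)⟩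
  have hlpos : ∀ z : ℝ × P2, 0 < 1 - (1 - l0) * (σ z.1 * χ z.2) := fun z => by
    have := hpr z; nlinarith
  have key := seg (fun z => f z.2) (fun z => Φ z.2) (fun z => 1 - (1 - l0) * (σ z.1 * χ z.2))
    (fun z => σ z.1 * χ z.2) (hf.comp contDiff_snd) (hΦ.comp contDiff_snd)
    (contDiff_const.sub (contDiff_const.mul hs)) hs hlpos (R + 1) f
    (fun t x hx => ⟨rfl, by simp [hχ.outer x hx]⟩) (fun x _ => hfi x) ?_
  · filter_upwards [key] with ε hε
    have e0 : σ 0 = 0 := Real.smoothTransition.zero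
    have e1 : σ 1 = 1 := Real.smoothTransition.one
    simp only [e0, e1, zero_mul, one_mul] at hε
    convert hε using 1
    funext x
    rw [hcor_of_zero]
    rfl
  · intro t ht x hx θ v hv
    rw [← fderiv_sliceR (fun z => f z.2) (hf.comp contDiff_snd)] at hv
    simp only at hv
    rw [← hΦf, ← map_smul, ← map_add] at hv
    have := (injective_iff_map_eq_zero _).mp (hΦi x) _ hv
    exact psi_key _ _ (hlpos (t, x)).le (hpr (t, x)).1 (hpr (t, x)).2
      (by have := hlpos (t, x); have := (hpr (t, x)).1; simp only at *; linarith) θ v this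

lemma dpsi_periodic (θ : P2) : ∃ τ : P2, ‖θ + τ‖ ≤ 20 ∧ ∀ l s θ' v, dpsi l s (θ' + τ) v = dpsi l s θ' v := by
  obtain ⟨τ, h1, h2⟩ := psi_periodic θ
  refine ⟨τ, h1, fun l s θ' v => ?_⟩
  have : (fun z => psi (z + ((0 : ℝ), (0 : ℝ), τ))) = psi := by
    funext ⟨a, c, d⟩
    simpa using h2 a c d
  rw [← fderiv_psi, ← fderiv_psi]
  conv_rhs => rw [← this, fderiv_comp_add_right]
  simp

lemma dpsi_smul (l s c : ℝ) (θ v : P2) : dpsi l s θ (c • v) = c • dpsi l s θ v := by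
  rw [← fderiv_psi, ← fderiv_psi, ← map_smul]; simp

lemma dpsi_cont : Continuous (fun z : ℝ × P2 × P2 => dpsi z.1 1 z.2.1 z.2.2) := by
  have : (fun z : ℝ × P2 × P2 => dpsi z.1 1 z.2.1 z.2.2) =
      fun z => fderiv ℝ psi (z.1, 1, z.2.1) (0, 0, z.2.2) := by
    funext z; rw [fderiv_psi]
  rw [this]
  have e1 : Continuous (fderiv ℝ psi) := psi_contDiff.continuous_fderiv (by simp)
  exact (e1.comp (by fun_prop)).clm_apply (by fun_prop)

lemma legB (f0 f1 : P2 → E3) (hf0 : ContDiff ℝ ∞ f0) (hf1 : ContDiff ℝ ∞ f1)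
    (Φ : ℝ × P2 → E3 →L[ℝ] E3) (hΦ : ContDiff ℝ ∞ Φ)
    (hΦi : ∀ t ∈ Icc (0 : ℝ) 1, ∀ x, Function.Injective (Φ (t, x)))
    (R : ℝ) (χ : P2 → ℝ) (hχ : IsCut R χ)
    (hff : ∀ x, R ≤ ‖x‖ → f0 x = f1 x) (hdf : ∀ x, R ≤ ‖x‖ → fderiv ℝ f0 x = fderiv ℝ f1 x)
    (hΦf : ∀ t ∈ Icc (0 : ℝ) 1, ∀ x v, R ≤ ‖x‖ → Φ (t, x) (iota v) = fderiv ℝ f0 x v) 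
    (hfi : ∀ x, Function.Injective (fderiv ℝ f0 x)) :
    ∀ᶠ l0 in 𝓝[>] (0 : ℝ), ∀ᶠ ε in 𝓝[>] (0 : ℝ),
      FSeg (hcor ε f0 (fun x => Φ (0, x)) (fun x => 1 - (1 - l0) * χ x) χ)
        (hcor ε f1 (fun x => Φ (1, x)) (fun x => 1 - (1 - l0) * χ x) χ) := by
  let b : ℝ × P2 → E3 := fun z => f0 z.2 + z.1 • (f1 z.2 - f0 z.2)
  have hb : ContDiff ℝ ∞ b := (hf0.comp contDiff_snd).add
    (contDiff_fst.smul ((hf1.comp contDiff_snd).sub (hf0.comp contDiff_snd)))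
  have hbd : ∀ t x v, R ≤ ‖x‖ → fderiv ℝ b (t, x) (0, v) = fderiv ℝ f0 x v := by
    intro t x v hx
    rw [← fderiv_sliceR b hb]
    have d0 := (hf0.differentiable (by simp)).differentiableAt (x := x) |>.hasFDerivAt
    have d1 := (hf1.differentiable (by simp)).differentiableAt (x := x) |>.hasFDerivAt
    have : HasFDerivAt (fun y => b (t, y)) _ x := d0.add ((d1.sub d0).const_smul t)
    rw [this.fderiv, hdf x hx]
    simp
  have hQ : ∀ᶠ l0 in 𝓝 (0 : ℝ), ∀ z ∈ (Icc (0 : ℝ) 1 ×ˢ (closedBall (0 : P2) R ×ˢ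
      (closedBall (0 : P2) 20 ×ˢ sphere (0 : P2) 1))),
      l0 • fderiv ℝ b (z.1, z.2.1) (0, z.2.2.2) + Φ (z.1, z.2.1) (dpsi l0 1 z.2.2.1 z.2.2.2) ≠ 0 := by
    apply IsCompact.eventually_forall_of_forall_eventually
    · exact isCompact_Icc.prod ((isCompact_closedBall _ _).prod
        ((isCompact_closedBall _ _).prod (isCompact_sphere _ _)))
    · rintro ⟨t, x, θ, v⟩ ⟨ht, hx, hθ, hv⟩
      have hc : Continuous (fun w : ℝ × (ℝ × P2 × P2 × P2) =>
          w.1 • fderiv ℝ b (w.2.1, w.2.2.1) (0, w.2.2.2.2) +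
            Φ (w.2.1, w.2.2.1) (dpsi w.1 1 w.2.2.2.1 w.2.2.2.2)) := by
        have e1 : Continuous (fderiv ℝ b) := hb.continuous_fderiv (by simp)
        refine (continuous_fst.smul ((e1.comp (by fun_prop)).clm_apply (by fun_prop))).add ?_
        refine (hΦ.continuous.comp (by fun_prop)).clm_apply ?_
        exact dpsi_cont.comp (f := fun w : ℝ × (ℝ × P2 × P2 × P2) => (w.1, w.2.2.2.1, w.2.2.2.2)) (by fun_prop)
      refine (isOpen_ne.preimage hc).mem_nhds ?_
      simp only [mem_preimage, mem_ofPred_eq, zero_smul, zero_add]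
      intro h
      have h' := (injective_iff_map_eq_zero _).mp (hΦi t ht x) _ h
      have : v = 0 := psi_key 0 1 le_rfl zero_le_one le_rfl (by norm_num) θ v (by simpa using h')
      simp [this] at hv
  filter_upwards [nhdsWithin_le_nhds hQ, self_mem_nhdsWithin,
    nhdsWithin_le_nhds (Iio_mem_nhds (zero_lt_one' ℝ))] with l0 hl hpos hlt
  have hpos : (0 : ℝ) < l0 := hpos
  have hlt : l0 < 1 := hlt
  have hs : ContDiff ℝ ∞ (fun z : ℝ × P2 => χ z.2) := hχ.smooth.comp contDiff_snd
  have hlp : ∀ z : ℝ × P2, 0 < 1 - (1 - l0) * χ z.2 := fun z => by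
    have := hχ.nonneg z.2; have := hχ.le_one z.2; nlinarith
  have key := seg b Φ (fun z => 1 - (1 - l0) * χ z.2) (fun z => χ z.2) hb hΦ
    (contDiff_const.sub (contDiff_const.mul hs)) hs hlp (R + 1) f0
    (fun t x hx => ⟨by simp [b, hff x (by linarith)], hχ.outer x hx⟩) (fun x _ => hfi x) ?_
  · filter_upwards [key] with ε hε
    simpa [b] using hε
  · intro t ht x hx θ v hv
    rcases le_total R ‖x‖ with hxR | hxR
    · simp only [hbd t x v hxR] at hv
      rw [← hΦf t ht x v hxR, ← map_smul, ← map_add] at hv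
      have := (injective_iff_map_eq_zero _).mp (hΦi t ht x) _ hv
      exact psi_key _ _ (hlp (t, x)).le (hχ.nonneg x) (hχ.le_one x)
        (by have := hlp (t, x); have := hχ.nonneg x; simp only at *; linarith) θ v this
    · by_contra hne
      have hn : ‖v‖ ≠ 0 := norm_ne_zero_iff.mpr hne
      obtain ⟨τ, h1, h2⟩ := dpsi_periodic θ
      refine hl (t, x, θ + τ, ‖v‖⁻¹ • v) ⟨ht, by simpa using hxR, by simpa using h1, ?_⟩ ?_
      · simp [norm_smul, hn]
      · simp only [hχ.inner x hxR, mul_one, sub_sub_cancel] at hv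
        simp only [h2, dpsi_smul, map_smul]
        have : ((0 : ℝ), ‖v‖⁻¹ • v) = ‖v‖⁻¹ • ((0 : ℝ), v) := by simp
        rw [this, map_smul, smul_comm, ← smul_add, hv, smul_zero]

def e0 : E3 := !₂[1, 0, 0]
def e1 : E3 := !₂[0, 1, 0]
def cr (a b : E3) : E3 := !₂[a 1 * b 2 - a 2 * b 1, a 2 * b 0 - a 0 * b 2, a 0 * b 1 - a 1 * b 0]

def LI (a b : E3) : Prop := ∀ s t : ℝ, s • a + t • b = 0 → s = 0 ∧ t = 0

def Fr (p : E3 × E3) : E3 →L[ℝ] E3 :=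
  (EuclideanSpace.proj (0 : Fin 3) : E3 →L[ℝ] ℝ).smulRight p.1 +
  (EuclideanSpace.proj (1 : Fin 3) : E3 →L[ℝ] ℝ).smulRight p.2 +
  (EuclideanSpace.proj (2 : Fin 3) : E3 →L[ℝ] ℝ).smulRight (cr p.1 p.2)

lemma Fr_apply (p : E3 × E3) (w : E3) :
    Fr p w = w 0 • p.1 + w 1 • p.2 + w 2 • cr p.1 p.2 := by
  simp [Fr]

lemma Fr_iota (p : E3 × E3) (v : P2) : Fr p (iota v) = v 0 • p.1 + v 1 • p.2 := by
  simp [Fr_apply, iota]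

lemma E3_ext {a b : E3} (h0 : a 0 = b 0) (h1 : a 1 = b 1) (h2 : a 2 = b 2) : a = b := by
  ext i; fin_cases i <;> assumption

lemma Fr_e : Fr (e0, e1) = ContinuousLinearMap.id ℝ E3 := by
  ext w i
  fin_cases i <;> simp [Fr_apply, e0, e1, cr]

lemma coord_contDiff {X : Type*} [NormedAddCommGroup X] [NormedSpace ℝ X] {f : X → E3}
    (hf : ContDiff ℝ ∞ f) (i : Fin 3) : ContDiff ℝ ∞ (fun x => f x i) :=
  (EuclideanSpace.proj (𝕜 := ℝ) i : E3 →L[ℝ] ℝ).contDiff.comp hf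

lemma mk_contDiff {X : Type*} [NormedAddCommGroup X] [NormedSpace ℝ X] {f g h : X → ℝ}
    (hf : ContDiff ℝ ∞ f) (hg : ContDiff ℝ ∞ g) (hh : ContDiff ℝ ∞ h) :
    ContDiff ℝ ∞ (fun x => (!₂[f x, g x, h x] : E3)) := by
  rw [contDiff_euclidean]
  intro i
  fin_cases i
  · exact hf
  · exact hg
  · exact hh

lemma cr_contDiff {X : Type*} [NormedAddCommGroup X] [NormedSpace ℝ X] {a b : X → E3}
    (ha : ContDiff ℝ ∞ a) (hb : ContDiff ℝ ∞ b) : ContDiff ℝ ∞ (fun x => cr (a x) (b x)) := by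
  have A := coord_contDiff ha
  have B := coord_contDiff hb
  exact mk_contDiff (((A 1).mul (B 2)).sub ((A 2).mul (B 1)))
    (((A 2).mul (B 0)).sub ((A 0).mul (B 2))) (((A 0).mul (B 1)).sub ((A 1).mul (B 0)))

lemma Fr_contDiff {X : Type*} [NormedAddCommGroup X] [NormedSpace ℝ X] {p : X → E3 × E3}
    (hp : ContDiff ℝ ∞ p) : ContDiff ℝ ∞ (fun x => Fr (p x)) := by
  unfold Fr
  exact ((contDiff_const.smulRight hp.fst).add (contDiff_const.smulRight hp.snd)).add
    (contDiff_const.smulRight (cr_contDiff hp.fst hp.snd))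

lemma LI.ne_left {a b : E3} (h : LI a b) : a ≠ 0 := by
  intro h0
  have := (h 1 0 (by simp [h0])).1
  norm_num at this

lemma LI.cr_ne {a b : E3} (h : LI a b) : cr a b ≠ 0 := by
  intro h0
  have c0 : a 1 * b 2 - a 2 * b 1 = 0 := by simpa [cr] using congrArg (fun w : E3 => w 0) h0
  have c1 : a 2 * b 0 - a 0 * b 2 = 0 := by simpa [cr] using congrArg (fun w : E3 => w 1) h0
  have c2 : a 0 * b 1 - a 1 * b 0 = 0 := by simpa [cr] using congrArg (fun w : E3 => w 2) h0
  have k : ∀ i, a i = 0 := by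
    intro i
    have := (h (b i) (- a i) (by
      apply E3_ext <;> fin_cases i <;> simp <;> linarith)).2
    linarith
  exact h.ne_left (by ext i; simp [k i])

lemma Fr_inj {p : E3 × E3} (h : LI p.1 p.2) : Function.Injective (Fr p) := by
  refine (injective_iff_map_eq_zero _).mpr fun w hw => ?_
  obtain ⟨a, b⟩ := p
  simp only [Fr_apply] at hw h
  have hc := h.cr_ne
  have q0 : w 0 * a 0 + w 1 * b 0 + w 2 * cr a b 0 = 0 := by
    simpa using congrArg (fun w : E3 => w 0) hw
  have q1 : w 0 * a 1 + w 1 * b 1 + w 2 * cr a b 1 = 0 := by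
    simpa using congrArg (fun w : E3 => w 1) hw
  have q2 : w 0 * a 2 + w 1 * b 2 + w 2 * cr a b 2 = 0 := by
    simpa using congrArg (fun w : E3 => w 2) hw
  have c0 : cr a b 0 = a 1 * b 2 - a 2 * b 1 := by simp [cr]
  have c1 : cr a b 1 = a 2 * b 0 - a 0 * b 2 := by simp [cr]
  have c2 : cr a b 2 = a 0 * b 1 - a 1 * b 0 := by simp [cr]
  have hsq : w 2 * (cr a b 0 ^ 2 + cr a b 1 ^ 2 + cr a b 2 ^ 2) = 0 := by
    linear_combination cr a b 0 * q0 + cr a b 1 * q1 + cr a b 2 * q2 -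
      (w 0 * a 0 + w 1 * b 0) * c0 - (w 0 * a 1 + w 1 * b 1) * c1 - (w 0 * a 2 + w 1 * b 2) * c2
  have w2 : w 2 = 0 := by
    rcases mul_eq_zero.mp hsq with h' | h'
    · exact h'
    · exfalso; apply hc
      apply E3_ext <;> simp <;> nlinarith [sq_nonneg (cr a b 0), sq_nonneg (cr a b 1), sq_nonneg (cr a b 2)]
  rw [w2, zero_smul, add_zero] at hw
  obtain ⟨h1, h2⟩ := h _ _ hw
  apply E3_ext <;> simp [*]

def PSeg (R : ℝ) (p q : P2 → E3 × E3) : Prop :=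
  ∃ A : ℝ × P2 → E3 × E3, ContDiff ℝ ∞ A ∧
    (∀ t ∈ Icc (0 : ℝ) 1, ∀ x, LI (A (t, x)).1 (A (t, x)).2) ∧
    (∀ t ∈ Icc (0 : ℝ) 1, ∀ x, R ≤ ‖x‖ → A (t, x) = (e0, e1)) ∧
    (∀ x, A (0, x) = p x) ∧ (∀ x, A (1, x) = q x)

def b0 : P2 := EuclideanSpace.single 0 1
def b1 : P2 := EuclideanSpace.single 1 1

def dfr (f : P2 → E3) (x : P2) : E3 × E3 := (fderiv ℝ f x b0, fderiv ℝ f x b1)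

lemma P2_decomp (v : P2) : v = v 0 • b0 + v 1 • b1 := by
  ext i; fin_cases i <;> simp [b0, b1]

lemma dfr_apply (f : P2 → E3) (x v : P2) :
    fderiv ℝ f x v = v 0 • (dfr f x).1 + v 1 • (dfr f x).2 := by
  conv_lhs => rw [P2_decomp v]
  simp [dfr]

lemma dfr_LI {f : P2 → E3} {x : P2} (h : Function.Injective (fderiv ℝ f x)) :
    LI (dfr f x).1 (dfr f x).2 := by
  intro s t hst
  have : fderiv ℝ f x (s • b0 + t • b1) = 0 := by simpa [dfr] using hst
  have := (injective_iff_map_eq_zero _).mp h _ this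
  constructor
  · simpa [b0, b1] using congrArg (fun w : P2 => w 0) this
  · simpa [b0, b1] using congrArg (fun w : P2 => w 1) this

lemma dfr_contDiff {f : P2 → E3} (hf : ContDiff ℝ ∞ f) : ContDiff ℝ ∞ (dfr f) := by
  have : ContDiff ℝ ∞ (fderiv ℝ f) := hf.fderiv_right (by simp)
  exact (this.clm_apply contDiff_const).prodMk (this.clm_apply contDiff_const)

lemma exists_inv (F : P2 → E3 →L[ℝ] E3) (hF : ContDiff ℝ ∞ F)
    (hi : ∀ x, Function.Injective (F x)) :
    ∃ G : P2 → E3 →L[ℝ] E3, ContDiff ℝ ∞ G ∧ (∀ x w, F x (G x w) = w) ∧ (∀ x w, G x (F x w) = w) := by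
  let e : P2 → (E3 ≃L[ℝ] E3) := fun x =>
    (LinearEquiv.ofInjectiveEndo (F x : E3 →ₗ[ℝ] E3) (hi x)).toContinuousLinearEquiv
  have he : ∀ x, (e x : E3 →L[ℝ] E3) = F x := fun x => by ext1 w; rfl
  refine ⟨fun x => (F x).inverse, ?_, fun x w => ?_, fun x w => ?_⟩
  · rw [contDiff_iff_contDiffAt]
    intro x
    have := contDiffAt_map_inverse (𝕜 := ℝ) (n := ∞) (e x)
    rw [he] at this
    exact this.comp x hF.contDiffAt
  · show F x ((F x).inverse w) = w
    rw [← he, ContinuousLinearMap.inverse_equiv]; simp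
  · show (F x).inverse (F x w) = w
    rw [← he, ContinuousLinearMap.inverse_equiv]; simp

/-- one pair leg -/
lemma legP (f0 f1 : P2 → E3) (hf0 : ContDiff ℝ ∞ f0) (hf1 : ContDiff ℝ ∞ f1)
    (hfi : ∀ x, Function.Injective (fderiv ℝ f0 x))
    (R : ℝ) (χ : P2 → ℝ) (hχ : IsCut R χ)
    (hff : ∀ x, R ≤ ‖x‖ → f0 x = f1 x) (hdf : ∀ x, R ≤ ‖x‖ → fderiv ℝ f0 x = fderiv ℝ f1 x)
    (p q : P2 → E3 × E3) (h : PSeg R p q) :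
    ∀ᶠ l0 in 𝓝[>] (0 : ℝ), ∀ᶠ ε in 𝓝[>] (0 : ℝ),
      FSeg (hcor ε f0 (fun x => (Fr (dfr f0 x)).comp (Fr (p x))) (fun x => 1 - (1 - l0) * χ x) χ)
        (hcor ε f1 (fun x => (Fr (dfr f0 x)).comp (Fr (q x))) (fun x => 1 - (1 - l0) * χ x) χ) := by
  obtain ⟨A, hA, hLI, hout, h0, h1⟩ := h
  have := legB f0 f1 hf0 hf1 (fun z => (Fr (dfr f0 z.2)).comp (Fr (A z)))
    ((Fr_contDiff ((dfr_contDiff hf0).comp contDiff_snd)).clm_comp (Fr_contDiff hA))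
    (fun t ht x => ?_) R χ hχ hff hdf (fun t ht x v hx => ?_) hfi
  · simpa only [h0, h1] using this
  · exact (Fr_inj (dfr_LI (hfi x))).comp (Fr_inj (hLI t ht x))
  · simp only [hout t ht x hx, Fr_e]
    rw [dfr_apply, ← Fr_iota]
    rfl

lemma flat_legs (f g : P2 → E3) (hf : ContDiff ℝ ∞ f) (hg : ContDiff ℝ ∞ g)
    (hfi : ∀ x, Function.Injective (fderiv ℝ f x)) (hgi : ∀ x, Function.Injective (fderiv ℝ g x))
    (R : ℝ) (hR : 0 < R)
    (hff : ∀ x, R ≤ ‖x‖ → f x = g x) (hdf : ∀ x, R ≤ ‖x‖ → fderiv ℝ f x = fderiv ℝ g x)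
    (p1 p2 p3 : P2 → E3 × E3) (h1 : PSeg R (fun _ => (e0, e1)) p1) (h2 : PSeg R p1 p2)
    (h3 : PSeg R p2 p3) (hp3 : ContDiff ℝ ∞ p3) (hLI : ∀ x, LI (p3 x).1 (p3 x).2)
    (hpa : ∀ x, Fr (dfr f x) (p3 x).1 = (dfr g x).1)
    (hpb : ∀ x, Fr (dfr f x) (p3 x).2 = (dfr g x).2) :
    ∃ k1 k2 k3 k4, FSeg f k1 ∧ FSeg k1 k2 ∧ FSeg k2 k3 ∧ FSeg k3 k4 ∧ FSeg g k4 := by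
  obtain ⟨χ, hχ⟩ := exists_cut R hR
  have hsm : ∀ᶠ l0 in 𝓝[>] (0 : ℝ), 0 < l0 ∧ l0 < 1 := by
    filter_upwards [self_mem_nhdsWithin, nhdsWithin_le_nhds (Iio_mem_nhds (zero_lt_one' ℝ))]
      with l a b using ⟨a, b⟩
  obtain ⟨l0, L1, L2, L3, hl0, hl1⟩ :=
    ((legP f f hf hf hfi R χ hχ (fun _ _ => rfl) (fun _ _ => rfl) _ _ h1).and
    ((legP f f hf hf hfi R χ hχ (fun _ _ => rfl) (fun _ _ => rfl) _ _ h2).and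
    ((legP f g hf hg hfi R χ hχ hff hdf _ _ h3).and hsm))).exists
  have LA := legA f hf (fun x => Fr (dfr f x)) (Fr_contDiff (dfr_contDiff hf))
    (fun x => Fr_inj (dfr_LI (hfi x))) (fun x v => by rw [Fr_iota, dfr_apply]) hfi R χ hχ l0 hl0 hl1
  have LB := legA g hg (fun x => (Fr (dfr f x)).comp (Fr (p3 x)))
    ((Fr_contDiff (dfr_contDiff hf)).clm_comp (Fr_contDiff hp3))
    (fun x => (Fr_inj (dfr_LI (hfi x))).comp (Fr_inj (hLI x)))
    (fun x v => by
      rw [ContinuousLinearMap.comp_apply, Fr_iota, dfr_apply, map_add, map_smul, map_smul, hpa, hpb])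
    hgi R χ hχ l0 hl0 hl1
  obtain ⟨ε, m1, m2, m3, m4, m5⟩ := (LA.and (L1.and (L2.and (L3.and LB)))).exists
  simp only [Fr_e, ContinuousLinearMap.comp_id] at m2
  exact ⟨_, _, _, _, m1, m2, m3, m4, m5⟩

section Quat
open scoped Quaternion
abbrev HH : Type := ℍ[ℝ]

def qiL : E3 →ₗ[ℝ] HH where
  toFun w := ⟨0, w 0, w 1, w 2⟩
  map_add' a b := Quaternion.ext _ _ (add_zero (0 : ℝ)).symm rfl rfl rfl
  map_smul' a b := Quaternion.ext _ _ (mul_zero a).symm rfl rfl rfl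

def qi (w : E3) : HH := qiL w

lemma qi_contDiff : ContDiff ℝ ∞ qi := (LinearMap.toContinuousLinearMap qiL).contDiff

def iqL : HH →ₗ[ℝ] E3 where
  toFun q := !₂[q.imI, q.imJ, q.imK]
  map_add' a b := by apply E3_ext <;> simp
  map_smul' a b := by apply E3_ext <;> simp

def iq (q : HH) : E3 := iqL q

lemma iq_contDiff : ContDiff ℝ ∞ iq := (LinearMap.toContinuousLinearMap iqL).contDiff

@[simp] lemma qi_re (w : E3) : (qi w).re = 0 := rfl
@[simp] lemma qi_imI (w : E3) : (qi w).imI = w 0 := rfl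
@[simp] lemma qi_imJ (w : E3) : (qi w).imJ = w 1 := rfl
@[simp] lemma qi_imK (w : E3) : (qi w).imK = w 2 := rfl

lemma iq_qi (w : E3) : iq (qi w) = w := by
  apply E3_ext <;> simp [iq, iqL]

lemma iq_zero {q : HH} (h : iq q = 0) : q = (q.re : HH) := by
  have h0 : q.imI = 0 := by simpa [iq, iqL] using congrArg (fun w : E3 => w 0) h
  have h1 : q.imJ = 0 := by simpa [iq, iqL] using congrArg (fun w : E3 => w 1) h
  have h2 : q.imK = 0 := by simpa [iq, iqL] using congrArg (fun w : E3 => w 2) h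
  apply Quaternion.ext <;> simp [h0, h1, h2]

def dt (a b : E3) : ℝ := a 0 * b 0 + a 1 * b 1 + a 2 * b 2

lemma qi_sq {a : E3} (h : dt a a = 1) : qi a * qi a = -1 := by
  unfold dt at h
  apply Quaternion.ext <;> simp <;> linarith

lemma qi_anti {a b : E3} (h : dt a b = 0) : qi a * qi b = -(qi b * qi a) := by
  unfold dt at h
  apply Quaternion.ext <;> simp <;> linarith

/-- anticommuting unit imaginary pair -/
structure AC (a b : HH) : Prop where
  ha : a * a = -1
  hb : b * b = -1
  hab : a * b = -(b * a)

lemma AC.na {a b : HH} (h : AC a b) : ‖a‖ = 1 := by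
  have := congrArg norm h.ha
  rw [norm_mul, norm_neg, norm_one] at this
  nlinarith [norm_nonneg a]

lemma AC.nb {a b : HH} (h : AC a b) : ‖b‖ = 1 := by
  have := congrArg norm h.hb
  rw [norm_mul, norm_neg, norm_one] at this
  nlinarith [norm_nonneg b]

def QQ (a b a' b' : HH) : HH := 1 - a' * a - b' * b + b' * a' * a * b

lemma QQ_a {a b a' b' : HH} (h : AC a b) (h' : AC a' b') : QQ a b a' b' * a = a' * QQ a b a' b' := by
  have e1 : b' * a' * a * b * a = b' * a' * b := by
    calc b' * a' * a * b * a = b' * a' * ((a * b) * a) := by noncomm_ring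
      _ = b' * a' * (-(b * (a * a))) := by rw [h.hab]; noncomm_ring
      _ = _ := by rw [h.ha]; noncomm_ring
  have e2 : a' * (b' * a' * a * b) = b' * a * b := by
    calc a' * (b' * a' * a * b) = (a' * b') * a' * (a * b) := by noncomm_ring
      _ = -(b' * (a' * a')) * (a * b) := by rw [h'.hab]; noncomm_ring
      _ = _ := by rw [h'.ha]; noncomm_ring
  have l : QQ a b a' b' * a = a - a' * (a * a) - b' * (b * a) + b' * a' * a * b * a := by
    unfold QQ; noncomm_ring
  have r : a' * QQ a b a' b' = a' - (a' * a') * a - (a' * b') * b + a' * (b' * a' * a * b) := by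
    unfold QQ; noncomm_ring
  rw [l, r, e1, e2, h.ha, h'.ha, h'.hab, mul_assoc b' a b, h.hab]
  noncomm_ring

lemma QQ_b {a b a' b' : HH} (h : AC a b) (h' : AC a' b') : QQ a b a' b' * b = b' * QQ a b a' b' := by
  have l : QQ a b a' b' * b = b - a' * (a * b) - b' * (b * b) + b' * a' * a * (b * b) := by
    unfold QQ; noncomm_ring
  have r : b' * QQ a b a' b' = b' - b' * a' * a - (b' * b') * b + (b' * b') * (a' * (a * b)) := by
    unfold QQ; noncomm_ring
  rw [l, r, h.hb, h'.hb]
  noncomm_ring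

lemma QQ_ne {a b a' b' : HH} (h : AC a b) (h' : AC a' b') (ha : ‖a' - a‖ < 1) (hb : ‖b' - b‖ < 1) :
    QQ a b a' b' ≠ 0 := by
  intro h0
  have e1 : -4 = -((a' - a) * a) - (b' - b) * b + ((b' - b) * a' + b * (a' - a)) * a * b := by
    have : -((a' - a) * a) - (b' - b) * b + ((b' - b) * a' + b * (a' - a)) * a * b
      = QQ a b a' b' - 1 + a * a + b * b - b * (a * a) * b := by unfold QQ; noncomm_ring
    rw [this, h0, h.ha]
    have : b * (-1) * b = -(b * b) := by noncomm_ring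
    rw [this, h.hb]; norm_num
  have n4 : ‖(-4 : HH)‖ = 4 := by
    rw [norm_neg]
    have : (4 : HH) = ((4 : ℝ) : HH) := by norm_cast
    rw [this, Quaternion.norm_coe]; norm_num
  have := congrArg norm e1
  rw [n4] at this
  have k1 : ‖(a' - a) * a‖ = ‖a' - a‖ := by rw [norm_mul, h.na, mul_one]
  have k2 : ‖(b' - b) * b‖ = ‖b' - b‖ := by rw [norm_mul, h.nb, mul_one]
  have k3 : ‖((b' - b) * a' + b * (a' - a)) * a * b‖ ≤ ‖b' - b‖ + ‖a' - a‖ := by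
    rw [norm_mul, norm_mul, h.na, h.nb, mul_one, mul_one]
    refine (norm_add_le _ _).trans ?_
    rw [norm_mul, norm_mul, h'.na, h.nb, mul_one, one_mul]
  have k4 := norm_add_le (-((a' - a) * a) - (b' - b) * b) (((b' - b) * a' + b * (a' - a)) * a * b)
  have k5 := norm_sub_le (-((a' - a) * a)) ((b' - b) * b)
  rw [norm_neg] at k5
  linarith

def qI : HH := qi e0
def qJ : HH := qi e1

lemma AC_std : AC qI qJ :=
  ⟨qi_sq (by simp [dt, e0]), qi_sq (by simp [dt, e1]), qi_anti (by simp [dt, e0, e1])⟩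

lemma real_of_comm {q : HH} (h1 : q * qI = qI * q) (h2 : q * qJ = qJ * q) : q = (q.re : HH) := by
  have a1 := congrArg QuaternionAlgebra.imJ h1
  have a2 := congrArg QuaternionAlgebra.imK h1
  have a3 := congrArg QuaternionAlgebra.imK h2
  simp [qI, qJ, e0, e1] at a1 a2 a3
  apply Quaternion.ext <;> simp <;> linarith

lemma lift_iter (A B : P2 → HH) (hA : ContDiff ℝ ∞ A) (hB : ContDiff ℝ ∞ B)
    (h : ∀ x, AC (A x) (B x)) (w : P2)
    (hwA : ∀ x, ‖A x - A (x + w)‖ < 1) (hwB : ∀ x, ‖B x - B (x + w)‖ < 1) (n : ℕ) :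
    ∃ q : P2 → HH, ContDiff ℝ ∞ q ∧ (∀ x, q x ≠ 0) ∧
      (∀ x, q x * A (x + n • w) = A x * q x) ∧ (∀ x, q x * B (x + n • w) = B x * q x) := by
  induction n with
  | zero => exact ⟨fun _ => 1, contDiff_const, fun _ => one_ne_zero, by simp, by simp⟩
  | succ n ih =>
    obtain ⟨q, hq, hne, hqA, hqB⟩ := ih
    have sh : ∀ m : ℕ, ContDiff ℝ ∞ (fun x : P2 => x + m • w) := fun m => by fun_prop
    refine ⟨fun x => q x * QQ (A (x + (n + 1) • w)) (B (x + (n + 1) • w)) (A (x + n • w)) (B (x + n • w)),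
      ?_, fun x => ?_, fun x => ?_, fun x => ?_⟩
    · have a1 := hA.comp (sh n)
      have a2 := hA.comp (sh (n + 1))
      have b1 := hB.comp (sh n)
      have b2 := hB.comp (sh (n + 1))
      unfold QQ
      exact hq.mul (((contDiff_const.sub (a1.mul a2)).sub (b1.mul b2)).add (((b1.mul a1).mul a2).mul b2))
    · have e : x + (n + 1) • w = x + n • w + w := by rw [succ_nsmul, add_assoc]
      exact mul_ne_zero (hne x) (QQ_ne (h _) (h _) (by rw [e]; exact hwA _) (by rw [e]; exact hwB _))
    · rw [mul_assoc, QQ_a (h _) (h _), ← mul_assoc, hqA, mul_assoc]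
    · rw [mul_assoc, QQ_b (h _) (h _), ← mul_assoc, hqB, mul_assoc]

lemma annulus_preconn (R : ℝ) (hR : 0 < R) : IsPreconnected {x : P2 | R ≤ ‖x‖ ∧ ‖x‖ ≤ R + 1} := by
  have hs : IsPreconnected (sphere (0 : P2) 1) := isPreconnected_sphere (by
    rw [← Module.finrank_eq_rank, finrank_euclideanSpace]; norm_num) _ _
  have := (isPreconnected_Icc (a := R) (b := R + 1)).prod hs
  have := this.image (fun z : ℝ × P2 => z.1 • z.2) (by fun_prop)
  convert this using 1
  ext x
  constructor
  · rintro ⟨h1, h2⟩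
    have : ‖x‖ ≠ 0 := by linarith
    exact ⟨(‖x‖, ‖x‖⁻¹ • x), ⟨⟨h1, h2⟩, by simp [norm_smul, this]⟩, by simp [smul_smul, this]⟩
  · rintro ⟨⟨r, y⟩, ⟨⟨h1, h2⟩, hy⟩, rfl⟩
    simp only [mem_sphere_iff_norm, sub_zero] at hy
    have : |r| = r := abs_of_pos (by simp at h1; linarith)
    simp only [mem_ofPred_eq, norm_smul, hy, mul_one, Real.norm_eq_abs, this]
    exact ⟨h1, h2⟩

lemma unif_out (A : P2 → HH) (hA : Continuous A) (c : HH) (R : ℝ) (h : ∀ x, R ≤ ‖x‖ → A x = c) :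
    ∃ δ > 0, ∀ x y, dist x y < δ → ‖A x - A y‖ < 1 := by
  have : UniformContinuous A := by
    apply hA.uniformContinuous_of_tendsto_cocompact (x := c)
    apply tendsto_nhds_of_eventually_eq
    have := tendsto_norm_cocompact_atTop (E := P2) |>.eventually_ge_atTop R
    filter_upwards [this] with x hx using h x hx
  obtain ⟨δ, hδ, k⟩ := Metric.uniformContinuous_iff.mp this 1 one_pos
  exact ⟨δ, hδ, fun x y hxy => by simpa [dist_eq_norm] using k hxy⟩

lemma lift_main (A B : P2 → HH) (hA : ContDiff ℝ ∞ A) (hB : ContDiff ℝ ∞ B)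
    (h : ∀ x, AC (A x) (B x)) (R : ℝ) (hR : 0 < R)
    (hAo : ∀ x, R ≤ ‖x‖ → A x = qI) (hBo : ∀ x, R ≤ ‖x‖ → B x = qJ) :
    ∃ q : P2 → HH, ContDiff ℝ ∞ q ∧ (∀ x, q x ≠ 0) ∧ (∀ x, q x * qI = A x * q x) ∧
      (∀ x, q x * qJ = B x * q x) ∧ ∀ x, R ≤ ‖x‖ → ∃ r : ℝ, 0 < r ∧ q x = (r : HH) := by
  obtain ⟨δ1, hd1, k1⟩ := unif_out A hA.continuous qI R hAo
  obtain ⟨δ2, hd2, k2⟩ := unif_out B hB.continuous qJ R hBo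
  set δ := min δ1 δ2 / 2 with hδ
  have hmin : 0 < min δ1 δ2 := lt_min hd1 hd2
  have hδ0 : 0 < δ := by positivity
  have hδ1 : δ < δ1 := by have := min_le_left δ1 δ2; linarith
  have hδ2 : δ < δ2 := by have := min_le_right δ1 δ2; linarith
  let w : P2 := δ • b0
  have hw : ‖w‖ = δ := by simp [w, b0, norm_smul, abs_of_pos hδ0]
  obtain ⟨n, hn⟩ := exists_nat_gt ((2 * R + 1) / δ)
  have hn' : 2 * R + 1 < n * δ := by rwa [div_lt_iff₀ hδ0] at hn
  obtain ⟨q, hq, hne, hqA, hqB⟩ := lift_iter A B hA hB h w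
    (fun x => k1 _ _ (by simpa [hw] using hδ1)) (fun x => k2 _ _ (by simpa [hw] using hδ2)) n
  have far : ∀ x, ‖x‖ ≤ R + 1 → R ≤ ‖x + n • w‖ := by
    intro x hx
    have e1 : ‖n • w‖ = n * δ := by rw [← Nat.cast_smul_eq_nsmul ℝ, norm_smul, hw]; simp
    have := norm_sub_le (x + n • w) x
    rw [add_sub_cancel_left, e1] at this
    linarith
  have cA : ∀ x, ‖x‖ ≤ R + 1 → q x * qI = A x * q x := fun x hx => by
    rw [← hqA, hAo _ (far x hx)]
  have cB : ∀ x, ‖x‖ ≤ R + 1 → q x * qJ = B x * q x := fun x hx => by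
    rw [← hqB, hBo _ (far x hx)]
  have hreal : ∀ x, R ≤ ‖x‖ → ‖x‖ ≤ R + 1 → q x = ((q x).re : HH) := fun x h1 h2 =>
    real_of_comm (by rw [cA x h2, hAo x h1]) (by rw [cB x h2, hBo x h1])
  have hre : ∀ x, R ≤ ‖x‖ → ‖x‖ ≤ R + 1 → (q x).re ≠ 0 := fun x h1 h2 h3 => by
    apply hne x; rw [hreal x h1 h2, h3]; simp
  -- sign
  have sgn : ∃ s : ℝ, s ≠ 0 ∧ ∀ x, R ≤ ‖x‖ → ‖x‖ ≤ R + 1 → 0 < s * (q x).re := by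
    have hcont : ContinuousOn (fun x => (q x).re) {x : P2 | R ≤ ‖x‖ ∧ ‖x‖ ≤ R + 1} :=
      (Quaternion.continuous_re.comp hq.continuous).continuousOn
    have pc := (annulus_preconn R hR).image _ hcont
    by_cases hp : ∀ x, R ≤ ‖x‖ → ‖x‖ ≤ R + 1 → 0 < (q x).re
    · exact ⟨1, one_ne_zero, by simpa using hp⟩
    · push Not at hp
      obtain ⟨x0, a1, a2, a3⟩ := hp
      refine ⟨-1, by norm_num, fun x h1 h2 => ?_⟩
      by_contra hc
      have : (0 : ℝ) ∈ (fun x => (q x).re) '' {x : P2 | R ≤ ‖x‖ ∧ ‖x‖ ≤ R + 1} :=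
        pc.ordConnected.out ⟨x0, ⟨a1, a2⟩, rfl⟩ ⟨x, ⟨h1, h2⟩, rfl⟩ ⟨a3, by simp at hc ⊢; linarith⟩
      obtain ⟨y, ⟨y1, y2⟩, y3⟩ := this
      exact hre y y1 y2 y3
  obtain ⟨s, hs, hsgn⟩ := sgn
  obtain ⟨χ, hχ⟩ := exists_cut R hR
  have form : ∀ x, R ≤ ‖x‖ → ∃ r : ℝ, 0 < r ∧ (χ x * s) • q x + (1 - χ x) • (1 : HH) = (r : HH) := by
    intro x hx
    rcases le_total ‖x‖ (R + 1) with h2 | h2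
    · refine ⟨χ x * (s * (q x).re) + (1 - χ x), ?_, ?_⟩
      · have := hsgn x hx h2
        have a := hχ.nonneg x
        have b := hχ.le_one x
        rcases a.eq_or_lt with h' | h'
        · rw [← h']; simp
        · have := mul_pos h' this; linarith
      · rw [hreal x hx h2]
        apply Quaternion.ext <;> simp <;> ring
    · refine ⟨1, one_pos, ?_⟩
      simp [hχ.outer x h2]
  refine ⟨fun x => (χ x * s) • q x + (1 - χ x) • (1 : HH), ?_, ?_, ?_, ?_, form⟩
  · exact ((hχ.smooth.mul contDiff_const).smul hq).add ((contDiff_const.sub hχ.smooth).smul contDiff_const)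
  · intro x
    rcases le_total R ‖x‖ with h1 | h1
    · obtain ⟨r, hr, e⟩ := form x h1
      simp only [e]
      intro h0
      have := congrArg QuaternionAlgebra.re h0
      simp at this; linarith
    · simp [hχ.inner x h1, hs, hne x]
  · intro x
    rcases le_total R ‖x‖ with h1 | h1
    · obtain ⟨r, hr, e⟩ := form x h1
      simp only [e, hAo x h1]
      exact Quaternion.coe_commutes r qI
    · simp [hχ.inner x h1, cA x (by linarith)]
  · intro x
    rcases le_total R ‖x‖ with h1 | h1
    · obtain ⟨r, hr, e⟩ := form x h1
      simp only [e, hBo x h1]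
      exact Quaternion.coe_commutes r qJ
    · simp [hχ.inner x h1, cB x (by linarith)]

end Quat

section Quat2
open scoped Quaternion

def rot (q : HH) : E3 × E3 := (iq (q * qI * q⁻¹), iq (q * qJ * q⁻¹))

lemma rot_contDiff {X : Type*} [NormedAddCommGroup X] [NormedSpace ℝ X] {q : X → HH}
    (hq : ContDiff ℝ ∞ q) (h : ∀ x, q x ≠ 0) : ContDiff ℝ ∞ (fun x => rot (q x)) := by
  have hi : ContDiff ℝ ∞ (fun x => (q x)⁻¹) := by
    rw [contDiff_iff_contDiffAt]
    intro x
    have := (contDiffAt_ringInverse ℝ (n := ∞) (Units.mk0 (q x) (h x))).comp x hq.contDiffAt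
    rw [Ring.inverse_eq_inv'] at this
    exact this
  exact (iq_contDiff.comp ((hq.mul contDiff_const).mul hi)).prodMk
    (iq_contDiff.comp ((hq.mul contDiff_const).mul hi))

lemma rot_real (r : ℝ) (hr : r ≠ 0) : rot (r : HH) = (e0, e1) := by
  have h0 : (r : HH) ≠ 0 := by
    intro h; apply hr; simpa using congrArg QuaternionAlgebra.re h
  unfold rot
  rw [Quaternion.coe_commutes, Quaternion.coe_commutes, mul_assoc, mul_assoc, mul_inv_cancel₀ h0,
    mul_one, mul_one, qI, qJ, iq_qi, iq_qi]

lemma rot_LI (q : HH) (h : q ≠ 0) : LI (rot q).1 (rot q).2 := by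
  intro s t hst
  have e : iq (q * (s • qI + t • qJ) * q⁻¹) = 0 := by
    rw [← hst]
    simp only [rot, iq]
    rw [← map_smul, ← map_smul, ← map_add]
    congr 1
    simp [mul_add, add_mul]
  have k := iq_zero e
  set r := (q * (s • qI + t • qJ) * q⁻¹).re
  have k2 : s • qI + t • qJ = (r : HH) := by
    have : q⁻¹ * (q * (s • qI + t • qJ) * q⁻¹) * q = s • qI + t • qJ := by
      simp [mul_assoc, h]
    rw [← this, k, ← Quaternion.coe_commutes, mul_assoc, inv_mul_cancel₀ h, mul_one]
  constructor
  · simpa [qI, qJ, e0, e1] using congrArg QuaternionAlgebra.imI k2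
  · simpa [qI, qJ, e0, e1] using congrArg QuaternionAlgebra.imJ k2

lemma rot_eq {q : HH} (h : q ≠ 0) {a b : E3} (ha : q * qI = qi a * q) (hb : q * qJ = qi b * q) :
    rot q = (a, b) := by
  unfold rot
  rw [ha, hb, mul_assoc, mul_assoc, mul_inv_cancel₀ h, mul_one, mul_one, iq_qi, iq_qi]

lemma rot_seg (R : ℝ) (q : ℝ × P2 → HH) (hq : ContDiff ℝ ∞ q)
    (hne : ∀ t ∈ Icc (0 : ℝ) 1, ∀ x, q (t, x) ≠ 0)
    (hr : ∀ t ∈ Icc (0 : ℝ) 1, ∀ x, R ≤ ‖x‖ → ∃ r : ℝ, q (t, x) = (r : HH)) :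
    PSeg R (fun x => rot (q (0, x))) (fun x => rot (q (1, x))) := by
  let σ := Real.smoothTransition
  have hσ : ContDiff ℝ ∞ σ := Real.smoothTransition.contDiff
  have hσI : ∀ t, σ t ∈ Icc (0 : ℝ) 1 := fun t =>
    ⟨Real.smoothTransition.nonneg t, Real.smoothTransition.le_one t⟩
  have s0 : σ 0 = 0 := Real.smoothTransition.zero
  have s1 : σ 1 = 1 := Real.smoothTransition.one
  refine ⟨fun z => rot (q (σ z.1, z.2)), rot_contDiff (hq.comp ((hσ.comp contDiff_fst).prodMk
    contDiff_snd)) (fun z => hne _ (hσI _) _), fun t _ x => rot_LI _ (hne _ (hσI _) _),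
    fun t _ x hx => ?_, fun x => by simp only [s0], fun x => by simp only [s1]⟩
  obtain ⟨r, e⟩ := hr (σ t) (hσI t) x hx
  simp only [e]
  apply rot_real
  rintro rfl
  exact hne (σ t) (hσI t) x (by rw [e]; simp)

lemma dt_contDiff {a b : P2 → E3} (ha : ContDiff ℝ ∞ a) (hb : ContDiff ℝ ∞ b) :
    ContDiff ℝ ∞ (fun x => dt (a x) (b x)) := by
  have A := coord_contDiff ha
  have B := coord_contDiff hb
  exact (((A 0).mul (B 0)).add ((A 1).mul (B 1))).add ((A 2).mul (B 2))

lemma dt_pos {a : E3} (h : a ≠ 0) : 0 < dt a a := by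
  unfold dt
  by_contra hc
  apply h
  apply E3_ext <;> simp <;> nlinarith [sq_nonneg (a 0), sq_nonneg (a 1), sq_nonneg (a 2)]

/-- normalization -/
def nm (a : E3) : E3 := (Real.sqrt (dt a a))⁻¹ • a

lemma nm_contDiff {a : P2 → E3} (ha : ContDiff ℝ ∞ a) (h : ∀ x, a x ≠ 0) :
    ContDiff ℝ ∞ (fun x => nm (a x)) := by
  have h1 : ContDiff ℝ ∞ (fun x => Real.sqrt (dt (a x) (a x))) :=
    (dt_contDiff ha ha).sqrt fun x => (dt_pos (h x)).ne'
  exact (h1.inv fun x => (Real.sqrt_pos.mpr (dt_pos (h x))).ne').smul ha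

lemma dt_smul (s t : ℝ) (a b : E3) : dt (s • a) (t • b) = s * t * dt a b := by
  simp [dt]; ring

lemma dt_nm {a : E3} (h : a ≠ 0) : dt (nm a) (nm a) = 1 := by
  unfold nm
  rw [dt_smul]
  have h1 := dt_pos h
  have h2 := Real.mul_self_sqrt h1.le
  have h3 : Real.sqrt (dt a a) ≠ 0 := (Real.sqrt_pos.mpr h1).ne'
  rw [← mul_inv, h2, inv_mul_cancel₀ h1.ne']

def perp (a b : E3) : E3 := dt a a • b - dt a b • a

lemma dt_perp (a b : E3) : dt a (perp a b) = 0 := by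
  simp [perp, dt]; ring

lemma perp_ne {a b : E3} (h : LI a b) : perp a b ≠ 0 := by
  intro h0
  have := (h (-dt a b) (dt a a) (by rw [← h0, perp]; module)).2
  exact (dt_pos h.ne_left).ne' this

lemma pair_main (a b : P2 → E3) (ha : ContDiff ℝ ∞ a) (hb : ContDiff ℝ ∞ b)
    (hLI : ∀ x, LI (a x) (b x)) (R : ℝ) (hR : 0 < R) (hao : ∀ x, R ≤ ‖x‖ → a x = e0)
    (hbo : ∀ x, R ≤ ‖x‖ → b x = e1) :
    ∃ p1 p2, PSeg (R + 1) (fun _ => (e0, e1)) p1 ∧ PSeg (R + 1) p1 p2 ∧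
      PSeg (R + 1) p2 (fun x => (a x, b x)) := by
  have hpc : ContDiff ℝ ∞ (fun x => perp (a x) (b x)) :=
    ((dt_contDiff ha ha).smul hb).sub ((dt_contDiff ha hb).smul ha)
  let A : P2 → E3 := fun x => nm (a x)
  let B : P2 → E3 := fun x => nm (perp (a x) (b x))
  have hA : ContDiff ℝ ∞ A := nm_contDiff ha fun x => (hLI x).ne_left
  have hB : ContDiff ℝ ∞ B := nm_contDiff hpc fun x => perp_ne (hLI x)
  have hAC : ∀ x, AC (qi (A x)) (qi (B x)) := fun x =>
    ⟨qi_sq (dt_nm (hLI x).ne_left), qi_sq (dt_nm (perp_ne (hLI x))),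
      qi_anti (by simp only [A, B, nm, dt_smul, dt_perp, mul_zero])⟩
  have hAo : ∀ x, R ≤ ‖x‖ → A x = e0 := fun x hx => by
    simp [A, nm, hao x hx, dt, e0]
  have hBo : ∀ x, R ≤ ‖x‖ → B x = e1 := fun x hx => by
    have : perp (a x) (b x) = e1 := by
      rw [hao x hx, hbo x hx]
      apply E3_ext <;> simp [perp, e0, e1, dt]
    simp [B, nm, this, dt, e1]
  obtain ⟨q, hq, hqne, hqA, hqB, hqr⟩ := lift_main (fun x => qi (A x)) (fun x => qi (B x))
    (qi_contDiff.comp hA) (qi_contDiff.comp hB) hAC R hR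
    (fun x hx => by simp only [hAo x hx, qI]) (fun x hx => by simp only [hBo x hx, qJ])
  have hrot : ∀ x, rot (q x) = (A x, B x) := fun x => rot_eq (hqne x) (hqA x) (hqB x)
  -- generic quaternion
  obtain ⟨c, hc⟩ : ∃ c : HH, ∀ (r : ℝ) x, c ≠ r • q x := by
    have hs : ContDiff ℝ 1 (fun z : ℝ × P2 => z.1 • q z.2) :=
      contDiff_fst.smul ((hq.of_le (by simp)).comp contDiff_snd)
    have hd := hs.dense_compl_range_of_finrank_lt_finrank (by
      rw [Module.finrank_prod, Quaternion.finrank_eq_four, finrank_euclideanSpace]; simp)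
    obtain ⟨c, hc⟩ := hd.nonempty
    exact ⟨c, fun r x h => hc ⟨(r, x), h.symm⟩⟩
  have hcr : ∀ r : ℝ, c ≠ (r : HH) := by
    intro r h
    let x : P2 := R • b0
    have hx : ‖x‖ = R := by simp [x, b0, norm_smul, abs_of_pos hR]
    obtain ⟨r0, h0, e⟩ := hqr x hx.ge
    apply hc (r / r0) x
    rw [e, h]
    apply Quaternion.ext <;> simp
    field_simp
  obtain ⟨χ, hχ⟩ := exists_cut R hR
  let κ : P2 → HH := fun x => (1 - χ x) • (1 : HH) + χ x • c
  have hκ : ContDiff ℝ ∞ κ :=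
    ((contDiff_const.sub hχ.smooth).smul contDiff_const).add (hχ.smooth.smul contDiff_const)
  -- u + v c ≠ 0
  have comb : ∀ u v : ℝ, (v = 0 → u ≠ 0) → u • (1 : HH) + v • c ≠ 0 := by
    intro u v huv h
    by_cases hv : v = 0
    · subst hv
      have := congrArg QuaternionAlgebra.re h
      simp at this
      exact huv rfl this
    · obtain ⟨r, hr⟩ : ∃ r : ℝ, r = -(v⁻¹ * u) := ⟨_, rfl⟩
      apply hcr r
      have : c = v⁻¹ • ((u • (1 : HH) + v • c) - u • 1) := by
        rw [add_sub_cancel_left, smul_smul, inv_mul_cancel₀ hv, one_smul]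
      rw [this, h]
      apply Quaternion.ext <;> simp <;> linarith
  have S1 := rot_seg (R + 1) (fun z : ℝ × P2 => (1 - z.1) • (1 : HH) + z.1 • κ z.2)
    (((contDiff_const.sub contDiff_fst).smul contDiff_const).add
      (contDiff_fst.smul (hκ.comp contDiff_snd)))
    (fun t ht x => by
      have : (1 - t) • (1 : HH) + t • κ x = (1 - t * χ x) • (1 : HH) + (t * χ x) • c := by
        simp only [κ]; module
      simp only [this]
      apply comb
      intro h; rw [h]; norm_num)
    (fun t ht x hx => ⟨1, by simp [κ, hχ.outer x hx]; rw [← add_smul]; simp⟩)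
  have S2 := rot_seg (R + 1) (fun z : ℝ × P2 => (1 - z.1) • κ z.2 + z.1 • q z.2)
    (((contDiff_const.sub contDiff_fst).smul (hκ.comp contDiff_snd)).add
      (contDiff_fst.smul (hq.comp contDiff_snd)))
    (fun t ht x => by
      rcases le_total R ‖x‖ with hx | hx
      · obtain ⟨r, hr, e⟩ := hqr x hx
        have e' : q x = r • (1 : HH) := by rw [e]; apply Quaternion.ext <;> simp
        have : (1 - t) • κ x + t • q x = ((1 - t) * (1 - χ x) + t * r) • (1 : HH) +
            ((1 - t) * χ x) • c := by
          rw [e']; simp only [κ]; module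
        simp only [this]
        apply comb
        intro h
        have h1 := ht.1
        have h2 := ht.2
        rcases mul_eq_zero.mp h with h | h
        · have : t = 1 := by linarith
          subst this; simp; linarith
        · rw [h]
          rcases h1.eq_or_lt with h3 | h3
          · rw [← h3]; norm_num
          · have := mul_pos h3 hr; linarith
      · simp only [κ, hχ.inner x hx]
        intro h
        rcases eq_or_ne t 1 with rfl | h1
        · simp at h; exact hqne x h
        · have h1' : 1 - t ≠ 0 := sub_ne_zero.mpr h1.symm
          apply hc (-(t / (1 - t))) x
          have k : (1 - t) • c + t • q x = 0 := by simpa using h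
          have : c = (1 - t)⁻¹ • (((1 - t) • c + t • q x) - t • q x) := by
            rw [add_sub_cancel_right, smul_smul, inv_mul_cancel₀ h1', one_smul]
          rw [this, k, zero_sub, smul_neg, smul_smul, neg_smul, div_eq_inv_mul])
    (fun t ht x hx => by
      obtain ⟨r, hr, e⟩ := hqr x (by linarith)
      exact ⟨(1 - t) + t * r, by
        simp only [κ, hχ.outer x hx, e]; apply Quaternion.ext <;> simp⟩)
  refine ⟨fun x => rot (κ x), fun x => (A x, B x), ?_, ?_, ?_⟩
  · have r1 : rot 1 = (e0, e1) := by simpa using rot_real 1 one_ne_zero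
    simpa [r1] using S1
  · simpa [hrot] using S2
  · refine ⟨fun z => (A z.2 + z.1 • (a z.2 - A z.2), B z.2 + z.1 • (b z.2 - B z.2)), ?_, ?_, ?_, ?_, ?_⟩
    · have a1 := ha.comp (contDiff_snd (E := ℝ) (F := P2))
      have a2 := hA.comp (contDiff_snd (E := ℝ) (F := P2))
      have a3 := hb.comp (contDiff_snd (E := ℝ) (F := P2))
      have a4 := hB.comp (contDiff_snd (E := ℝ) (F := P2))
      exact (a2.add (contDiff_fst.smul (a1.sub a2))).prodMk (a4.add (contDiff_fst.smul (a3.sub a4)))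
    · intro t ht x s u hsu
      simp only at hsu
      set α := (Real.sqrt (dt (a x) (a x)))⁻¹ with hα
      set β := (Real.sqrt (dt (perp (a x) (b x)) (perp (a x) (b x))))⁻¹ with hβ
      have pα : 0 < α := inv_pos.mpr (Real.sqrt_pos.mpr (dt_pos (hLI x).ne_left))
      have pβ : 0 < β := inv_pos.mpr (Real.sqrt_pos.mpr (dt_pos (perp_ne (hLI x))))
      have hd := dt_pos (hLI x).ne_left
      have eA : A x = α • a x := rfl
      have eB : B x = β • (dt (a x) (a x) • b x - dt (a x) (b x) • a x) := rfl
      rw [eA, eB] at hsu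
      obtain ⟨k1, k2⟩ := hLI x (s * ((1 - t) * α + t) - u * ((1 - t) * β * dt (a x) (b x)))
        (u * ((1 - t) * β * dt (a x) (a x) + t)) (by rw [← hsu]; module)
      have posc : ∀ y : ℝ, 0 < y → (1 - t) * y + t ≠ 0 := by
        intro y hy
        have h1 := ht.1
        have h2 := ht.2
        rcases h1.eq_or_lt with h3 | h3
        · rw [← h3]; simp; exact hy.ne'
        · have := mul_nonneg (sub_nonneg.mpr h2) hy.le; linarith
      have hu : u = 0 := by
        rcases mul_eq_zero.mp k2 with h | h
        · exact h
        · exact absurd h (by rw [mul_assoc]; exact posc _ (mul_pos pβ hd))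
      rw [hu, zero_mul, sub_zero] at k1
      refine ⟨?_, hu⟩
      rcases mul_eq_zero.mp k1 with h | h
      · exact h
      · exact absurd h (posc _ pα)
    · intro t ht x hx
      simp [hAo x (by linarith), hBo x (by linarith), hao x (by linarith), hbo x (by linarith)]
    · intro x; simp
    · intro x; simp

end Quat2

/-- flat main -/
theorem flat_main (f g : P2 → E3) (hf : ContDiff ℝ ∞ f) (hg : ContDiff ℝ ∞ g)
    (hfi : ∀ x, Function.Injective (fderiv ℝ f x)) (hgi : ∀ x, Function.Injective (fderiv ℝ g x))
    (R : ℝ) (hR : 0 < R) (hff : ∀ x, R ≤ ‖x‖ → f x = g x) :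
    ∃ k1 k2 k3 k4, FSeg f k1 ∧ FSeg k1 k2 ∧ FSeg k2 k3 ∧ FSeg k3 k4 ∧ FSeg g k4 := by
  have hdf : ∀ x, R + 1 ≤ ‖x‖ → fderiv ℝ f x = fderiv ℝ g x := by
    intro x hx
    apply Filter.EventuallyEq.fderiv_eq
    filter_upwards [(isOpen_lt continuous_const continuous_norm).mem_nhds
      (show R < ‖x‖ by linarith)] with y hy using hff y (le_of_lt hy)
  obtain ⟨G, hG, hFG, hGF⟩ := exists_inv (fun x => Fr (dfr f x)) (Fr_contDiff (dfr_contDiff hf))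
    (fun x => Fr_inj (dfr_LI (hfi x)))
  have hgc := dfr_contDiff hg
  have hLI : ∀ x, LI (G x (dfr g x).1) (G x (dfr g x).2) := by
    intro x s t h
    apply dfr_LI (hgi x)
    have := congrArg (Fr (dfr f x)) h
    simpa [hFG] using this
  have ha : ContDiff ℝ ∞ (fun x => G x (dfr g x).1) := hG.clm_apply hgc.fst
  have hb : ContDiff ℝ ∞ (fun x => G x (dfr g x).2) := hG.clm_apply hgc.snd
  have dd : ∀ x, R + 1 ≤ ‖x‖ → dfr g x = dfr f x := fun x hx => by simp only [dfr, hdf x hx]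
  obtain ⟨p1, p2, h1, h2, h3⟩ := pair_main _ _ ha hb hLI (R + 1) (by linarith)
    (fun x hx => by
      have : (dfr g x).1 = Fr (dfr f x) e0 := by rw [dd x hx]; simp [Fr_apply, e0]
      rw [this, hGF])
    (fun x hx => by
      have : (dfr g x).2 = Fr (dfr f x) e1 := by rw [dd x hx]; simp [Fr_apply, e1]
      rw [this, hGF])
  exact flat_legs f g hf hg hfi hgi (R + 1 + 1) (by linarith) (fun x hx => hff x (by linarith))
    (fun x hx => hdf x (by linarith)) p1 p2 _ h1 h2 h3 (ha.prodMk hb) hLI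
    (fun x => hFG x _) (fun x => hFG x _)

/-! ### Regular homotopies parametrised by the real line -/

def RSm (H : ℝ × S2 → E3) : Prop := ContMDiff (𝓘(ℝ, ℝ).prod (𝓡 2)) 𝓘(ℝ, E3) (⊤ : ℕ∞) H

def RH (f g : S2 → E3) : Prop :=
  ∃ H : ℝ × S2 → E3, RSm H ∧ (∀ t, IsImmersion (fun x => H (t, x))) ∧
    (∀ t ≤ 0, ∀ x, H (t, x) = f x) ∧ (∀ t, 1 ≤ t → ∀ x, H (t, x) = g x)

lemma RSm.slice {H : ℝ × S2 → E3} (h : RSm H) (t : ℝ) :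
    ContMDiff (𝓡 2) 𝓘(ℝ, E3) (⊤ : ℕ∞) (fun x => H (t, x)) :=
  ContMDiff.comp h (contMDiff_const.prodMk contMDiff_id)

lemma RSm.reparam {H : ℝ × S2 → E3} (h : RSm H) {φ : ℝ → ℝ} (hφ : ContDiff ℝ ∞ φ) :
    RSm (fun z => H (φ z.1, z.2)) := by
  have h1 : ContMDiff (𝓘(ℝ, ℝ).prod (𝓡 2)) 𝓘(ℝ, ℝ) (⊤ : ℕ∞) (fun z : ℝ × S2 => φ z.1) :=
    (contMDiff_iff_contDiff.2 hφ).comp contMDiff_fst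
  exact ContMDiff.comp h (h1.prodMk contMDiff_snd)

lemma RH.of {H : ℝ × S2 → E3} (h : RSm H)
    (hi : ∀ t ∈ Icc (0:ℝ) 1, ∀ x, Function.Injective (mfderiv (𝓡 2) 𝓘(ℝ, E3) (fun y => H (t, y)) x))
    {f g : S2 → E3} (hf : ∀ x, H (0, x) = f x) (hg : ∀ x, H (1, x) = g x) : RH f g := by
  refine ⟨fun z => H (Real.smoothTransition z.1, z.2), h.reparam Real.smoothTransition.contDiff,
    fun t => ⟨h.slice (Real.smoothTransition t), hi (Real.smoothTransition t) ⟨Real.smoothTransition.nonneg t, Real.smoothTransition.le_one t⟩⟩,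
    fun t ht x => ?_, fun t ht x => ?_⟩
  · simp [Real.smoothTransition.zero_of_nonpos ht, hf]
  · simp [Real.smoothTransition.one_of_one_le ht, hg]

lemma RH.symm {f g : S2 → E3} (h : RH f g) : RH g f := by
  obtain ⟨H, h1, h2, h3, h4⟩ := h
  refine ⟨fun z => H (1 - z.1, z.2), h1.reparam (by fun_prop), fun t => h2 (1 - t),
    fun t ht x => h4 _ (by linarith) x, fun t ht x => h3 _ (by linarith) x⟩

lemma RH.trans {f g k : S2 → E3} (h : RH f g) (h' : RH g k) : RH f k := by
  obtain ⟨H, h1, h2, h3, h4⟩ := h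
  obtain ⟨K, k1, k2, k3, k4⟩ := h'
  have eA : ∀ t < (3/4:ℝ), ∀ x, (if t ≤ 1/2 then H (4*t, x) else K (4*t-3, x)) = H (4*t, x) := by
    intro t ht x
    split_ifs with h
    · rfl
    · rw [k3 _ (by linarith), h4 _ (by push Not at h; linarith)]
  have eB : ∀ t, (1/4:ℝ) < t → ∀ x, (if t ≤ 1/2 then H (4*t, x) else K (4*t-3, x)) = K (4*t-3, x) := by
    intro t ht x
    split_ifs with h
    · rw [k3 _ (by linarith), h4 _ (by linarith)]
    · rfl
  refine ⟨fun z => if z.1 ≤ 1/2 then H (4*z.1, z.2) else K (4*z.1-3, z.2), ?_, ?_, ?_, ?_⟩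
  · intro z
    by_cases hz : z.1 < 3/4
    · have := (h1.reparam (φ := fun t => 4*t) (by fun_prop)) z
      refine this.congr_of_eventuallyEq ?_
      filter_upwards [(isOpen_lt continuous_fst continuous_const).mem_nhds hz] with w hw
      exact eA w.1 hw w.2
    · have := (k1.reparam (φ := fun t => 4*t-3) (by fun_prop)) z
      refine this.congr_of_eventuallyEq ?_
      have hz' : (1/4:ℝ) < z.1 := by push Not at hz; linarith
      filter_upwards [(isOpen_lt continuous_const continuous_fst).mem_nhds hz'] with w hw
      exact eB w.1 hw w.2
  · intro t
    by_cases ht : t ≤ 1/2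
    · simp only [ht, if_true]; exact h2 _
    · simp only [ht, if_false]; exact k2 _
  · intro t ht x
    rw [← h3 (4*t) (by linarith) x]; exact eA t (by linarith) x
  · intro t ht x
    rw [← k4 (4*t-3) (by linarith) x]; exact eB t (by linarith) x

lemma RH.regular {f g : S2 → E3} (h : RH f g) : RegularHomotopic f g := by
  obtain ⟨H, h1, h2, h3, h4⟩ := h
  refine ⟨fun z => H (z.1.1, z.2), ?_, fun x => h3 0 le_rfl x, fun x => h4 1 le_rfl x, fun t => h2 t.1⟩
  have h5 : ContMDiff ((𝓡∂ 1).prod (𝓡 2)) 𝓘(ℝ, ℝ) (⊤ : ℕ∞)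
      (fun z : Set.Icc (0:ℝ) 1 × S2 => (z.1 : ℝ)) :=
    contMDiff_subtypeVal_Icc.comp contMDiff_fst
  exact ContMDiff.comp h1 (h5.prodMk contMDiff_snd)

/-! ### Stereographic charts -/

instance factE3 : Fact (Module.finrank ℝ E3 = 2 + 1) := ⟨by simp⟩

abbrev st (p : S2) : OpenPartialHomeomorph S2 P2 := stereographic' 2 p

lemma st_atlas (p : S2) : st p ∈ atlas P2 S2 := ⟨p, rfl⟩

lemma st_max (p : S2) : st p ∈ IsManifold.maximalAtlas (𝓡 2) (⊤ : ℕ∞) S2 :=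
  IsManifold.subset_maximalAtlas (st_atlas p)

lemma st_mem {p y : S2} (h : y ≠ p) : y ∈ (st p).source := by
  rw [stereographic'_source]; exact h

lemma st_symm_ne (p : S2) (x : P2) : (st p).symm x ≠ p := by
  have := (st p).map_target (x := x) (by rw [stereographic'_target]; trivial)
  rw [stereographic'_source] at this; exact this

lemma st_right (p : S2) (x : P2) : st p ((st p).symm x) = x :=
  (st p).right_inv (by rw [stereographic'_target]; trivial)

lemma st_left {p y : S2} (h : y ≠ p) : (st p).symm (st p y) = y := (st p).left_inv (st_mem h)

lemma st_symm_smooth (p : S2) : ContMDiff (𝓡 2) (𝓡 2) (⊤ : ℕ∞) (st p).symm := by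
  have := contMDiffOn_symm_of_mem_maximalAtlas (st_max p)
  rw [stereographic'_target] at this
  exact contMDiffOn_univ.1 this

lemma st_smoothAt {p y : S2} (h : y ≠ p) : ContMDiffAt (𝓡 2) (𝓡 2) (⊤ : ℕ∞) (st p) y :=
  (contMDiffOn_of_mem_maximalAtlas (st_max p)).contMDiffAt ((st p).open_source.mem_nhds (st_mem h))

lemma st_md (p : S2) : (st p).MDifferentiable (𝓡 2) (𝓡 2) :=
  haveI : IsManifold (𝓡 2) 1 S2 := inferInstance
  mdifferentiable_of_mem_atlas (st_atlas p)

lemma inj_iff {F : S2 → E3} {p : S2} {x : P2} 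
    (hF : MDifferentiableAt (𝓡 2) 𝓘(ℝ, E3) F ((st p).symm x)) :
    Function.Injective (mfderiv (𝓡 2) 𝓘(ℝ, E3) F ((st p).symm x)) ↔
    Function.Injective (fderiv ℝ (fun x => F ((st p).symm x)) x) := by
  have hx : x ∈ (st p).target := by rw [stereographic'_target]; trivial
  have h1 := (st_md p).symm.mfderiv_bijective (x := x) hx
  have h2 : MDifferentiableAt (𝓡 2) (𝓡 2) (st p).symm x :=
    (st_md p).mdifferentiableAt_symm hx
  have h3 := mfderiv_comp x hF h2
  have h4 : fderiv ℝ (fun x => F ((st p).symm x)) x = mfderiv (𝓡 2) 𝓘(ℝ, E3) (F ∘ (st p).symm) x :=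
    mfderiv_eq_fderiv.symm
  have h5 : (fderiv ℝ (fun x => F ((st p).symm x)) x : P2 → E3) = 
     (mfderiv (𝓡 2) 𝓘(ℝ, E3) F ((st p).symm x)) ∘ (mfderiv (𝓡 2) (𝓡 2) (st p).symm x) := by
    rw [h4, h3]; rfl
  rw [h5]
  exact (Function.Injective.of_comp_iff' _ h1).symm

lemma far_nhds (p : S2) (ρ : ℝ) : ∃ V : Set S2, IsOpen V ∧ p ∈ V ∧ ∀ y ∈ V, y ≠ p → ρ ≤ ‖st p y‖ := by
  refine ⟨((st p).symm '' closedBall 0 ρ)ᶜ, ?_, ?_, ?_⟩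
  · exact (((isCompact_closedBall (0:P2) ρ).image (st_symm_smooth p).continuous).isClosed).isOpen_compl
  · rintro ⟨x, -, hx⟩; exact st_symm_ne p x hx
  · intro y hy hyp
    by_contra h
    exact hy ⟨st p y, by simp; linarith, st_left hyp⟩

lemma LM {F : S2 → E3} (hF : _root_.IsImmersion F) (p : S2) {k : P2 → E3}
    (h : FSeg (fun x => F ((st p).symm x)) k) :
    ∃ F' : S2 → E3, _root_.IsImmersion F' ∧ (∀ x, F' ((st p).symm x) = k x) ∧ F' p = F p ∧ RH F F' := by
  obtain ⟨K, hK, hKi, ⟨ρ, hρ⟩, hK0, hK1⟩ := h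
  classical
  let H : ℝ × S2 → E3 := fun z => if z.2 = p then F p else K (z.1, st p z.2)
  have hHp : ∀ t, H (t, p) = F p := fun t => by simp [H]
  have hHx : ∀ t x, H (t, (st p).symm x) = K (t, x) := fun t x => by
    simp [H, st_symm_ne]
  obtain ⟨V, hVo, hpV, hV⟩ := far_nhds p ρ
  have hHV : ∀ t, ∀ y ∈ V, H (t, y) = F y := by
    intro t y hy
    by_cases hyp : y = p
    · rw [hyp, hHp]
    · simp only [H, hyp, if_false]
      rw [hρ t _ (hV y hy hyp)]
      exact congrArg F (st_left hyp)
  have hH : RSm H := by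
    rintro ⟨t, y⟩
    by_cases hyp : y = p
    · have h1 : ContMDiffAt (𝓘(ℝ, ℝ).prod (𝓡 2)) 𝓘(ℝ, E3) (⊤ : ℕ∞) (fun z : ℝ × S2 => F z.2) (t, y) :=
        (hF.1.comp contMDiff_snd) _
      refine h1.congr_of_eventuallyEq ?_
      filter_upwards [(hVo.preimage continuous_snd).mem_nhds (show (t,y).2 ∈ V from hyp ▸ hpV)] with w hw
      exact hHV w.1 w.2 hw
    · have h0 : ContMDiffAt (𝓘(ℝ, ℝ).prod (𝓡 2)) (𝓡 2) (⊤ : ℕ∞) (fun z : ℝ × S2 => st p z.2) (t, y) :=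
        ContMDiffAt.comp (t, y) (st_smoothAt hyp) contMDiffAt_snd
      have h1 : ContMDiffAt (𝓘(ℝ, ℝ).prod (𝓡 2)) 𝓘(ℝ, ℝ × P2) (⊤ : ℕ∞)
          (fun z : ℝ × S2 => (z.1, st p z.2)) (t, y) :=
        ContMDiffAt.prodMk_space contMDiffAt_fst h0
      have h2 : ContMDiffAt (𝓘(ℝ, ℝ).prod (𝓡 2)) 𝓘(ℝ, E3) (⊤ : ℕ∞)
          (fun z : ℝ × S2 => K (z.1, st p z.2)) (t, y) :=
        ContMDiffAt.comp (t, y) (contMDiff_iff_contDiff.2 hK).contMDiffAt h1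
      refine h2.congr_of_eventuallyEq ?_
      filter_upwards [(isOpen_ne.preimage continuous_snd).mem_nhds (show (t,y).2 ≠ p from hyp)] with w hw
      have : w.2 ≠ p := hw
      simp [H, this]
  have hHi : ∀ t ∈ Icc (0:ℝ) 1, ∀ x,
      Function.Injective (mfderiv (𝓡 2) 𝓘(ℝ, E3) (fun y => H (t, y)) x) := by
    intro t ht y
    by_cases hyp : y = p
    · have : (fun y => H (t, y)) =ᶠ[𝓝 y] F := by
        filter_upwards [hVo.mem_nhds (hyp ▸ hpV)] with w hw
        exact hHV t w hw
      have h2 := hF.2 y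
      rw [← this.mfderiv_eq] at h2
      exact h2
    · obtain ⟨x, rfl⟩ : ∃ x, y = (st p).symm x := ⟨_, (st_left hyp).symm⟩
      rw [inj_iff ((hH.slice t _).mdifferentiableAt (by simp))]
      simp only [hHx]
      exact hKi t ht x
  refine ⟨fun y => H (1, y), ⟨hH.slice 1, hHi 1 (by simp)⟩, fun x => (hHx 1 x).trans (hK1 x), hHp 1,
    RH.of hH hHi (fun y => ?_) (fun y => rfl)⟩
  by_cases hyp : y = p
  · rw [hyp, hHp]
  · simp only [H, hyp, if_false]
    rw [hK0]
    exact congrArg F (st_left hyp)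

lemma ff_smooth {F : S2 → E3} (hF : _root_.IsImmersion F) (p : S2) :
    ContDiff ℝ ∞ (fun x => F ((st p).symm x)) :=
  contMDiff_iff_contDiff.1 (hF.1.comp (st_symm_smooth p))

lemma ff_inj {F : S2 → E3} (hF : _root_.IsImmersion F) (p : S2) (x : P2) :
    Function.Injective (fderiv ℝ (fun x => F ((st p).symm x)) x) :=
  (inj_iff ((hF.1 _).mdifferentiableAt (by simp))).1 (hF.2 _)

/-- Final step: immersions which agree near `p`. -/
lemma agree_RH {f g : S2 → E3} (hf : _root_.IsImmersion f) (hg : _root_.IsImmersion g) (p : S2)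
    (h : ∀ᶠ y in 𝓝 p, f y = g y) : RH f g := by
  obtain ⟨U, hU, hUo, hpU⟩ := _root_.eventually_nhds_iff.1 h
  obtain ⟨R, hR, hfg⟩ : ∃ R : ℝ, 0 < R ∧ ∀ x : P2, R ≤ ‖x‖ → f ((st p).symm x) = g ((st p).symm x) := by
    have hc : IsCompact Uᶜ := hUo.isClosed_compl.isCompact
    have hcont : ContinuousOn (st p) Uᶜ := (st p).continuousOn.mono (fun y hy => st_mem (by
      rintro rfl; exact hy hpU))
    obtain ⟨R, hR⟩ := (hc.image_of_continuousOn hcont).isBounded.exists_norm_le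
    refine ⟨max R 0 + 1, by positivity, fun x hx => hU _ ?_⟩
    by_contra hn
    have := hR _ ⟨_, hn, rfl⟩
    rw [st_right] at this
    linarith [le_max_left R 0]
  obtain ⟨k1, k2, k3, k4, s1, s2, s3, s4, s5⟩ := flat_main _ _ (ff_smooth hf p) (ff_smooth hg p)
    (ff_inj hf p) (ff_inj hg p) R hR hfg
  obtain ⟨F1, i1, e1, p1, r1⟩ := LM hf p s1
  obtain rfl : (fun x => F1 ((st p).symm x)) = k1 := funext e1
  obtain ⟨F2, i2, e2, p2, r2⟩ := LM i1 p s2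
  obtain rfl : (fun x => F2 ((st p).symm x)) = k2 := funext e2
  obtain ⟨F3, i3, e3, p3, r3⟩ := LM i2 p s3
  obtain rfl : (fun x => F3 ((st p).symm x)) = k3 := funext e3
  obtain ⟨F4, i4, e4, p4, r4⟩ := LM i3 p s4
  obtain ⟨G, iG, eG, pG, rG⟩ := LM hg p s5
  have : F4 = G := by
    funext y
    by_cases hyp : y = p
    · rw [hyp, p4, p3, p2, p1, pG, h.self_of_nhds]
    · rw [← st_left hyp, e4, eG]
  subst this
  exact (((r1.trans r2).trans r3).trans r4).trans rG.symm

lemma inj_comp {φ : E3 → E3} (hφ : ContDiff ℝ ∞ φ) (hi : ∀ x, Function.Injective (fderiv ℝ φ x))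
    {f : S2 → E3} (hf : _root_.IsImmersion f) : _root_.IsImmersion (fun y => φ (f y)) := by
  refine ⟨(contMDiff_iff_contDiff.2 hφ).comp hf.1, fun x => ?_⟩
  have h1 : MDifferentiableAt 𝓘(ℝ, E3) 𝓘(ℝ, E3) φ (f x) :=
    ((contMDiff_iff_contDiff.2 hφ) (f x)).mdifferentiableAt (by simp)
  have h2 : MDifferentiableAt (𝓡 2) 𝓘(ℝ, E3) f x := (hf.1 x).mdifferentiableAt (by simp)
  have h3 := mfderiv_comp x h1 h2
  have h5 : (mfderiv (𝓡 2) 𝓘(ℝ, E3) (fun y => φ (f y)) x : P2 → E3) =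
      (fderiv ℝ φ (f x)) ∘ (mfderiv (𝓡 2) 𝓘(ℝ, E3) f x) := by
    rw [← mfderiv_eq_fderiv]
    exact congrArg (fun L : P2 →L[ℝ] E3 => (L : P2 → E3)) h3
  have : Function.Injective ((fderiv ℝ φ (f x)) ∘ (mfderiv (𝓡 2) 𝓘(ℝ, E3) f x)) := (hi _).comp (hf.2 x)
  rw [← h5] at this
  exact this

lemma inj_lin {L : E3 →L[ℝ] E3} (hL : Function.Injective L)
    {f : S2 → E3} (hf : _root_.IsImmersion f) : _root_.IsImmersion (fun y => L (f y)) :=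
  inj_comp L.contDiff (fun x => by rw [ContinuousLinearMap.fderiv]; exact hL) hf

lemma lin_step {A : ℝ → E3 × E3} (hA : ContDiff ℝ ∞ A) (hLI : ∀ t ∈ Icc (0:ℝ) 1, LI (A t).1 (A t).2)
    {p q : E3 × E3} (h0 : A 0 = p) (h1 : A 1 = q)
    {f : S2 → E3} (hf : _root_.IsImmersion f) : RH (fun y => Fr p (f y)) (fun y => Fr q (f y)) := by
  refine RH.of (H := fun z => Fr (A z.1) (f z.2)) ?_ (fun t ht => (inj_lin (Fr_inj (hLI t ht)) hf).2)
    (fun x => by simp [h0]) (fun x => by simp [h1])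
  have h2 : ContMDiff (𝓘(ℝ, ℝ).prod (𝓡 2)) 𝓘(ℝ, E3 →L[ℝ] E3) (⊤ : ℕ∞) (fun z : ℝ × S2 => Fr (A z.1)) :=
    (contMDiff_iff_contDiff.2 (Fr_contDiff hA)).comp contMDiff_fst
  have h3 : ContMDiff (𝓘(ℝ, ℝ).prod (𝓡 2)) 𝓘(ℝ, E3) (⊤ : ℕ∞) (fun z : ℝ × S2 => f z.2) :=
    hf.1.comp contMDiff_snd
  exact h2.clm_apply h3

lemma trans_step {f : S2 → E3} (hf : _root_.IsImmersion f) (c : E3) :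
    _root_.IsImmersion (fun y => f y + c) ∧ RH f (fun y => f y + c) := by
  have key : ∀ c : E3, _root_.IsImmersion (fun y => f y + c) := fun c =>
    inj_comp (φ := fun w => w + c) (by fun_prop)
      (fun x => by rw [fderiv_add_const, fderiv_fun_id]; exact fun _ _ h => h) hf
  refine ⟨key c, RH.of (H := fun z => f z.2 + z.1 • c) ?_ (fun t ht => (key (t • c)).2)
    (fun x => by simp) (fun x => by simp)⟩
  have h3 : ContMDiff (𝓘(ℝ, ℝ).prod (𝓡 2)) 𝓘(ℝ, E3) (⊤ : ℕ∞) (fun z : ℝ × S2 => f z.2) :=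
    hf.1.comp contMDiff_snd
  have h4 : ContMDiff (𝓘(ℝ, ℝ).prod (𝓡 2)) 𝓘(ℝ, E3) (⊤ : ℕ∞) (fun z : ℝ × S2 => z.1 • c) :=
    contMDiff_fst.smul contMDiff_const
  exact h3.add h4

lemma dt_cr_left (a b : E3) : dt (cr a b) a = 0 := by simp [dt, cr]; ring
lemma dt_cr_right (a b : E3) : dt (cr a b) b = 0 := by simp [dt, cr]; ring
lemma dt_cr_swap (a b w : E3) : dt (cr b a) w = - dt (cr a b) w := by simp [dt, cr]; ring
lemma dt_lin (n a b w : E3) (s u v : ℝ) :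
    dt n (s • a + (u • b + v • w)) = s * dt n a + u * dt n b + v * dt n w := by
  simp [dt]; ring

lemma LI.swap {a b : E3} (h : LI a b) : LI b a := fun s t hst => by
  have := h t s (by rw [add_comm]; exact hst)
  exact ⟨this.2, this.1⟩

lemma LI.seg {a b w : E3} (h : LI a b) (hw : dt (cr a b) w ≠ 0) (t : ℝ) :
    LI a ((1 - t) • b + t • w) := by
  intro s u hsu
  have h1 : s • a + ((u * (1 - t)) • b + (u * t) • w) = 0 := by
    rw [← hsu]; module
  have h2 := dt_lin (cr a b) a b w s (u * (1 - t)) (u * t)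
  rw [h1, dt_cr_left, dt_cr_right] at h2
  have h3 : u * t = 0 := by
    have : dt (cr a b) 0 = 0 := by simp [dt]
    rw [this] at h2
    have : (u * t) * dt (cr a b) w = 0 := by linarith
    exact (mul_eq_zero.1 this).resolve_right hw
  rw [h3, zero_smul, add_zero] at h1
  obtain ⟨h4, h5⟩ := h _ _ h1
  exact ⟨h4, by nlinarith⟩

lemma choose_w {m n : E3} (hm : m ≠ 0) (hn : n ≠ 0) : ∃ w, dt m w ≠ 0 ∧ dt n w ≠ 0 := by
  have h1 := dt_pos hm
  have h2 := dt_pos hn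
  by_cases h : dt n m = 0
  · refine ⟨m + n, ?_, ?_⟩
    · have : dt m (m + n) = dt m m + dt n m := by simp [dt]; ring
      rw [this, h]; linarith
    · have : dt n (m + n) = dt n m + dt n n := by simp [dt]; ring
      rw [this, h]; linarith
  · exact ⟨m, h1.ne', h⟩

lemma move2 {a b w : E3} (h : LI a b) (hw : dt (cr a b) w ≠ 0) :
    LI a w ∧ ∀ {f : S2 → E3} (_ : _root_.IsImmersion f), RH (fun y => Fr (a, b) (f y)) (fun y => Fr (a, w) (f y)) := by
  refine ⟨by simpa using h.seg hw 1, fun hf => ?_⟩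
  exact lin_step (A := fun t => (a, (1 - t) • b + t • w)) (by fun_prop) (fun t _ => h.seg hw t)
    (by simp) (by simp) hf

lemma move1 {a b w : E3} (h : LI a b) (hw : dt (cr a b) w ≠ 0) :
    LI w b ∧ ∀ {f : S2 → E3} (_ : _root_.IsImmersion f), RH (fun y => Fr (a, b) (f y)) (fun y => Fr (w, b) (f y)) := by
  have hw' : dt (cr b a) w ≠ 0 := by rw [dt_cr_swap]; simpa using hw
  refine ⟨by simpa using (h.swap.seg hw' 1).swap, fun hf => ?_⟩
  exact lin_step (A := fun t => ((1 - t) • a + t • w, b)) (by fun_prop) (fun t _ => (h.swap.seg hw' t).swap)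
    (by simp) (by simp) hf

lemma frame_RH {p q : E3 × E3} (hp : LI p.1 p.2) (hq : LI q.1 q.2)
    {f : S2 → E3} (hf : _root_.IsImmersion f) : RH (fun y => Fr p (f y)) (fun y => Fr q (f y)) := by
  obtain ⟨a, b⟩ := p
  obtain ⟨c, d⟩ := q
  obtain ⟨w, w1, w2⟩ := choose_w hp.cr_ne hq.cr_ne
  obtain ⟨p1, r1⟩ := move2 hp w1
  obtain ⟨q1, s1⟩ := move2 hq w2
  obtain ⟨u, u1, u2⟩ := choose_w p1.cr_ne q1.cr_ne
  obtain ⟨p2, r2⟩ := move1 p1 u1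
  obtain ⟨q2, s2⟩ := move1 q1 u2
  exact ((r1 hf).trans (r2 hf)).trans (((s1 hf).trans (s2 hf)).symm)

/-- Affine step. -/
lemma affine_step {f g : S2 → E3} (hf : _root_.IsImmersion f) (hg : _root_.IsImmersion g)
    {q : S2} (x0 : P2) : ∃ f1, _root_.IsImmersion f1 ∧ RH f f1 ∧
      f1 ((st q).symm x0) = g ((st q).symm x0) ∧
      fderiv ℝ (fun x => f1 ((st q).symm x)) x0 = fderiv ℝ (fun x => g ((st q).symm x)) x0 := by
  set fh := (fun x => f ((st q).symm x)) with hfh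
  set gh := (fun x => g ((st q).symm x)) with hgh
  have hP := dfr_LI (ff_inj hf q x0)
  have hQ := dfr_LI (ff_inj hg q x0)
  obtain ⟨G, -, hG1, hG2⟩ := exists_inv (fun _ => Fr (dfr fh x0)) contDiff_const (fun _ => Fr_inj hP)
  have hGi : Function.Injective (G 0) := fun a b hab => by rw [← hG1 0 a, ← hG1 0 b, hab]
  have hf' := inj_lin hGi hf
  have r1 := frame_RH hP hQ hf'
  rw [show (fun y => Fr (dfr fh x0) (G 0 (f y))) = f from funext fun y => hG1 0 _] at r1
  have i2 := inj_lin (Fr_inj hQ) hf'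
  obtain ⟨i3, r3⟩ := trans_step i2 (g ((st q).symm x0) - Fr (dfr gh x0) (G 0 (f ((st q).symm x0))))
  refine ⟨_, i3, r1.trans r3, by simp [hgh], ?_⟩
  have hd : HasFDerivAt fh (fderiv ℝ fh x0) x0 :=
    ((ff_smooth hf q).differentiable (by simp) x0).hasFDerivAt
  have h4 := (((Fr (dfr gh x0)).comp (G 0)).hasFDerivAt.comp x0 hd).add_const
    (g ((st q).symm x0) - Fr (dfr gh x0) (G 0 (f ((st q).symm x0))))
  have h5 := h4.fderiv
  refine Eq.trans h5 ?_
  ext1 v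
  have h6 : G 0 (fderiv ℝ fh x0 v) = iota v := by
    rw [dfr_apply, ← Fr_iota]; exact hG2 0 _
  simp only [ContinuousLinearMap.comp_apply]
  rw [h6, Fr_iota, dfr_apply]

lemma cut_bound {R : ℝ} {χ : P2 → ℝ} (h : IsCut R χ) : ∃ M, 0 ≤ M ∧ ∀ x, ‖fderiv ℝ χ x‖ ≤ M := by
  have hs : HasCompactSupport χ := HasCompactSupport.intro (isCompact_closedBall (0:P2) (R+1))
    (fun x hx => h.outer x (by simp at hx; exact hx.le))
  obtain ⟨M, hM⟩ := (hs.fderiv (𝕜 := ℝ)).exists_bound_of_continuous (h.smooth.continuous_fderiv (by simp))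
  exact ⟨max M 0, le_max_right _ _, fun x => (hM x).trans (le_max_left _ _)⟩

lemma local_flat (f g : P2 → E3) (hf : ContDiff ℝ ∞ f) (hg : ContDiff ℝ ∞ g)
    (hfi : ∀ x, Function.Injective (fderiv ℝ f x)) (x0 : P2) (h0 : f x0 = g x0)
    (h1 : fderiv ℝ f x0 = fderiv ℝ g x0) :
    ∃ k, FSeg f k ∧ ∀ᶠ x in 𝓝 x0, k x = g x := by
  obtain ⟨χ, hχ⟩ := exists_cut 1 one_pos
  obtain ⟨M, hM0, hM⟩ := cut_bound hχ
  obtain ⟨r, hr, hball⟩ := Metric.isOpen_iff.1 isOpen_inj _ (hfi x0)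
  set k : P2 → E3 := fun x => g x - f x with hk
  have hks : ContDiff ℝ ∞ k := hg.sub hf
  have hk0 : k x0 = 0 := by simp [hk, h0]
  have hdk0 : fderiv ℝ k x0 = 0 := by
    rw [hk, fderiv_fun_sub (hg.differentiable (by simp) x0) (hf.differentiable (by simp) x0), h1, sub_self]
  set η : ℝ := r / (4 * (1 + 2 * M)) with hη
  have hηp : 0 < η := by positivity
  have hηM : η * (1 + 2 * M) = r / 4 := by rw [hη]; field_simp
  have c1 : ∀ᶠ x in 𝓝 x0, ‖fderiv ℝ f x - fderiv ℝ f x0‖ < r / 2 := by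
    have : Continuous (fun x => ‖fderiv ℝ f x - fderiv ℝ f x0‖) :=
      ((hf.continuous_fderiv (by simp)).sub continuous_const).norm
    exact this.continuousAt.eventually_lt continuousAt_const (by simp; positivity)
  have c2 : ∀ᶠ x in 𝓝 x0, ‖fderiv ℝ k x‖ < η := by
    have : Continuous (fun x => ‖fderiv ℝ k x‖) := (hks.continuous_fderiv (by simp)).norm
    exact this.continuousAt.eventually_lt continuousAt_const (by simp [hdk0]; positivity)
  obtain ⟨δ, hδ, hδ'⟩ := Metric.eventually_nhds_iff_ball.1 (c1.and c2)
  have hkb : ∀ x ∈ ball x0 δ, ‖k x‖ ≤ η * ‖x - x0‖ := by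
    intro x hx
    have := (convex_ball x0 δ).norm_image_sub_le_of_norm_fderiv_le (𝕜 := ℝ) (f := k) (C := η)
      (fun y _ => hks.differentiable (by simp) y) (fun y hy => (hδ' y hy).2.le)
      (mem_ball_self hδ) hx
    simpa [hk0] using this
  set ε : ℝ := δ / 4 with hε
  have hεp : 0 < ε := by positivity
  let c : P2 → ℝ := fun x => χ (ε⁻¹ • (x - x0))
  have hc : ContDiff ℝ ∞ c := hχ.smooth.comp (by fun_prop)
  have hcout : ∀ x, 2 * ε ≤ ‖x - x0‖ → c x = 0 := by
    intro x hx
    apply hχ.outer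
    rw [norm_smul, norm_inv, Real.norm_of_nonneg hεp.le]
    rw [inv_mul_eq_div, le_div_iff₀ hεp]; linarith
  have hcin : ∀ x, ‖x - x0‖ ≤ ε → c x = 1 := by
    intro x hx
    apply hχ.inner
    rw [norm_smul, norm_inv, Real.norm_of_nonneg hεp.le]
    rw [inv_mul_eq_div, div_le_iff₀ hεp]; linarith
  have hdc : ∀ x, ‖fderiv ℝ c x‖ ≤ M * ε⁻¹ := by
    intro x
    have e1 : HasFDerivAt (fun x : P2 => ε⁻¹ • (x - x0)) (ε⁻¹ • ContinuousLinearMap.id ℝ P2) x :=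
      ((hasFDerivAt_id x).sub_const x0).const_smul ε⁻¹
    have e2 := ((hχ.smooth.differentiable (by simp)) (ε⁻¹ • (x - x0))).hasFDerivAt.comp x e1
    have e3 : fderiv ℝ c x = _ := e2.fderiv
    rw [e3]
    refine (ContinuousLinearMap.opNorm_comp_le _ _).trans ?_
    refine mul_le_mul (hM _) ?_ (norm_nonneg _) hM0
    rw [norm_smul, norm_inv, Real.norm_of_nonneg hεp.le]
    exact mul_le_of_le_one_right (by positivity) ContinuousLinearMap.norm_id_le
  refine ⟨fun x => f x + c x • k x, ⟨fun z => f z.2 + z.1 • (c z.2 • k z.2), ?_, ?_, ⟨‖x0‖ + 2 * ε, ?_⟩, ?_, ?_⟩, ?_⟩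
  · exact (hf.comp contDiff_snd).add (contDiff_fst.smul ((hc.comp contDiff_snd).smul (hks.comp contDiff_snd)))
  · intro t ht x
    by_cases hx : ‖x - x0‖ ≤ 2 * ε
    · have hxb : x ∈ ball x0 δ := by
        rw [mem_ball, dist_eq_norm]; linarith
      have d1 := (hf.differentiable (by simp) x).hasFDerivAt
      have d2 := (hc.differentiable (by simp) x).hasFDerivAt
      have d3 := (hks.differentiable (by simp) x).hasFDerivAt
      have d4 := d1.add ((d2.smul d3).const_smul t)
      have d5 : fderiv ℝ (fun y => f y + t • (c y • k y)) x = _ := d4.fderiv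
      show Function.Injective (fderiv ℝ (fun y => f y + t • (c y • k y)) x)
      rw [d5]
      apply hball
      rw [mem_ball, dist_eq_norm]
      have n1 := (hδ' x hxb).1
      have n2 := (hδ' x hxb).2
      have n3 := hkb x hxb
      have n4 : ‖c x • fderiv ℝ k x‖ ≤ η := by
        rw [norm_smul, Real.norm_of_nonneg (hχ.nonneg _)]
        exact (mul_le_of_le_one_left (norm_nonneg _) (hχ.le_one _)).trans n2.le
      have n5 : ‖(fderiv ℝ c x).smulRight (k x)‖ ≤ 2 * M * η := by
        rw [ContinuousLinearMap.norm_smulRight_apply]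
        calc _ ≤ (M * ε⁻¹) * (η * (2 * ε)) :=
              mul_le_mul (hdc x) (n3.trans (by gcongr)) (norm_nonneg _) (by positivity)
          _ = _ := by field_simp
      have n6 : ‖t • (c x • fderiv ℝ k x + (fderiv ℝ c x).smulRight (k x))‖ ≤ η + 2 * M * η := by
        rw [norm_smul, Real.norm_of_nonneg ht.1]
        exact (mul_le_of_le_one_left (norm_nonneg _) ht.2).trans ((norm_add_le _ _).trans (add_le_add n4 n5))
      rw [add_sub_right_comm]
      refine (norm_add_le _ _).trans_lt ?_
      nlinarith
    · push Not at hx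
      have : (fun y => f y + t • (c y • k y)) =ᶠ[𝓝 x] f := by
        filter_upwards [(isOpen_lt continuous_const (by fun_prop : Continuous fun y : P2 => ‖y - x0‖)).mem_nhds hx] with y hy
        rw [hcout y (le_of_lt hy)]; simp
      show Function.Injective (fderiv ℝ (fun y => f y + t • (c y • k y)) x)
      rw [this.fderiv_eq]; exact hfi x
  · intro t x hx
    have : c x = 0 := hcout x (by linarith [norm_sub_norm_le x x0])
    simp [this]
  · intro x; simp
  · intro x; simp
  · filter_upwards [ball_mem_nhds x0 hεp] with x hx
    rw [mem_ball, dist_eq_norm] at hx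
    simp [hcin x hx.le, hk]

lemma smale_main (f g : S2 → E3) (hf : _root_.IsImmersion f) (hg : _root_.IsImmersion g) : RH f g := by
  obtain ⟨p⟩ : Nonempty S2 := ⟨⟨e0, by simp [e0, EuclideanSpace.norm_eq, Fin.sum_univ_three]⟩⟩
  set q : S2 := -p
  have hpq : p ≠ q := ne_neg_of_mem_unit_sphere ℝ p
  obtain ⟨f1, i1, r1, v1, d1⟩ := affine_step hf hg (q := q) (st q p)
  obtain ⟨k, hk, hkg⟩ := local_flat _ _ (ff_smooth i1 q) (ff_smooth hg q) (ff_inj i1 q) (st q p) v1 d1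
  obtain ⟨f2, i2, e2, -, r2⟩ := LM i1 q hk
  refine (r1.trans r2).trans (agree_RH i2 hg p ?_)
  have hc : ContinuousAt (st q) p := (st_smoothAt hpq).continuousAt
  filter_upwards [hc.eventually hkg, isOpen_ne.mem_nhds hpq] with y hy hyq
  rw [← e2] at hy
  simpa only [st_left hyq] using hy

end Aux

/-- Smale's theorem: any two smooth immersions of the 2-sphere into Euclidean
3-space are regularly homotopic. -/
theorem smale_sphere_immersions_regularly_homotopic
    (f g : S2 → E3) (hf : IsImmersion f) (hg : IsImmersion g) :
    RegularHomotopic f g := by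
  exact (smale_main f g hf hg).regular
end
end

section
/- The sphere can be everted: the standard inclusion ι : S² → ℝ³ and its negation −ι (the map x ↦ −x, which is the inclusion composed with the antipodal map and presents the sphere inside-out) are regularly homotopic. That is, there exists a smooth map H : [0,1] × S² → ℝ³ with H(0,·) = ι, H(1,·) = −ι, and such that for every t ∈ [0,1] the map H(t,·) has injective differential at every point of S². -/
open Metric Manifold

noncomputable section

set_option maxHeartbeats 1000000 in
theorem ev_sigma (x y W1 W2 R x' y' W1' W2' R' : ℝ) (hR : 0 < R)
    (hS : 0 < x^2+y^2+W1^2+W2^2)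
    (h1 : (R' * (2*(x*W1-y*W2)) + R * (2*(x'*W1+x*W1'-y'*W2-y*W2'))) * (x^2+y^2+W1^2+W2^2)
      - R * (2*(x*W1-y*W2)) * (2*(x*x'+y*y'+W1*W1'+W2*W2')) = 0)
    (h2 : (R' * (2*(x*W2+y*W1)) + R * (2*(x'*W2+x*W2'+y'*W1+y*W1'))) * (x^2+y^2+W1^2+W2^2)
      - R * (2*(x*W2+y*W1)) * (2*(x*x'+y*y'+W1*W1'+W2*W2')) = 0)
    (h3 : (R' * (x^2+y^2-W1^2-W2^2) + R * (2*(x*x'+y*y'-W1*W1'-W2*W2'))) * (x^2+y^2+W1^2+W2^2)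
      - R * (x^2+y^2-W1^2-W2^2) * (2*(x*x'+y*y'+W1*W1'+W2*W2')) = 0) :
    R' = 0 ∧ x*W1'+y*W2' = W1*x'+W2*y' ∧ x*W2'-y*W1' = W2*x'-W1*y' := by
  have hR' : R' = 0 := by
    have : R' * (x^2+y^2+W1^2+W2^2)^3 = 0 := by
      linear_combination (2*(x*W1-y*W2)) * h1 + (2*(x*W2+y*W1)) * h2 + (x^2+y^2-W1^2-W2^2) * h3
    rcases mul_eq_zero.1 this with h | h
    · exact h
    · exact absurd h (by positivity)
  subst hR'
  have hx : (2*(x'*W1+x*W1'-y'*W2-y*W2')) * (x^2+y^2+W1^2+W2^2)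
      = (2*(x*W1-y*W2)) * (2*(x*x'+y*y'+W1*W1'+W2*W2')) := by
    apply mul_left_cancel₀ hR.ne'; linear_combination h1
  have hy : (2*(x'*W2+x*W2'+y'*W1+y*W1')) * (x^2+y^2+W1^2+W2^2)
      = (2*(x*W2+y*W1)) * (2*(x*x'+y*y'+W1*W1'+W2*W2')) := by
    apply mul_left_cancel₀ hR.ne'; linear_combination h2
  have hz : (2*(x*x'+y*y'-W1*W1'-W2*W2')) * (x^2+y^2+W1^2+W2^2)
      = (x^2+y^2-W1^2-W2^2) * (2*(x*x'+y*y'+W1*W1'+W2*W2')) := by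
    apply mul_left_cancel₀ hR.ne'; linear_combination h3
  have key : (x^2+y^2+W1^2+W2^2)^2 * 4 * ((x*W1'+y*W2' - (W1*x'+W2*y'))^2
      + (x*W2'-y*W1' - (W2*x'-W1*y'))^2) = 0 := by
    have e : (x^2+y^2+W1^2+W2^2)^2 * 4 * ((x*W1'+y*W2' - (W1*x'+W2*y'))^2
      + (x*W2'-y*W1' - (W2*x'-W1*y'))^2) =
      ((2*(x'*W1+x*W1'-y'*W2-y*W2')) * (x^2+y^2+W1^2+W2^2))^2
      + ((2*(x'*W2+x*W2'+y'*W1+y*W1')) * (x^2+y^2+W1^2+W2^2))^2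
      + ((2*(x*x'+y*y'-W1*W1'-W2*W2')) * (x^2+y^2+W1^2+W2^2))^2
      - ((2*(x*x'+y*y'+W1*W1'+W2*W2')) * (x^2+y^2+W1^2+W2^2))^2 := by ring
    rw [e, hx, hy, hz]; ring
  have key2 : (x*W1'+y*W2' - (W1*x'+W2*y'))^2
      + (x*W2'-y*W1' - (W2*x'-W1*y'))^2 = 0 := by
    rcases mul_eq_zero.1 key with h | h
    · exact absurd h (by positivity)
    · exact h
  have h := (add_eq_zero_iff_of_nonneg (sq_nonneg _) (sq_nonneg _)).1 key2
  exact ⟨rfl, sub_eq_zero.1 (pow_eq_zero_iff two_ne_zero |>.1 h.1),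
    sub_eq_zero.1 (pow_eq_zero_iff two_ne_zero |>.1 h.2)⟩

theorem ev_scale {a b B : ℝ} (ha : |a| ≤ 1) (hb : |b| ≤ B) : |a*b| ≤ B := by
  rw [abs_mul]
  calc |a| * |b| ≤ 1 * |b| := mul_le_mul_of_nonneg_right ha (abs_nonneg _)
    _ = |b| := one_mul _
    _ ≤ B := hb

theorem ev_sq {a : ℝ} (h : a^2 ≤ 1) : |a| ≤ 1 := (sq_le_one_iff_abs_le_one a).1 h

theorem ev_abs {a : ℝ} (h0 : 0 ≤ a) (h : a ≤ 1) : |a| ≤ 1 := by rwa [abs_of_nonneg h0]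

theorem ev_k (K D k : ℝ) (hK1 : 9/10 ≤ K) (hD1 : D ≤ 1/100) (hD2 : -(1/100) ≤ D)
    (hk : k = K/(K-D)) : 98/100 ≤ k ∧ k ≤ 102/100 := by
  have hL : 0 < K - D := by linarith
  constructor
  · rw [hk, le_div_iff₀ hL]; linarith
  · rw [hk, div_le_iff₀ hL]; linarith

theorem ev_quad (τ w s X : ℝ) (hw : w = 1 - τ^2) (hs2 : s^2 ≤ 1)
    (hXw : X + w^2*s^2 = w^2) (h : X + 98/100*(w^2*s^2) + τ^2 - τ*w*s ≤ 0) : False := by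
  have h1 : 0 ≤ (τ - w*s/2)^2 := sq_nonneg _
  have h2 : w^2*s^2 ≤ w^2 * 1 := mul_le_mul_of_nonneg_left hs2 (sq_nonneg _)
  have e : (τ - w*s/2)^2 = τ^2 - τ*w*s + w^2*s^2/4 := by ring
  have hw2 : w^2 ≤ 0 := by linarith
  have hw0 : w = 0 := by
    have := le_antisymm hw2 (sq_nonneg w)
    exact pow_eq_zero_iff two_ne_zero |>.1 this
  subst hw0
  have : τ^2 = 1 := by linarith
  simp only [zero_pow two_ne_zero, zero_mul, mul_zero] at *
  linarith

theorem ev_fin (K g Y w τ s v ρ X : ℝ) (hρ0 : 0 < ρ) (hρ1 : ρ ≤ 1) (hρ3 : 98/100 ≤ ρ)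
    (hτ : τ^2 ≤ 1) (hw0 : 0 ≤ w) (hw1 : w ≤ 1) (hs2 : s^2 ≤ 1) (hK1 : 9/10 ≤ K)
    (hY : Y = ρ*X) (hY0 : 0 ≤ Y) (hg1 : 98/1000 * Y ≤ g) (hg2 : g ≤ 102/1000 * Y)
    (hv2 : v^2 ≤ 105/10000 * Y) (hv1 : v^2 ≤ 1)
    (III : 20*K*g + w*τ*s*(4*v^2-3*v^4 - ρ*g/10) - ρ*τ^2/10*g
      + ρ^2*w^2*s^2 - 2*ρ*w^2*v^2*s^2 + ρ*w*s*τ/10*g + ρ*τ^2 - ρ*τ*w*s = 0) :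
    X + 98/100*(w^2*s^2) + τ^2 - τ*w*s ≤ 0 := by
  have hg0 : 0 ≤ g := by linarith
  have aw : |w| ≤ 1 := ev_abs hw0 hw1
  have aρ : |ρ| ≤ 1 := ev_abs hρ0.le hρ1
  have aτ : |τ| ≤ 1 := ev_sq hτ
  have as : |s| ≤ 1 := ev_sq hs2
  have ag : |g| ≤ 102/1000 * Y := by rwa [abs_of_nonneg hg0]
  have av : |v^2| ≤ 105/10000 * Y := by rwa [abs_of_nonneg (sq_nonneg v)]
  have t1 : 17/10 * Y ≤ 20*K*g := by
    have : 9/10 * (98/1000*Y) ≤ K * g := mul_le_mul hK1 hg1 (by positivity) (by linarith)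
    linarith
  have hv4 : v^4 ≤ v^2 := by
    have : v^2 * v^2 ≤ v^2 * 1 := mul_le_mul_of_nonneg_left hv1 (sq_nonneg _)
    calc v^4 = v^2 * v^2 := by ring
      _ ≤ _ := by linarith
  have hv40 : 0 ≤ v^4 := by positivity
  have hv20 : 0 ≤ v^2 := by positivity
  have t2 : |w*(τ*(s*(4*v^2-3*v^4 - ρ*g/10)))| ≤ 6/100*Y := by
    have hρg := abs_le.1 (ev_scale aρ ag)
    refine ev_scale aw (ev_scale aτ (ev_scale as ?_))
    rw [abs_le]; constructor <;> linarith
  have t3 := abs_le.1 (ev_scale aρ (ev_scale aτ (ev_scale aτ ag)))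
  have t4 := abs_le.1 (ev_scale aρ (ev_scale aw (ev_scale aw (ev_scale as (ev_scale as av)))))
  have t5 := abs_le.1 (ev_scale aρ (ev_scale aw (ev_scale as (ev_scale aτ ag))))
  have t2' := abs_le.1 t2
  have t6 : 98/100 * (ρ*(w^2*s^2)) ≤ ρ*(ρ*(w^2*s^2)) :=
    mul_le_mul_of_nonneg_right hρ3 (by positivity)
  have fin : ρ * (X + 98/100*(w^2*s^2) + τ^2 - τ*w*s) ≤ ρ * 0 := by
    have e : ρ * (X + 98/100*(w^2*s^2) + τ^2 - τ*w*s) =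
      Y + 98/100 * (ρ*(w^2*s^2)) + ρ*τ^2 - ρ*τ*w*s := by rw [hY]; ring
    rw [e]
    have III' : 20*K*g + w*(τ*(s*(4*v^2-3*v^4 - ρ*g/10))) - (ρ*(τ*(τ*g)))/10
      + ρ*(ρ*(w^2*s^2)) - 2*(ρ*(w*(w*(s*(s*v^2))))) + (ρ*(w*(s*(τ*g))))/10 + ρ*τ^2 - ρ*τ*w*s = 0 := by
      linear_combination III
    linarith [t2'.1, t3.2, t4.2, t5.1]
  exact le_of_mul_le_mul_left fin hρ0

theorem ev_core (v ρ c s τ w α β : ℝ) (hρ : ρ = 1 - v^2) (hρ0 : 0 < ρ) (hcs : c^2+s^2=1)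
    (hτ : τ^2 ≤ 1) (hw : w = 1 - τ^2)
    (e1 : β*(w/10*ρ*c - v) = v*ρ*α*(τ/10 + w/10*s))
    (e2 : α*(1 - w/10*ρ*c*v) + ρ*β*(τ/10 - w/10*s) = 0)
    (e3 : α*(w*(ρ*s-2*v^2*s+τ/10*v*c) - τ) + β*w*(2*v*c+τ/10*s) = 0) : α = 0 ∧ β = 0 := by
  have hw0 : 0 ≤ w := by linarith
  have hw1 : w ≤ 1 := by linarith [sq_nonneg τ]
  have hρ1 : ρ ≤ 1 := by linarith [sq_nonneg v]
  have hv1 : v^2 ≤ 1 := by linarith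
  have hs2 : s^2 ≤ 1 := by linarith [sq_nonneg c]
  have hc2 : c^2 ≤ 1 := by linarith [sq_nonneg s]
  have aw : |w| ≤ 1 := ev_abs hw0 hw1
  have aρ : |ρ| ≤ 1 := ev_abs hρ0.le hρ1
  have aτ : |τ| ≤ 1 := ev_sq hτ
  have as : |s| ≤ 1 := ev_sq hs2
  have ac : |c| ≤ 1 := ev_sq hc2
  have av : |v| ≤ 1 := ev_sq hv1
  have hK := abs_le.1 (ev_scale aw (ev_scale aρ (ev_scale ac av)))
  obtain ⟨K, hKd⟩ : ∃ K, K = 1 - w/10*ρ*c*v := ⟨_, rfl⟩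
  have hKd' : K = 1 - (w*(ρ*(c*v)))/10 := by rw [hKd]; ring
  have hK1 : 9/10 ≤ K := by linarith [hK.2]
  rw [← hKd] at e2
  suffices hβ : β = 0 by
    refine ⟨?_, hβ⟩
    rw [hβ] at e2
    have : α * K = 0 := by linarith
    rcases mul_eq_zero.1 this with h | h
    · exact h
    · linarith
  by_contra hβ
  have I : v*(K - ρ^2*(τ^2-w^2*s^2)/100) = w/10*ρ*c*K := by
    apply mul_left_cancel₀ hβ
    linear_combination (-K) * e1 - v*ρ*(τ/10+w/10*s)*e2
  have II : w*(2*K*v*c + τ/10*s*K) = ρ*(τ/10-w/10*s)*(w*(ρ*s-2*v^2*s+τ/10*v*c) - τ) := by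
    apply mul_left_cancel₀ hβ
    linear_combination K * e3 - (w*(ρ*s-2*v^2*s+τ/10*v*c) - τ) * e2
  obtain ⟨D, hD⟩ : ∃ D, D = ρ^2*(τ^2-w^2*s^2)/100 := ⟨_, rfl⟩
  have hw2 : w^2 ≤ 1 := (sq_le_one_iff_abs_le_one w).2 aw
  have hD0 : |ρ*(ρ*(τ^2-w^2*s^2))| ≤ 1 := by
    refine ev_scale aρ (ev_scale aρ ?_)
    have h1 := mul_le_one₀ hw2 (sq_nonneg s) hs2
    have h2 : 0 ≤ w^2*s^2 := by positivity
    rw [abs_le]; constructor <;> linarith [sq_nonneg τ]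
  have hD' : D = ρ*(ρ*(τ^2-w^2*s^2))/100 := by rw [hD]; ring
  have hD1 : D ≤ 1/100 := by linarith [(abs_le.1 hD0).2]
  have hD2 : -(1/100) ≤ D := by linarith [(abs_le.1 hD0).1]
  rw [← hD] at I
  have hL : 0 < K - D := by linarith
  obtain ⟨k, hk⟩ : ∃ k, k = K/(K-D) := ⟨_, rfl⟩
  obtain ⟨hk1, hk2⟩ := ev_k K D k hK1 hD1 hD2 hk
  have hv : v = w*ρ*c*k/10 := by
    rw [hk]; field_simp; linear_combination 10 * I
  have hk22 : k^2 ≤ 105/100 := by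
    have : k^2 ≤ (102/100)^2 := pow_le_pow_left₀ (by linarith) hk2 2
    linarith
  obtain ⟨X, hX⟩ : ∃ X, X = w^2*c^2 := ⟨_, rfl⟩
  have hX0 : 0 ≤ X := by rw [hX]; positivity
  have hX1 : X ≤ 1 := by rw [hX]; exact mul_le_one₀ hw2 (sq_nonneg _) hc2
  obtain ⟨Y, hY⟩ : ∃ Y, Y = ρ*X := ⟨_, rfl⟩
  have hY0 : 0 ≤ Y := by rw [hY]; positivity
  have hY1 : Y ≤ 1 := by rw [hY]; exact mul_le_one₀ hρ1 hX0 hX1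
  have hv2 : v^2 ≤ 105/10000 * Y := by
    have e : v^2 = Y * (ρ * k^2) / 100 := by rw [hY, hX, hv]; ring
    have h1 : ρ * k^2 ≤ 1 * k^2 := mul_le_mul_of_nonneg_right hρ1 (sq_nonneg k)
    have h2 : Y * (ρ*k^2) ≤ Y * (105/100) := mul_le_mul_of_nonneg_left (by linarith) hY0
    linarith
  have hρ3 : 98/100 ≤ ρ := by linarith
  obtain ⟨g, hg⟩ : ∃ g, g = w*(v*c) := ⟨_, rfl⟩
  have hgv : g = Y*k/10 := by rw [hg, hY, hX, hv]; ring
  have hg1 : 98/1000 * Y ≤ g := by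
    have := mul_le_mul_of_nonneg_left hk1 hY0; linarith
  have hg2 : g ≤ 102/1000 * Y := by
    have := mul_le_mul_of_nonneg_left hk2 hY0; linarith
  have III : 20*K*g + w*τ*s*(4*v^2-3*v^4 - ρ*g/10) - ρ*τ^2/10*g
      + ρ^2*w^2*s^2 - 2*ρ*w^2*v^2*s^2 + ρ*w*s*τ/10*g + ρ*τ^2 - ρ*τ*w*s = 0 := by
    rw [hKd] at II ⊢
    rw [hρ] at II ⊢
    rw [hg]
    linear_combination 10 * II
  exact ev_quad τ w s X hw hs2 (by rw [hX]; linear_combination w^2*hcs)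
    (ev_fin K g Y w τ s v ρ X hρ0 hρ1 hρ3 hτ hw0 hw1 hs2 hK1 hY hY0 hg1 hg2 hv2 hv1 III)

theorem ev_cart (x y v a b c τ w : ℝ) (hu : x^2+y^2+v^2 = 1) (ht : a*x+b*y+c*v = 0)
    (hτ : τ^2 ≤ 1) (hw : w = 1 - τ^2) (W1 W2 W1' W2' : ℝ)
    (hW1 : W1 = τ/10*(x^2+y^2) + w/10*(2*x*y)) (hW2 : W2 = v + w/10*(x^2-y^2))
    (hW1' : W1' = τ/10*(2*(x*a+y*b)) + w/10*(2*(a*y+x*b)))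
    (hW2' : W2' = c + w/10*(2*(x*a-y*b)))
    (hR : w*(2*(a*y*v+x*b*v+x*y*c) - τ/20*(2*(x*a-y*b))) - τ*c = 0)
    (E1 : x*W1'+y*W2' = W1*a+W2*b) (E2 : x*W2'-y*W1' = W2*a-W1*b) : a = 0 ∧ b = 0 ∧ c = 0 := by
  by_cases h0 : x^2+y^2 = 0
  · have hx : x = 0 := by nlinarith [sq_nonneg x, sq_nonneg y]
    have hy : y = 0 := by nlinarith [sq_nonneg x, sq_nonneg y]
    subst hx hy
    have hv : v ≠ 0 := by rintro rfl; norm_num at hu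
    subst hW1 hW2
    have h1 : v*b = 0 := by linear_combination -E1
    have h2 : v*a = 0 := by linear_combination -E2
    have h3 : v*c = 0 := by linear_combination ht
    simp only [mul_eq_zero, hv, false_or] at h1 h2 h3
    exact ⟨h2, h1, h3⟩
  · obtain ⟨ρ, hρ⟩ : ∃ ρ, ρ = x^2+y^2 := ⟨_, rfl⟩
    rw [← hρ] at h0
    have hρ0 : 0 < ρ := lt_of_le_of_ne (by rw [hρ]; positivity) (Ne.symm h0)
    obtain ⟨α, hα⟩ : ∃ α, α = c/ρ := ⟨_, rfl⟩
    obtain ⟨β, hβ⟩ : ∃ β, β = (x*b-y*a)/ρ := ⟨_, rfl⟩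
    obtain ⟨Co, hC⟩ : ∃ Co, Co = (x^2-y^2)/ρ := ⟨_, rfl⟩
    obtain ⟨Si, hS⟩ : ∃ Si, Si = (2*x*y)/ρ := ⟨_, rfl⟩
    have hα' : c = ρ*α := by rw [hα]; field_simp
    have hβ' : ρ*β = x*b-y*a := by rw [hβ]; field_simp
    have hC' : ρ*Co = x^2-y^2 := by rw [hC]; field_simp
    have hS' : ρ*Si = 2*x*y := by rw [hS]; field_simp
    have ha : a = -v*α*x - β*y := by
      apply mul_left_cancel₀ h0
      linear_combination a*hρ + x*ht + y*hβ' - x*v*hα'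
    have hb : b = -v*α*y + β*x := by
      apply mul_left_cancel₀ h0
      linear_combination b*hρ + y*ht - x*hβ' - y*v*hα'
    have hCS : Co^2+Si^2 = 1 := by
      apply mul_left_cancel₀ (pow_ne_zero 2 h0)
      have : ρ^2*(Co^2+Si^2) = (ρ*Co)^2+(ρ*Si)^2 := by ring
      rw [this, hC', hS', hρ]; ring
    have core := ev_core v ρ Co Si τ w α β (by linarith) hρ0 hCS hτ hw
    have e1 : β*(w/10*ρ*Co - v) = v*ρ*α*(τ/10 + w/10*Si) := by
      have : β*(w/10*(ρ*Co) - v) = v*α*(τ/10*ρ + w/10*(ρ*Si)) := by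
        rw [hC', hS']
        apply mul_left_cancel₀ h0
        subst hW1 hW2 hW1' hW2' ha hb hα' hρ
        linear_combination x*E1 - y*E2
      linear_combination this
    have e2 : α*(1 - w/10*ρ*Co*v) + ρ*β*(τ/10 - w/10*Si) = 0 := by
      have : α*(1 - w/10*(ρ*Co)*v) + β*(τ/10*ρ - w/10*(ρ*Si)) = 0 := by
        rw [hC', hS']
        apply mul_left_cancel₀ h0
        subst hW1 hW2 hW1' hW2' ha hb hα' hρ
        linear_combination x*E2 + y*E1 - (x^2+y^2)*α*hu
      linear_combination this
    have e3 : α*(w*(ρ*Si-2*v^2*Si+τ/10*v*Co) - τ) + β*w*(2*v*Co+τ/10*Si) = 0 := by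
      have : α*(w*(ρ*(ρ*Si)-2*v^2*(ρ*Si)+τ/10*v*(ρ*Co)) - τ*ρ) + β*w*(2*v*(ρ*Co)+τ/10*(ρ*Si)) = 0 := by
        rw [hC', hS']
        subst ha hb hα' hρ
        linear_combination hR
      apply mul_left_cancel₀ h0
      linear_combination this
    obtain ⟨h1, h2⟩ := core e1 e2 e3
    subst h1 h2
    refine ⟨by rw [ha]; ring, by rw [hb]; ring, by rw [hα']; ring⟩

theorem ev_rot (x y v a b c τ s Q : ℝ) (hu : x^2+y^2+v^2 = 1) (ht : a*x+b*y+c*v = 0)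
    (hτ : τ^2 = 1) (hs0 : 0 ≤ s) (hs1 : s ≤ 1) (hQ : 0 < Q) (W1 W2 W1' W2' : ℝ)
    (hW1 : W1 = (1-s)*(τ/10*(x^2+y^2) + (1-τ^2)/10*(2*x*y)) + s*τ*(Q-τ*v+2))
    (hW2 : W2 = (1-s)*(v + (1-τ^2)/10*(x^2-y^2)))
    (hW1' : W1' = (1-s)*(τ/10*(2*(x*a+y*b)) + (1-τ^2)/10*(2*(a*y+x*b)))
      + s*τ*((-2*τ*c/Q) - τ*c))
    (hW2' : W2' = (1-s)*(c + (1-τ^2)/10*(2*(x*a-y*b))))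
    (hR : (1-s)*((1-τ^2)*(2*(a*y*v+x*b*v+x*y*c) - τ/20*(2*(x*a-y*b))) - τ*c) + s*(-2*τ*c/Q) = 0)
    (E1 : x*W1'+y*W2' = W1*a+W2*b) (E2 : x*W2'-y*W1' = W2*a-W1*b) : a = 0 ∧ b = 0 ∧ c = 0 := by
  rw [hτ] at hW1 hW2 hW1' hW2' hR
  have hτ0 : τ ≠ 0 := by rintro rfl; norm_num at hτ
  have hc : c = 0 := by
    have h1 : (τ*((1-s) + s*(2/Q)))*c = 0 := by linear_combination -hR
    have h2 : 0 < (1-s) + s*(2/Q) := by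
      rcases eq_or_lt_of_le hs1 with h | h
      · rw [h]; simp; positivity
      · have : 0 ≤ s*(2/Q) := by positivity
        linarith
    exact (mul_eq_zero.1 h1).resolve_left (mul_ne_zero hτ0 h2.ne')
  subst hc
  have hW1z : W1' = 0 := by rw [hW1']; linear_combination (1-s)*τ/5*ht
  have hW2z : W2' = 0 := by rw [hW2']; ring
  rw [hW1z, hW2z] at E1 E2
  have hW : 0 < W1^2+W2^2 := by
    have e1 : τ*W1 = (1-s)*(1/10*(x^2+y^2)) + s*(Q-τ*v+2) := by
      rw [hW1]; linear_combination ((1-s)/10*(x^2+y^2)+s*(Q-τ*v+2))*hτ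
    have hτv : τ*v ≤ 1 := by nlinarith [sq_nonneg (τ-v), sq_nonneg x, sq_nonneg y]
    have hpos : 0 < Q-τ*v+2 := by linarith
    have hne : W1 ≠ 0 ∨ W2 ≠ 0 := by
      by_contra hcon
      push Not at hcon
      rw [hcon.1] at e1
      rw [hcon.2] at hW2
      have hs : s = 0 := by
        have h1 : 0 ≤ (1-s)*(1/10*(x^2+y^2)) := mul_nonneg (by linarith) (by positivity)
        have h2 : 0 ≤ s*(Q-τ*v+2) := mul_nonneg hs0 hpos.le
        have h3 : s*(Q-τ*v+2) = 0 := by linarith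
        exact (mul_eq_zero.1 h3).resolve_right hpos.ne'
      subst hs
      have hv : v = 0 := by linarith
      subst hv
      linarith
    rcases hne with h | h
    · have := sq_nonneg W2; have := pow_pos (abs_pos.2 h) 2; rw [sq_abs] at this; linarith
    · have := sq_nonneg W1; have := pow_pos (abs_pos.2 h) 2; rw [sq_abs] at this; linarith
  refine ⟨?_, ?_, rfl⟩
  · apply (mul_eq_zero.1 (?_ : (W1^2+W2^2)*a = 0)).resolve_left hW.ne'
    linear_combination -W1*E1 - W2*E2
  · apply (mul_eq_zero.1 (?_ : (W1^2+W2^2)*b = 0)).resolve_left hW.ne'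
    linear_combination -W2*E1 + W1*E2

noncomputable def evQ (τ v : ℝ) : ℝ := √(5-4*τ*v)
noncomputable def evW1 (τ s x y v : ℝ) : ℝ :=
  (1-s)*(τ/10*(x^2+y^2) + (1-τ^2)/10*(2*x*y)) + s*τ*(evQ τ v-τ*v+2)
noncomputable def evW2 (τ s x y v : ℝ) : ℝ := (1-s)*(v + (1-τ^2)/10*(x^2-y^2))
noncomputable def evR (τ s x y v : ℝ) : ℝ :=
  (1-s)*(3 + (1-τ^2)*(2*x*y*v - τ/20*(x^2-y^2)) - τ*v) + s*evQ τ v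
noncomputable def evS (τ s x y v : ℝ) : ℝ := x^2+y^2+evW1 τ s x y v^2+evW2 τ s x y v^2
noncomputable def evX (τ s x y v : ℝ) : ℝ :=
  evR τ s x y v * (2*(x*evW1 τ s x y v-y*evW2 τ s x y v)) / evS τ s x y v
noncomputable def evY (τ s x y v : ℝ) : ℝ :=
  evR τ s x y v * (2*(x*evW2 τ s x y v+y*evW1 τ s x y v)) / evS τ s x y v
noncomputable def evZ (τ s x y v : ℝ) : ℝ :=
  evR τ s x y v * (x^2+y^2-evW1 τ s x y v^2-evW2 τ s x y v^2) / evS τ s x y v + 2*s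

/-- The set of admissible parameters. -/
def EvGood (τ s : ℝ) : Prop := (s = 0 ∧ τ^2 ≤ 1) ∨ (τ^2 = 1 ∧ 0 ≤ s ∧ s ≤ 1)

theorem ev_arg_pos (τ v : ℝ) (hτ : τ^2 ≤ 1) (hv : v^2 ≤ 1) : 0 < 5-4*τ*v := by
  nlinarith [sq_nonneg (τ-v)]

theorem EvGood.sq {τ s : ℝ} (h : EvGood τ s) : τ^2 ≤ 1 ∧ 0 ≤ s ∧ s ≤ 1 := by
  rcases h with ⟨rfl, h⟩ | ⟨h, h1, h2⟩
  · exact ⟨h, le_rfl, zero_le_one⟩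
  · exact ⟨h.le, h1, h2⟩

theorem evR_pos (τ s x y v : ℝ) (h : EvGood τ s) (hu : x^2+y^2+v^2 = 1) : 0 < evR τ s x y v := by
  obtain ⟨hτ, hs0, hs1⟩ := h.sq
  have hv : v^2 ≤ 1 := by linarith [sq_nonneg x, sq_nonneg y]
  have hQ : 0 < evQ τ v := Real.sqrt_pos.2 (ev_arg_pos τ v hτ hv)
  have aτ := ev_sq hτ
  have av := ev_sq hv
  have h1 := abs_le.1 (ev_scale aτ av)
  have aw : |1-τ^2| ≤ 1 := by rw [abs_le]; constructor <;> linarith [sq_nonneg τ]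
  have axy : |2*x*y| ≤ 1 := by
    rw [abs_le]; constructor <;> linarith [sq_nonneg (x+y), sq_nonneg (x-y), sq_nonneg v, add_sq x y, sub_sq x y]
  have axy2 : |x^2-y^2| ≤ 1 := by
    rw [abs_le]; constructor <;> linarith [sq_nonneg x, sq_nonneg y, sq_nonneg v]
  have h2 := abs_le.1 (ev_scale axy av)
  have h3 := abs_le.1 (ev_scale aτ axy2)
  have h4 : |(1-τ^2)*(2*x*y*v - τ/20*(x^2-y^2))| ≤ 3/2 := by
    apply ev_scale aw
    have : τ/20*(x^2-y^2) = τ*(x^2-y^2)/20 := by ring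
    rw [this, abs_le]; constructor <;> linarith [h2.1, h2.2, h3.1, h3.2]
  have h5 := abs_le.1 h4
  unfold evR
  have p1 : 0 < 3 + (1-τ^2)*(2*x*y*v - τ/20*(x^2-y^2)) - τ*v := by linarith [h5.1, h1.2]
  rcases eq_or_lt_of_le hs1 with h | h
  · rw [h]; simpa using hQ
  · have q1 : 0 < (1-s)*(3 + (1-τ^2)*(2*x*y*v - τ/20*(x^2-y^2)) - τ*v) := mul_pos (by linarith) p1
    have q2 : 0 ≤ s*evQ τ v := by positivity
    linarith

theorem evS_pos (τ s x y v : ℝ) (h : EvGood τ s) (hu : x^2+y^2+v^2 = 1) : 0 < evS τ s x y v := by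
  obtain ⟨hτ, hs0, hs1⟩ := h.sq
  have hv : v^2 ≤ 1 := by linarith [sq_nonneg x, sq_nonneg y]
  have hQ : 0 < evQ τ v := Real.sqrt_pos.2 (ev_arg_pos τ v hτ hv)
  by_contra hcon
  unfold evS at hcon
  have a1 := sq_nonneg x
  have a2 := sq_nonneg y
  have a3 := sq_nonneg (evW1 τ s x y v)
  have a4 := sq_nonneg (evW2 τ s x y v)
  have hx : x = 0 := pow_eq_zero_iff two_ne_zero |>.1 (by linarith)
  have hy : y = 0 := pow_eq_zero_iff two_ne_zero |>.1 (by linarith)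
  have h1 : evW1 τ s x y v = 0 := pow_eq_zero_iff two_ne_zero |>.1 (by linarith)
  have h2 : evW2 τ s x y v = 0 := pow_eq_zero_iff two_ne_zero |>.1 (by linarith)
  subst hx hy
  have hv0 : v ≠ 0 := by rintro rfl; norm_num at hu
  have h2' : (1-s)*v = 0 := by rw [← h2]; unfold evW2; ring
  have hs : s = 1 := by
    have := (mul_eq_zero.1 h2').resolve_right hv0
    linarith
  subst hs
  have h1' : τ*(evQ τ v-τ*v+2) = 0 := by rw [← h1]; unfold evW1; ring
  have hτ0 : τ ≠ 0 := by
    rintro rfl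
    rcases h with h | h
    · exact one_ne_zero h.1
    · norm_num at h
  have := (mul_eq_zero.1 h1').resolve_left hτ0
  have hh := abs_le.1 (ev_scale (ev_sq hτ) (ev_sq hv))
  linarith [hh.2]

theorem ev_comp_deriv {R N S : ℝ → ℝ} {R' N' S' : ℝ} (hR : HasDerivAt R R' 0)
    (hN : HasDerivAt N N' 0) (hS : HasDerivAt S S' 0) (hS0 : S 0 ≠ 0) {d : ℝ}
    (h : HasDerivAt (fun r => R r * N r / S r + d) 0 0) :
    (R' * N 0 + R 0 * N') * S 0 - R 0 * N 0 * S' = 0 := by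
  have h1 := ((hR.mul hN).div hS hS0).add_const d
  have h2 := h1.unique h
  rcases div_eq_zero_iff.1 h2 with h3 | h3
  · exact h3
  · exact absurd h3 (pow_ne_zero 2 hS0)

theorem ev_inj (τ s x y v a b c : ℝ) (hg : EvGood τ s) (hu : x^2+y^2+v^2 = 1)
    (ht : a*x+b*y+c*v = 0)
    (hX : HasDerivAt (fun r => evX τ s (x+r*a) (y+r*b) (v+r*c)) 0 0)
    (hY : HasDerivAt (fun r => evY τ s (x+r*a) (y+r*b) (v+r*c)) 0 0)
    (hZ : HasDerivAt (fun r => evZ τ s (x+r*a) (y+r*b) (v+r*c)) 0 0) :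
    a = 0 ∧ b = 0 ∧ c = 0 := by
  obtain ⟨hτ, hs0, hs1⟩ := hg.sq
  have hv : v^2 ≤ 1 := by linarith [sq_nonneg x, sq_nonneg y]
  have hQ : 0 < evQ τ v := Real.sqrt_pos.2 (ev_arg_pos τ v hτ hv)
  have dx : HasDerivAt (fun r : ℝ => x+r*a) a 0 := by
    simpa using ((hasDerivAt_id (0:ℝ)).mul_const a).const_add x
  have dy : HasDerivAt (fun r : ℝ => y+r*b) b 0 := by
    simpa using ((hasDerivAt_id (0:ℝ)).mul_const b).const_add y
  have dv : HasDerivAt (fun r : ℝ => v+r*c) c 0 := by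
    simpa using ((hasDerivAt_id (0:ℝ)).mul_const c).const_add v
  have dQ : HasDerivAt (fun r : ℝ => evQ τ (v+r*c)) (-2*τ*c/evQ τ v) 0 := by
    have h1 : HasDerivAt (fun r : ℝ => 5-4*τ*(v+r*c)) (-(4*τ*c)) 0 := (dv.const_mul (4*τ)).const_sub 5
    have h2 := h1.sqrt (by simpa using (ev_arg_pos τ v hτ hv).ne')
    refine h2.congr_deriv ?_
    simp only [evQ, zero_mul, add_zero]
    rw [div_eq_div_iff (by unfold evQ at hQ; positivity) (by unfold evQ at hQ; positivity)]
    ring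
  have dW1 : HasDerivAt (fun r : ℝ => evW1 τ s (x+r*a) (y+r*b) (v+r*c))
     ((1-s)*(τ/10*(2*(x*a+y*b)) + (1-τ^2)/10*(2*(a*y+x*b)))
      + s*τ*((-2*τ*c/evQ τ v) - τ*c)) 0 := by
    unfold evW1
    refine ((((((dx.pow 2).add (dy.pow 2)).const_mul (τ/10)).add
      (((dx.const_mul 2).mul dy).const_mul ((1-τ^2)/10))).const_mul (1-s)).add
      (((dQ.sub (dv.const_mul τ)).add_const 2).const_mul (s*τ))).congr_deriv ?_
    simp only [zero_mul, add_zero, Nat.cast_ofNat, Nat.reduceSub, pow_one, Pi.mul_apply, Pi.pow_apply]; ring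
  have dW2 : HasDerivAt (fun r : ℝ => evW2 τ s (x+r*a) (y+r*b) (v+r*c))
     ((1-s)*(c + (1-τ^2)/10*(2*(x*a-y*b)))) 0 := by
    unfold evW2
    refine ((dv.add (((dx.pow 2).sub (dy.pow 2)).const_mul ((1-τ^2)/10))).const_mul (1-s)).congr_deriv ?_
    simp only [zero_mul, add_zero, Nat.cast_ofNat, Nat.reduceSub, pow_one, Pi.mul_apply, Pi.pow_apply]; ring
  have dR : HasDerivAt (fun r : ℝ => evR τ s (x+r*a) (y+r*b) (v+r*c))
     ((1-s)*((1-τ^2)*(2*(a*y*v+x*b*v+x*y*c) - τ/20*(2*(x*a-y*b))) - τ*c)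
        + s*(-2*τ*c/evQ τ v)) 0 := by
    unfold evR
    refine (((((((((dx.const_mul 2).mul dy).mul dv).sub (((dx.pow 2).sub (dy.pow 2)).const_mul
      (τ/20))).const_mul (1-τ^2)).const_add 3).sub (dv.const_mul τ)).const_mul (1-s)).add
      (dQ.const_mul s)).congr_deriv ?_
    simp only [zero_mul, add_zero, Nat.cast_ofNat, Nat.reduceSub, pow_one, Pi.mul_apply, Pi.pow_apply]; ring
  have hR0 := evR_pos τ s x y v hg hu
  have hS0 := evS_pos τ s x y v hg hu
  generalize hW1' : ((1-s)*(τ/10*(2*(x*a+y*b)) + (1-τ^2)/10*(2*(a*y+x*b)))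
      + s*τ*((-2*τ*c/evQ τ v) - τ*c)) = W1' at dW1
  generalize hW2' : ((1-s)*(c + (1-τ^2)/10*(2*(x*a-y*b)))) = W2' at dW2
  generalize hR' : ((1-s)*((1-τ^2)*(2*(a*y*v+x*b*v+x*y*c) - τ/20*(2*(x*a-y*b))) - τ*c)
        + s*(-2*τ*c/evQ τ v)) = R' at dR
  have dS : HasDerivAt (fun r : ℝ => evS τ s (x+r*a) (y+r*b) (v+r*c))
     (2*(x*a+y*b+evW1 τ s x y v*W1'+evW2 τ s x y v*W2')) 0 := by
    unfold evS
    refine ((((dx.pow 2).add (dy.pow 2)).add (dW1.pow 2)).add (dW2.pow 2)).congr_deriv ?_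
    simp only [zero_mul, add_zero, Nat.cast_ofNat, Nat.reduceSub, pow_one, Pi.mul_apply, Pi.pow_apply]; ring
  have hS00 : evS τ s (x+0*a) (y+0*b) (v+0*c) ≠ 0 := by simpa using hS0.ne'
  have k1 := ev_comp_deriv (d := 0) dR (((dx.mul dW1).sub (dy.mul dW2)).const_mul 2) dS hS00
    (by simpa [evX] using hX)
  have k2 := ev_comp_deriv (d := 0) dR (((dx.mul dW2).add (dy.mul dW1)).const_mul 2) dS hS00
    (by simpa [evY] using hY)
  have k3 := ev_comp_deriv dR ((((dx.pow 2).add (dy.pow 2)).sub (dW1.pow 2)).sub (dW2.pow 2)) dS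
    hS00 hZ
  simp only [zero_mul, add_zero, Pi.mul_apply, Pi.add_apply, Pi.sub_apply, Pi.pow_apply, evS] at k1 k2 k3
  obtain ⟨r0, E1, E2⟩ := ev_sigma x y (evW1 τ s x y v) (evW2 τ s x y v) (evR τ s x y v) a b W1' W2' R'
    hR0 hS0 (by linear_combination k1) (by linear_combination k2)
    (by norm_num at k3; linear_combination k3)
  rw [r0] at hR'
  rcases hg with ⟨rfl, hg⟩ | ⟨hg, -, -⟩
  · refine ev_cart x y v a b c τ (1-τ^2) hu ht hτ rfl _ _ _ _ ?_ ?_ ?_ ?_ ?_ E1 E2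
    · unfold evW1; ring
    · unfold evW2; ring
    · rw [← hW1']; ring
    · rw [← hW2']; ring
    · rw [← hR']; ring
  · exact ev_rot x y v a b c τ s _ hu ht hg hs0 hs1 hQ _ _ _ _ rfl rfl hW1'.symm hW2'.symm hR' E1 E2

theorem ev_end (τ x y v : ℝ) (hτ : τ^2 = 1) (hu : x^2+y^2+v^2 = 1) :
    evX τ 1 x y v = τ*x ∧ evY τ 1 x y v = τ*y ∧ evZ τ 1 x y v = τ*v := by
  have hv : v^2 ≤ 1 := by linarith [sq_nonneg x, sq_nonneg y]
  have hp := ev_arg_pos τ v hτ.le hv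
  have hQ : 0 < evQ τ v := Real.sqrt_pos.2 hp
  have hQ2 : evQ τ v^2 = 5-4*τ*v := Real.sq_sqrt hp.le
  have hS := evS_pos τ 1 x y v (Or.inr ⟨hτ, zero_le_one, le_rfl⟩) hu
  have h1 : evW1 τ 1 x y v = τ*(evQ τ v-τ*v+2) := by unfold evW1; ring
  have h2 : evW2 τ 1 x y v = 0 := by unfold evW2; ring
  have h3 : evR τ 1 x y v = evQ τ v := by unfold evR; ring
  have hS' : evS τ 1 x y v = 2*evQ τ v*(evQ τ v-τ*v+2) := by
    unfold evS; rw [h1, h2]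
    linear_combination hu - hQ2 + ((evQ τ v-τ*v+2)^2 + v^2)*hτ
  unfold evX evY evZ
  rw [h1, h2, h3]
  refine ⟨?_, ?_, ?_⟩
  · rw [div_eq_iff hS.ne', hS']; ring
  · rw [div_eq_iff hS.ne', hS']; ring
  · rw [← eq_sub_iff_add_eq, div_eq_iff hS.ne', hS']
    linear_combination evQ τ v * (hu - hQ2 - ((evQ τ v-τ*v+2)^2 - v^2)*hτ)

noncomputable def evF (τ s : ℝ) (q : EuclideanSpace ℝ (Fin 3)) : EuclideanSpace ℝ (Fin 3) :=
  !₂[evX τ s (q 0) (q 1) (q 2), evY τ s (q 0) (q 1) (q 2), evZ τ s (q 0) (q 1) (q 2)]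

noncomputable def evTau (t : ℝ) : ℝ := 1 - 2*Real.smoothTransition (3*t-1)
noncomputable def evSig (t : ℝ) : ℝ :=
  1 - Real.smoothTransition (3*t) + Real.smoothTransition (3*t-2)

theorem ev_good (t : ℝ) : EvGood (evTau t) (evSig t) := by
  unfold evTau evSig
  have a0 := Real.smoothTransition.nonneg (3*t)
  have a1 := Real.smoothTransition.le_one (3*t)
  have b0 := Real.smoothTransition.nonneg (3*t-1)
  have b1 := Real.smoothTransition.le_one (3*t-1)
  have c0 := Real.smoothTransition.nonneg (3*t-2)
  have c1 := Real.smoothTransition.le_one (3*t-2)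
  rcases le_total (3*t) 1 with h | h
  · right
    rw [Real.smoothTransition.zero_of_nonpos (x := 3*t-1) (by linarith),
      Real.smoothTransition.zero_of_nonpos (x := 3*t-2) (by linarith)]
    refine ⟨by norm_num, by linarith, by linarith⟩
  · rcases le_total (3*t) 2 with h' | h'
    · left
      rw [Real.smoothTransition.one_of_one_le (x := 3*t) (by linarith),
        Real.smoothTransition.zero_of_nonpos (x := 3*t-2) (by linarith)]
      refine ⟨by norm_num, ?_⟩
      nlinarith
    · right
      rw [Real.smoothTransition.one_of_one_le (x := 3*t) (by linarith),
        Real.smoothTransition.one_of_one_le (x := 3*t-1) (by linarith)]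
      refine ⟨by norm_num, by linarith, by linarith⟩

theorem ev_unit (q : S2) : (q.1 0)^2 + (q.1 1)^2 + (q.1 2)^2 = 1 := by
  have h := q.2
  rw [mem_sphere_zero_iff_norm, EuclideanSpace.norm_eq, Real.sqrt_eq_one] at h
  simpa [Fin.sum_univ_three] using h

theorem ev_smooth (t : ℝ) (q : S2) : ContDiffAt ℝ (⊤ : ℕ∞)
    (fun p : ℝ × E3 => evF (evTau p.1) (evSig p.1) p.2) (t, q.1) := by
  have hu := ev_unit q
  have hg := ev_good t
  obtain ⟨hτ, -, -⟩ := hg.sq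
  have hv : (q.1 2)^2 ≤ 1 := by linarith [sq_nonneg (q.1 0), sq_nonneg (q.1 1)]
  have hS := (evS_pos _ _ _ _ _ hg hu).ne'
  have hp := (ev_arg_pos _ _ hτ hv).ne'
  have st : ∀ f : ℝ × E3 → ℝ, ContDiffAt ℝ (⊤ : ℕ∞) f (t, q.1) →
      ContDiffAt ℝ (⊤ : ℕ∞) (fun p => Real.smoothTransition (f p)) (t, q.1) := fun f hf =>
    (Real.smoothTransition.contDiff (n := ⊤)).contDiffAt.comp _ hf
  have dT : ContDiffAt ℝ (⊤ : ℕ∞) (fun p : ℝ × E3 => evTau p.1) (t, q.1) := by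
    have := st (fun p => 3*p.1-1) (by fun_prop)
    unfold evTau; fun_prop
  have dG : ContDiffAt ℝ (⊤ : ℕ∞) (fun p : ℝ × E3 => evSig p.1) (t, q.1) := by
    have h1 := st (fun p => 3*p.1) (by fun_prop)
    have h2 := st (fun p => 3*p.1-2) (by fun_prop)
    unfold evSig; fun_prop
  have dx : ∀ i, ContDiffAt ℝ (⊤ : ℕ∞) (fun p : ℝ × E3 => p.2 i) (t, q.1) := fun i => by
    fun_prop
  have d0 := dx 0
  have d1 := dx 1
  have d2 := dx 2
  have dQ : ContDiffAt ℝ (⊤ : ℕ∞) (fun p : ℝ × E3 => evQ (evTau p.1) (p.2 2)) (t, q.1) := by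
    unfold evQ
    exact ContDiffAt.sqrt (by fun_prop) hp
  have dW1 : ContDiffAt ℝ (⊤ : ℕ∞) (fun p : ℝ × E3 =>
      evW1 (evTau p.1) (evSig p.1) (p.2 0) (p.2 1) (p.2 2)) (t, q.1) := by
    unfold evW1; simp only [div_eq_mul_inv]; fun_prop
  have dW2 : ContDiffAt ℝ (⊤ : ℕ∞) (fun p : ℝ × E3 =>
      evW2 (evTau p.1) (evSig p.1) (p.2 0) (p.2 1) (p.2 2)) (t, q.1) := by
    unfold evW2; simp only [div_eq_mul_inv]; fun_prop
  have dR : ContDiffAt ℝ (⊤ : ℕ∞) (fun p : ℝ × E3 =>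
      evR (evTau p.1) (evSig p.1) (p.2 0) (p.2 1) (p.2 2)) (t, q.1) := by
    unfold evR; simp only [div_eq_mul_inv]; fun_prop
  have dS : ContDiffAt ℝ (⊤ : ℕ∞) (fun p : ℝ × E3 =>
      evS (evTau p.1) (evSig p.1) (p.2 0) (p.2 1) (p.2 2)) (t, q.1) := by
    unfold evS; fun_prop
  rw [contDiffAt_euclidean]
  intro i
  fin_cases i
  · change ContDiffAt ℝ (⊤ : ℕ∞) (fun p : ℝ × E3 =>
      evX (evTau p.1) (evSig p.1) (p.2 0) (p.2 1) (p.2 2)) (t, q.1)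
    unfold evX
    exact ContDiffAt.div (by fun_prop) dS hS
  · change ContDiffAt ℝ (⊤ : ℕ∞) (fun p : ℝ × E3 =>
      evY (evTau p.1) (evSig p.1) (p.2 0) (p.2 1) (p.2 2)) (t, q.1)
    unfold evY
    exact ContDiffAt.div (by fun_prop) dS hS
  · change ContDiffAt ℝ (⊤ : ℕ∞) (fun p : ℝ × E3 =>
      evZ (evTau p.1) (evSig p.1) (p.2 0) (p.2 1) (p.2 2)) (t, q.1)
    unfold evZ
    exact (ContDiffAt.div (by fun_prop) dS hS).add (by fun_prop)

theorem ev_smooth_t (t : ℝ) (q : S2) : ContDiffAt ℝ (⊤ : ℕ∞) (evF (evTau t) (evSig t)) q.1 :=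
  (ev_smooth t q).comp (f := fun q' : E3 => ((t, q') : ℝ × E3)) q.1
    (contDiffAt_const.prodMk contDiffAt_id)

theorem ev_fderiv_inj (t : ℝ) (q : S2) (w : E3) (hw : inner ℝ q.1 w = 0)
    (h : fderiv ℝ (evF (evTau t) (evSig t)) q.1 w = 0) : w = 0 := by
  have hd : DifferentiableAt ℝ (evF (evTau t) (evSig t)) q.1 :=
    (ev_smooth_t t q).differentiableAt (by simp)
  have hl : HasDerivAt (fun r : ℝ => q.1 + r • w) w 0 := by
    simpa using ((hasDerivAt_id (0:ℝ)).smul_const w).const_add q.1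
  have hf : HasFDerivAt (evF (evTau t) (evSig t)) (fderiv ℝ (evF (evTau t) (evSig t)) q.1)
      (q.1 + (0:ℝ) • w) := by simpa using hd.hasFDerivAt
  have hc := hf.comp_hasDerivAt (0:ℝ) hl
  rw [h] at hc
  have hi : ∀ i, HasDerivAt (fun r : ℝ => evF (evTau t) (evSig t) (q.1 + r • w) i) 0 0 := by
    intro i
    have := (EuclideanSpace.proj i : E3 →L[ℝ] ℝ).hasFDerivAt.comp_hasDerivAt (0:ℝ) hc
    rw [map_zero] at this
    exact this
  have ht : w 0 * q.1 0 + w 1 * q.1 1 + w 2 * q.1 2 = 0 := by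
    rw [← hw]; simp [PiLp.inner_apply, Fin.sum_univ_three]
  obtain ⟨h0, h1, h2⟩ := ev_inj (evTau t) (evSig t) (q.1 0) (q.1 1) (q.1 2) (w 0) (w 1) (w 2)
    (ev_good t) (ev_unit q) ht (hi 0) (hi 1) (hi 2)
  ext i
  fin_cases i
  · exact h0
  · exact h1
  · exact h2

theorem ev_end_pt (τ : ℝ) (hτ : τ^2 = 1) (q : S2) : evF τ 1 q.1 = τ • q.1 := by
  obtain ⟨h0, h1, h2⟩ := ev_end τ _ _ _ hτ (ev_unit q)
  ext i
  fin_cases i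
  · exact h0
  · exact h1
  · exact h2

theorem ev_coe_smooth (m : WithTop ℕ∞) :
    ContMDiff (𝓡 2) 𝓘(ℝ, E3) m (fun x : S2 => (x : E3)) := by
  haveI : Fact (Module.finrank ℝ E3 = 2 + 1) := ⟨by simp⟩
  exact contMDiff_coe_sphere (n := 2)

theorem ev_coe_inj (x : S2) :
    Function.Injective (mfderiv (𝓡 2) 𝓘(ℝ, E3) (fun x : S2 => (x : E3)) x) := by
  haveI : Fact (Module.finrank ℝ E3 = 2 + 1) := ⟨by simp⟩
  exact mfderiv_coe_sphere_injective (n := 2) x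

theorem ev_coe_mem (x : S2) (w : TangentSpace (𝓡 2) x) :
    (mfderiv (𝓡 2) 𝓘(ℝ, E3) (fun x : S2 => (x : E3)) x w : E3) ∈
      (Submodule.span ℝ {(x : E3)})ᗮ := by
  haveI : Fact (Module.finrank ℝ E3 = 2 + 1) := ⟨by simp⟩
  have h := range_mfderiv_coe_sphere (n := 2) x
  have h' : (mfderiv (𝓡 2) 𝓘(ℝ, E3) (fun x : S2 => (x : E3)) x w : E3) ∈
      LinearMap.range (mfderiv (𝓡 2) 𝓘(ℝ, E3) (fun x : S2 => (x : E3)) x).toLinearMap := ⟨w, rfl⟩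
  exact h.le h'

/-- The sphere can be everted: the standard inclusion `ι : S² → ℝ³` is regularly
homotopic to its negation `−ι` (the sphere inside-out). -/
theorem sphere_eversion_exists :
    RegularHomotopic (fun x : S2 => (x : E3)) (fun x : S2 => -(x : E3)) := by
  refine ⟨fun p => evF (evTau p.1) (evSig p.1) p.2.1, ?_, ?_, ?_, ?_⟩
  · intro p
    have h1 : ContMDiff ((𝓡∂ 1).prod (𝓡 2)) 𝓘(ℝ, ℝ) (⊤ : ℕ∞)
        (fun p : Set.Icc (0:ℝ) 1 × S2 => (p.1 : ℝ)) :=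
      contMDiff_subtypeVal_Icc.comp contMDiff_fst
    have h2 : ContMDiff ((𝓡∂ 1).prod (𝓡 2)) 𝓘(ℝ, E3) (⊤ : ℕ∞)
        (fun p : Set.Icc (0:ℝ) 1 × S2 => (p.2 : E3)) :=
      (ev_coe_smooth _).comp contMDiff_snd
    exact ContMDiffAt.comp (I' := 𝓘(ℝ, ℝ × E3))
      (g := fun p : ℝ × E3 => evF (evTau p.1) (evSig p.1) p.2)
      (f := fun p : Set.Icc (0:ℝ) 1 × S2 => (((p.1 : ℝ), (p.2 : E3)) : ℝ × E3)) p
      (ev_smooth p.1 p.2).contMDiffAt ((h1 p).prodMk_space (h2 p))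
  · intro x
    have a : evTau 0 = 1 := by
      unfold evTau; rw [Real.smoothTransition.zero_of_nonpos (by norm_num)]; norm_num
    have b : evSig 0 = 1 := by
      unfold evSig
      rw [Real.smoothTransition.zero_of_nonpos (by norm_num),
        Real.smoothTransition.zero_of_nonpos (by norm_num)]; norm_num
    simp only [a, b]
    rw [ev_end_pt 1 (by norm_num), one_smul]
  · intro x
    have a : evTau 1 = -1 := by
      unfold evTau; rw [Real.smoothTransition.one_of_one_le (by norm_num)]; norm_num
    have b : evSig 1 = 1 := by
      unfold evSig
      rw [Real.smoothTransition.one_of_one_le (by norm_num),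
        Real.smoothTransition.one_of_one_le (by norm_num)]; norm_num
    simp only [a, b]
    rw [ev_end_pt (-1) (by norm_num), neg_smul, one_smul]
  · intro t
    have hs : ∀ x : S2, ContMDiffAt (𝓡 2) 𝓘(ℝ, E3) (⊤ : ℕ∞)
        (fun x : S2 => evF (evTau t) (evSig t) x.1) x := fun x =>
      ContMDiffAt.comp (I' := 𝓘(ℝ, E3)) (g := evF (evTau t) (evSig t))
        (f := fun x : S2 => (x : E3)) x (ev_smooth_t t x).contMDiffAt (ev_coe_smooth _ x)
    refine ⟨hs, fun x => ?_⟩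
    have hd : DifferentiableAt ℝ (evF (evTau t) (evSig t)) x.1 :=
      (ev_smooth_t t x).differentiableAt (by simp)
    have hcoe : MDifferentiableAt (𝓡 2) 𝓘(ℝ, E3) (fun x : S2 => (x : E3)) x :=
      (ev_coe_smooth 1 x).mdifferentiableAt one_ne_zero
    have hcomp : mfderiv (𝓡 2) 𝓘(ℝ, E3) (fun x : S2 => evF (evTau t) (evSig t) x.1) x =
        (fderiv ℝ (evF (evTau t) (evSig t)) x.1).comp
          (mfderiv (𝓡 2) 𝓘(ℝ, E3) (fun x : S2 => (x : E3)) x) := by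
      rw [← mfderiv_eq_fderiv]
      exact mfderiv_comp x hd.mdifferentiableAt hcoe
    have hinj := ev_coe_inj x
    rw [hcomp]
    refine (injective_iff_map_eq_zero _).2 fun w hw => ?_
    have hmem : (mfderiv (𝓡 2) 𝓘(ℝ, E3) (fun x : S2 => (x : E3)) x) w ∈ (Submodule.span ℝ {(x : E3)})ᗮ := ev_coe_mem x w
    have hz := ev_fderiv_inj t x _ (Submodule.mem_orthogonal_singleton_iff_inner_right.1 hmem) hw
    exact (injective_iff_map_eq_zero _).1 hinj w hz
end
end

section
/- Eversion via a Boy's-surface halfway model: let f : S² → ℝ³ be a smooth immersion satisfying f(−x) = f(x) for all x ∈ S² (so f double covers an immersed projective plane). If f is regularly homotopic to the standard inclusion ι : S² → ℝ³, then ι is regularly homotopic to −ι; that is, a sphere eversion exists. -/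
open Metric Manifold

noncomputable section

theorem aux_neg_smooth : ContMDiff (𝓡 2) (𝓡 2) (⊤ : ℕ∞) (fun x : S2 => -x) :=
  have := Fact.mk (@finrank_euclideanSpace_fin ℝ _ (2 + 1))
  contMDiff_neg_sphere (E := E3) (n := 2)

theorem aux_comp_neg (g : S2 → E3) (hg : IsImmersion g) : IsImmersion (fun x => g (-x)) := by
  refine ⟨hg.1.comp aux_neg_smooth, fun x => ?_⟩
  have dn : ∀ y : S2, MDifferentiableAt (𝓡 2) (𝓡 2) (fun x : S2 => -x) y := fun y =>
    aux_neg_smooth.mdifferentiableAt (by simp)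
  have dg : MDifferentiableAt (𝓡 2) 𝓘(ℝ, E3) g (-x) := hg.1.mdifferentiableAt (by simp)
  have h1 := mfderiv_comp x dg (dn x)
  have h2 := mfderiv_comp x (dn (-x)) (dn x)
  have h3 : ((fun x : S2 => -x) ∘ fun x : S2 => -x) = id := by
    funext y; simp
  rw [h3, mfderiv_id] at h2
  change Function.Injective (mfderiv (𝓡 2) 𝓘(ℝ, E3) (g ∘ fun x => -x) x)
  rw [h1]
  refine (hg.2 (-x)).comp ?_
  intro v w hvw
  have hv := DFunLike.congr_fun h2 v
  have hw := DFunLike.congr_fun h2 w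
  refine hv.trans (Eq.trans ?_ hw.symm)
  exact congrArg (mfderiv (𝓡 2) (𝓡 2) (fun x : S2 => -x) (-x)) hvw

def auxRho (t : ℝ) : ℝ := Real.smoothTransition (1 - 3 * t) + Real.smoothTransition (3 * t - 2)

theorem auxRho_mem (t : ℝ) : auxRho t ∈ Set.Icc (0 : ℝ) 1 := by
  unfold auxRho
  refine ⟨add_nonneg (Real.smoothTransition.nonneg _) (Real.smoothTransition.nonneg _), ?_⟩
  rcases le_total t (1/2) with h | h
  · rw [Real.smoothTransition.zero_of_nonpos (x := 3 * t - 2) (by linarith), add_zero]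
    exact Real.smoothTransition.le_one _
  · rw [Real.smoothTransition.zero_of_nonpos (x := 1 - 3 * t) (by linarith), zero_add]
    exact Real.smoothTransition.le_one _

theorem auxRho_smooth : ContDiff ℝ (⊤ : ℕ∞) auxRho := by
  unfold auxRho
  exact (Real.smoothTransition.contDiff.comp (by fun_prop)).add
    (Real.smoothTransition.contDiff.comp (by fun_prop))

theorem auxRho_zero : auxRho 0 = 1 := by
  unfold auxRho
  rw [Real.smoothTransition.one_of_one_le (by norm_num),
    Real.smoothTransition.zero_of_nonpos (by norm_num), add_zero]

theorem auxRho_one : auxRho 1 = 1 := by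
  unfold auxRho
  rw [Real.smoothTransition.one_of_one_le (x := 3 * 1 - 2) (by norm_num),
    Real.smoothTransition.zero_of_nonpos (by norm_num), zero_add]

theorem auxRho_mid {t : ℝ} (h1 : 1 / 3 ≤ t) (h2 : t ≤ 2 / 3) : auxRho t = 0 := by
  unfold auxRho
  rw [Real.smoothTransition.zero_of_nonpos (x := 3 * t - 2) (by linarith),
    Real.smoothTransition.zero_of_nonpos (by linarith), zero_add]

def auxR (t : Set.Icc (0 : ℝ) 1) : Set.Icc (0 : ℝ) 1 := ⟨auxRho t, auxRho_mem t⟩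

theorem auxR_smooth : ContMDiff (𝓡∂ 1) (𝓡∂ 1) (⊤ : ℕ∞) auxR := by
  have h1 : ContMDiff (𝓡∂ 1) 𝓘(ℝ, ℝ) (⊤ : ℕ∞) (fun t : Set.Icc (0 : ℝ) 1 => auxRho t) :=
    auxRho_smooth.contMDiff.comp contMDiff_subtypeVal_Icc
  have h2 := (contMDiffOn_projIcc (x := (0 : ℝ)) (y := 1) (n := (⊤ : ℕ∞))).comp_contMDiff h1
    (fun t => auxRho_mem t)
  have h3 : auxR = Set.projIcc (0 : ℝ) 1 zero_le_one ∘ fun t : Set.Icc (0 : ℝ) 1 => auxRho t := by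
    funext t
    exact (Set.projIcc_of_mem _ (auxRho_mem t)).symm
  rw [h3]
  exact h2

/-- Eversion via a Boy's-surface halfway model: if a smooth immersion
`f : S² → ℝ³` is invariant under the antipodal map (`f(−x) = f(x)`) and is
regularly homotopic to the standard inclusion `ι`, then `ι` is regularly
homotopic to `−ι`, i.e. a sphere eversion exists. -/
theorem eversion_from_boys_halfway_model
    (f : S2 → E3) (hf : IsImmersion f)
    (hsym : ∀ x : S2, f (-x) = f x)
    (hreg : RegularHomotopic f (fun x : S2 => (x : E3))) :
    RegularHomotopic (fun x : S2 => (x : E3)) (fun x : S2 => -(x : E3)) := by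
  obtain ⟨H, hH, h0, h1, him⟩ := hreg
  have hA : ContMDiff ((𝓡∂ 1).prod (𝓡 2)) 𝓘(ℝ, E3) (⊤ : ℕ∞)
      (fun p : Set.Icc (0 : ℝ) 1 × S2 => H (auxR p.1, p.2)) :=
    hH.comp ((auxR_smooth.comp contMDiff_fst).prodMk contMDiff_snd)
  have hB : ContMDiff ((𝓡∂ 1).prod (𝓡 2)) 𝓘(ℝ, E3) (⊤ : ℕ∞)
      (fun p : Set.Icc (0 : ℝ) 1 × S2 => H (auxR p.1, -p.2)) :=
    hH.comp ((auxR_smooth.comp contMDiff_fst).prodMk (aux_neg_smooth.comp contMDiff_snd))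
  have hmid : ∀ p : Set.Icc (0 : ℝ) 1 × S2, 1 / 3 ≤ (p.1 : ℝ) → (p.1 : ℝ) ≤ 2 / 3 →
      H (auxR p.1, p.2) = H (auxR p.1, -p.2) := by
    intro p ha hb
    have : auxR p.1 = ⟨0, by norm_num⟩ := Subtype.ext (auxRho_mid ha hb)
    rw [this, h0, h0, hsym]
  have hc : Continuous (fun p : Set.Icc (0 : ℝ) 1 × S2 => (p.1 : ℝ)) :=
    continuous_subtype_val.comp continuous_fst
  refine ⟨fun p => if (p.1 : ℝ) ≤ 1 / 2 then H (auxR p.1, p.2) else H (auxR p.1, -p.2),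
    ?_, ?_, ?_, ?_⟩
  · intro p
    rcases le_or_gt (p.1 : ℝ) (1 / 2) with hp | hp
    · refine (hA p).congr_of_eventuallyEq ?_
      filter_upwards [(isOpen_lt hc continuous_const).mem_nhds
        (show (p.1 : ℝ) < 2 / 3 by linarith)] with q hq
      have hq' : (q.1 : ℝ) < 2 / 3 := hq
      split_ifs with h
      · rfl
      · exact (hmid q (by linarith) hq'.le).symm
    · refine (hB p).congr_of_eventuallyEq ?_
      filter_upwards [(isOpen_lt continuous_const hc).mem_nhds
        (show 1 / 3 < (p.1 : ℝ) by linarith)] with q hq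
      have hq' : 1 / 3 < (q.1 : ℝ) := hq
      split_ifs with h
      · exact hmid q hq'.le (by linarith)
      · rfl
  · intro x
    have : auxR ⟨0, by norm_num⟩ = ⟨1, by norm_num⟩ := Subtype.ext auxRho_zero
    simp only [this, h1]
    norm_num
  · intro x
    have : auxR ⟨1, by norm_num⟩ = ⟨1, by norm_num⟩ := Subtype.ext auxRho_one
    simp only [this, h1]
    norm_num
  · intro t
    by_cases h : (t : ℝ) ≤ 1 / 2
    · simp only [h, if_true]
      exact him (auxR t)
    · simp only [h, if_false]
      exact aux_comp_neg _ (him (auxR t))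
end
end

section
/- General halfway-model principle: let h : S² → ℝ³ be a smooth immersion, let T : ℝ³ → ℝ³ be a linear isometry, and let σ : S² → S² be a diffeomorphism such that h ∘ σ = T ∘ h. If h is regularly homotopic to the standard inclusion ι : S² → ℝ³, then ι is regularly homotopic to the immersion x ↦ T⁻¹(σ(x)), i.e. to T⁻¹ ∘ ι ∘ σ. -/
open Metric Manifold

noncomputable section

theorem icc_smooth (φ : ℝ → ℝ) (hφ : ContDiff ℝ (⊤ : ℕ∞) φ) (h01 : ∀ t, φ t ∈ Set.Icc (0:ℝ) 1) :
    ContMDiff (𝓡∂ 1) (𝓡∂ 1) (⊤ : ℕ∞)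
      (fun t : Set.Icc (0:ℝ) 1 => (⟨φ t, h01 t⟩ : Set.Icc (0:ℝ) 1)) := by
  have h1 : ContMDiff (𝓡∂ 1) 𝓘(ℝ, ℝ) (⊤ : ℕ∞) (fun t : Set.Icc (0:ℝ) 1 => φ t) :=
    hφ.contMDiff.comp contMDiff_subtypeVal_Icc
  have h2 := (contMDiffOn_projIcc (x := (0:ℝ)) (y := 1) (n := ((⊤ : ℕ∞) : WithTop ℕ∞))).comp_contMDiff h1
    (fun t => h01 t)
  refine h2.congr ?_
  intro t
  exact (Set.projIcc_of_mem _ (h01 t)).symm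

theorem imm_symm (T : E3 ≃ₗᵢ[ℝ] E3)
    (σ : Diffeomorph (𝓡 2) (𝓡 2) S2 S2 (⊤ : ℕ∞)) (f : S2 → E3) (hf : IsImmersion f) :
    IsImmersion (fun x => T.symm (f (σ x))) := by
  have hT : ContDiff ℝ (⊤ : ℕ∞) (T.symm : E3 → E3) := T.symm.contDiff
  refine ⟨hT.contMDiff.comp (hf.1.comp σ.contMDiff), fun x => ?_⟩
  have hn : ((⊤ : ℕ∞) : WithTop ℕ∞) ≠ 0 := by simp
  have d1 : MDifferentiableAt (𝓡 2) (𝓡 2) σ x := σ.contMDiff.mdifferentiable hn x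
  have d2 : MDifferentiableAt (𝓡 2) 𝓘(ℝ, E3) f (σ x) := hf.1.mdifferentiable hn _
  have d3 : MDifferentiableAt 𝓘(ℝ, E3) 𝓘(ℝ, E3) T.symm (f (σ x)) :=
    hT.contMDiff.mdifferentiable hn _
  have e : mfderiv (𝓡 2) 𝓘(ℝ, E3) (fun x => T.symm (f (σ x))) x =
      (mfderiv 𝓘(ℝ, E3) 𝓘(ℝ, E3) T.symm (f (σ x))).comp
        ((mfderiv (𝓡 2) 𝓘(ℝ, E3) f (σ x)).comp (mfderiv (𝓡 2) (𝓡 2) σ x)) := by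
    rw [← mfderiv_comp x d2 d1]
    exact mfderiv_comp x d3 (d2.comp x d1)
  have i1 : Function.Injective (mfderiv (𝓡 2) (𝓡 2) σ x) := by
    rw [← σ.mfderivToContinuousLinearEquiv_coe hn]
    exact (σ.mfderivToContinuousLinearEquiv hn x).injective
  have i3 : Function.Injective (mfderiv 𝓘(ℝ, E3) 𝓘(ℝ, E3) T.symm (f (σ x))) := by
    rw [mfderiv_eq_fderiv]
    have : fderiv ℝ (T.symm : E3 → E3) (f (σ x)) = (T.symm.toContinuousLinearEquiv : E3 →L[ℝ] E3) :=
      T.symm.toContinuousLinearEquiv.fderiv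
    rw [this]
    exact T.symm.injective
  rw [e]
  exact i3.comp ((hf.2 _).comp i1)

/-- General halfway-model principle: if an immersion `h` of the sphere admits a
symmetry `h ∘ σ = T ∘ h` (with `T` an ambient linear isometry and `σ` a
diffeomorphism of the sphere), and `h` is regularly homotopic to the standard
inclusion `ι`, then `ι` is regularly homotopic to `T⁻¹ ∘ ι ∘ σ`. -/
theorem eversion_from_general_halfway_model
    (h : S2 → E3) (hh : IsImmersion h)
    (T : E3 ≃ₗᵢ[ℝ] E3)
    (σ : Diffeomorph (𝓡 2) (𝓡 2) S2 S2 (⊤ : ℕ∞))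
    (hsym : ∀ x : S2, h (σ x) = T (h x))
    (hreg : RegularHomotopic h (fun x : S2 => (x : E3))) :
    RegularHomotopic (fun x : S2 => (x : E3))
      (fun x : S2 => T.symm ((σ x : E3))) := by
  obtain ⟨G, hG, hG0, hG1, hGi⟩ := hreg
  have hs : ContDiff ℝ (⊤ : ℕ∞) Real.smoothTransition := Real.smoothTransition.contDiff
  have ha : ContDiff ℝ (⊤ : ℕ∞) (fun t : ℝ => Real.smoothTransition (1 - 3 * t)) :=
    hs.comp (by fun_prop)
  have hb : ContDiff ℝ (⊤ : ℕ∞) (fun t : ℝ => Real.smoothTransition (3 * t - 2)) :=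
    hs.comp (by fun_prop)
  have ma : ∀ t : ℝ, Real.smoothTransition (1 - 3 * t) ∈ Set.Icc (0:ℝ) 1 := fun t =>
    ⟨Real.smoothTransition.nonneg _, Real.smoothTransition.le_one _⟩
  have mb : ∀ t : ℝ, Real.smoothTransition (3 * t - 2) ∈ Set.Icc (0:ℝ) 1 := fun t =>
    ⟨Real.smoothTransition.nonneg _, Real.smoothTransition.le_one _⟩
  have sa := icc_smooth _ ha ma
  have sb := icc_smooth _ hb mb
  have hT : ContDiff ℝ (⊤ : ℕ∞) (T.symm : E3 → E3) := T.symm.contDiff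
  let A : Set.Icc (0:ℝ) 1 → Set.Icc (0:ℝ) 1 := fun t => ⟨_, ma t⟩
  let B : Set.Icc (0:ℝ) 1 → Set.Icc (0:ℝ) 1 := fun t => ⟨_, mb t⟩
  have hA0 : ∀ t : Set.Icc (0:ℝ) 1, 1/3 ≤ (t:ℝ) → A t = ⟨0, by norm_num⟩ := fun t ht =>
    Subtype.ext (Real.smoothTransition.zero_of_nonpos (by linarith))
  have hA1 : ∀ t : Set.Icc (0:ℝ) 1, (t:ℝ) ≤ 0 → A t = ⟨1, by norm_num⟩ := fun t ht =>
    Subtype.ext (Real.smoothTransition.one_of_one_le (by linarith))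
  have hB0 : ∀ t : Set.Icc (0:ℝ) 1, (t:ℝ) ≤ 2/3 → B t = ⟨0, by norm_num⟩ := fun t ht =>
    Subtype.ext (Real.smoothTransition.zero_of_nonpos (by linarith))
  have hB1 : ∀ t : Set.Icc (0:ℝ) 1, 1 ≤ (t:ℝ) → B t = ⟨1, by norm_num⟩ := fun t ht =>
    Subtype.ext (Real.smoothTransition.one_of_one_le (by linarith))
  let H : Set.Icc (0:ℝ) 1 × S2 → E3 := fun p =>
    G (A p.1, p.2) + T.symm (G (B p.1, σ p.2)) - h p.2
  have hlow : ∀ (t : Set.Icc (0:ℝ) 1), (t:ℝ) ≤ 2/3 → ∀ x, H (t, x) = G (A t, x) := by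
    intro t ht x
    simp only [H]
    rw [hB0 t ht, hG0, hsym]
    simp
  have hhigh : ∀ (t : Set.Icc (0:ℝ) 1), 1/3 ≤ (t:ℝ) → ∀ x,
      H (t, x) = T.symm (G (B t, σ x)) := by
    intro t ht x
    simp only [H]
    rw [hA0 t ht, hG0]
    simp
  refine ⟨H, ?_, ?_, ?_, ?_⟩
  · have c1 : ContMDiff ((𝓡∂ 1).prod (𝓡 2)) 𝓘(ℝ, E3) (⊤ : ℕ∞)
        (fun p : Set.Icc (0:ℝ) 1 × S2 => G (A p.1, p.2)) :=
      hG.comp ((sa.comp contMDiff_fst).prodMk contMDiff_snd)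
    have c2 : ContMDiff ((𝓡∂ 1).prod (𝓡 2)) 𝓘(ℝ, E3) (⊤ : ℕ∞)
        (fun p : Set.Icc (0:ℝ) 1 × S2 => T.symm (G (B p.1, σ p.2))) :=
      hT.contMDiff.comp (hG.comp
        ((sb.comp contMDiff_fst).prodMk (σ.contMDiff.comp contMDiff_snd)))
    have c3 : ContMDiff ((𝓡∂ 1).prod (𝓡 2)) 𝓘(ℝ, E3) (⊤ : ℕ∞)
        (fun p : Set.Icc (0:ℝ) 1 × S2 => h p.2) := hh.1.comp contMDiff_snd
    exact (c1.add c2).sub c3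
  · intro x
    rw [hlow _ (by norm_num), hA1 _ le_rfl, hG1]
  · intro x
    rw [hhigh _ (by norm_num), hB1 _ le_rfl, hG1]
  · intro t
    rcases le_total (t:ℝ) (1/2) with ht | ht
    · have : (fun x => H (t, x)) = fun x => G (A t, x) :=
        funext (hlow t (by linarith))
      rw [this]
      exact hGi _
    · have : (fun x => H (t, x)) = fun x => T.symm (G (B t, σ x)) :=
        funext (hhigh t (by linarith))
      rw [this]
      exact imm_symm T σ (fun x => G (B t, x)) (hGi _)
end
end
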